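/- arXiv:1508.00827 — 2 statements merged into one kernel-verified Lean document; each statement's English description precedes it below -/
import Mathlib

section
/- Let s ≤ −1/2 and let ε > 0. Then there exist a time T ∈ (0, ε) and a smooth function u : ℝ × ℝ → ℂ which is 1-periodic in the first variable, satisfies the defocusing Wick ordered cubic nonlinear Schrödinger equation i ∂_t u(x,t) − ∂_x² u(x,t) + (|u(x,t)|² − 2 ∫₀¹ |u(y,t)|² dy) u(x,t) = 0 for all (x,t) ∈ ℝ × ℝ, and satisfies ‖u(·,0)‖_{H^s(𝕋)} < ε and ‖u(·,T)‖_{H^s(𝕋)} > ε^{−1}. -/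
open scoped Real

/-- Fourier coefficient of a 1-periodic function `f : ℝ → ℂ`:
`f̂(n) = ∫₀¹ f(x) e^{−2πinx} dx`. -/
noncomputable def fourierCoeff1 (f : ℝ → ℂ) (n : ℤ) : ℂ :=
  ∫ x in (0:ℝ)..1, f x * Complex.exp (-2 * (π : ℂ) * Complex.I * (n : ℂ) * (x : ℂ))

/-- Sobolev `H^s(𝕋)` norm: `‖f‖ = (Σ_{n∈ℤ} (1+n²)^s |f̂(n)|²)^{1/2}`. -/
noncomputable def HsNormT (s : ℝ) (f : ℝ → ℂ) : ℝ :=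
  Real.sqrt (∑' n : ℤ, ((1:ℝ) + (n:ℝ)^2) ^ s * ‖fourierCoeff1 f n‖^2)

section Helpers

open Set Metric
open scoped NNReal Topology ComplexConjugate Real

theorem ode_global_lip {E : Type*} [NormedAddCommGroup E] [NormedSpace ℝ E] [CompleteSpace E]
    (g : E → E) (K L : ℝ≥0) (hK : LipschitzWith K g) (hL : ∀ x, ‖g x‖ ≤ L) (x0 : E) :
    ∃ α : ℝ → E, α 0 = x0 ∧ ∀ t, HasDerivAt α (g (α t)) t := by
  have key : ∀ n : ℕ, ∃ α : ℝ → E, α 0 = x0 ∧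
      ∀ t ∈ Ioo (-((n:ℝ)+1)) ((n:ℝ)+1), HasDerivAt α (g (α t)) t := by
    intro n
    have h0 : (0:ℝ) ∈ Icc (-((n:ℝ)+1)) ((n:ℝ)+1) := by
      constructor <;> linarith [(Nat.cast_nonneg n : (0:ℝ) ≤ n)]
    have hp : IsPicardLindelof (fun _ : ℝ => g) (tmin := -((n:ℝ)+1)) (tmax := (n:ℝ)+1)
        ⟨0, h0⟩ x0 (L * ((n:ℝ≥0)+1)) 0 L K := by
      apply IsPicardLindelof.of_time_independent
      · exact fun x _ => hL x
      · exact hK.lipschitzOnWith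
      · simp
    obtain ⟨α, h1, h2⟩ := hp.exists_eq_forall_mem_Icc_hasDerivWithinAt₀
    refine ⟨α, h1, fun t ht => ?_⟩
    exact (h2 t (Ioo_subset_Icc_self ht)).hasDerivAt (Icc_mem_nhds ht.1 ht.2)
  choose A hA0 hA using key
  have huniq : ∀ m n : ℕ, m ≤ n → EqOn (A m) (A n) (Ioo (-((m:ℝ)+1)) ((m:ℝ)+1)) := by
    intro m n hmn
    have hmn' : (m:ℝ) ≤ n := by exact_mod_cast hmn
    have hm0 : (0:ℝ) ≤ m := Nat.cast_nonneg m
    apply ODE_solution_unique_of_mem_Ioo (v := fun _ => g) (s := fun _ => univ) (K := K) (t₀ := 0)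
    · exact fun t _ => hK.lipschitzOnWith
    · constructor <;> linarith
    · exact fun t ht => ⟨hA m t ht, trivial⟩
    · exact fun t ht => ⟨hA n t ⟨by linarith [ht.1], by linarith [ht.2]⟩, trivial⟩
    · rw [hA0, hA0]
  have hmem : ∀ t : ℝ, t ∈ Ioo (-((⌈|t|⌉₊:ℝ)+1)) ((⌈|t|⌉₊:ℝ)+1) := by
    intro t
    have := Nat.le_ceil |t|
    have h := abs_le.1 this
    exact ⟨by linarith [h.1], by linarith [h.2]⟩
  refine ⟨fun t => A ⌈|t|⌉₊ t, by simp [hA0], fun t => ?_⟩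
  set n := ⌈|t|⌉₊ with hn
  have h1 : HasDerivAt (A n) (g (A n t)) t := hA n t (hmem t)
  refine h1.congr_of_eventuallyEq ?_
  filter_upwards [Ioo_mem_nhds (hmem t).1 (hmem t).2] with s hs
  rcases le_total n ⌈|s|⌉₊ with h | h
  · exact (huniq _ _ h hs).symm
  · exact huniq _ _ h (hmem s)

theorem ode_global_cons {ι : Type*} [Fintype ι] (f : (ι → ℂ) → (ι → ℂ)) (hf : ContDiff ℝ 1 f)
    (hq : ∀ x, ∑ i, (conj (x i) * f x i).re = 0) (x0 : ι → ℂ) :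
    ∃ α : ℝ → ι → ℂ, α 0 = x0 ∧ ∀ t, HasDerivAt α (f (α t)) t := by
  set q : (ι → ℂ) → ℝ := fun x => ∑ i, ‖x i‖^2 with hqd
  have hq0 : ∀ x, 0 ≤ q x := fun x => Finset.sum_nonneg fun i _ => by positivity
  have hqc : ContDiff ℝ 1 q := by
    apply ContDiff.sum
    intro i _
    exact (contDiff_apply ℝ ℂ i).norm_sq ℝ
  let χ : ContDiffBump (0:ℝ) := ⟨q x0 + 1, q x0 + 2, by linarith [hq0 x0], by linarith⟩
  set g : (ι → ℂ) → (ι → ℂ) := fun x => (χ (q x)) • f x with hg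
  have hgc : ContDiff ℝ 1 g := (χ.contDiff.comp hqc).smul hf
  have hsupp : HasCompactSupport g := by
    apply HasCompactSupport.of_support_subset_isCompact
      (isCompact_closedBall (0 : ι → ℂ) (q x0 + 2))
    intro x hx
    have h1 : χ (q x) ≠ 0 := by
      intro h
      apply hx
      simp [hg, h]
    have h2 : q x ∈ ball (0:ℝ) (q x0 + 2) := by
      rw [← χ.support_eq]; exact h1
    rw [mem_ball_zero_iff, Real.norm_of_nonneg (hq0 x)] at h2
    rw [mem_closedBall_zero_iff, pi_norm_le_iff_of_nonneg (by linarith [hq0 x0])]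
    intro i
    have h3 : ‖x i‖^2 ≤ q x := Finset.single_le_sum (f := fun i => ‖x i‖^2)
      (fun i _ => by positivity) (Finset.mem_univ i)
    nlinarith [sq_nonneg (‖x i‖ - 1), hq0 x0]
  obtain ⟨K, hK⟩ := hgc.lipschitzWith_of_hasCompactSupport hsupp (by simp)
  obtain ⟨L, hL⟩ := hsupp.exists_bound_of_continuous hgc.continuous
  obtain ⟨α, h0, hα⟩ := ode_global_lip g K L.toNNReal hK
    (fun x => (hL x).trans (Real.le_coe_toNNReal L)) x0
  have hcons : ∀ t, q (α t) = q x0 := by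
    have hd : ∀ t, HasDerivAt (fun s => q (α s)) 0 t := by
      intro t
      have : HasDerivAt (fun s => q (α s)) (∑ i, 2 * inner ℝ (α t i) (g (α t) i)) t := by
        apply HasDerivAt.fun_sum
        intro i _
        exact (hasDerivAt_pi.1 (hα t) i).norm_sq
      convert this using 1
      rw [← Finset.mul_sum]
      have h4 : ∀ i, inner ℝ (α t i) (g (α t) i)
          = χ (q (α t)) * (conj (α t i) * f (α t) i).re := by
        intro i
        rw [Complex.inner]
        simp [hg]
        ring
      simp only [h4, ← Finset.mul_sum, hq]
      simp
    intro t
    have := is_const_of_deriv_eq_zero (fun s => (hd s).differentiableAt) (fun s => (hd s).deriv) t 0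
    rw [this, h0]
  refine ⟨α, h0, fun t => ?_⟩
  have : g (α t) = f (α t) := by
    have h1 : χ (q (α t)) = 1 := by
      apply χ.one_of_mem_closedBall
      rw [mem_closedBall_zero_iff, Real.norm_of_nonneg (hq0 _), hcons]
      change q x0 ≤ q x0 + 1
      linarith
    simp [hg, h1]
  rw [← this]
  exact hα t

noncomputable def tri (a b c : ℤ → ℂ) (n : ℤ) : ℂ :=
  ∑' p : ℤ × ℤ, a p.1 * conj (b (p.1 + p.2 - n)) * c p.2

def triEquiv : ℤ × (ℤ × ℤ) ≃ (ℤ × ℤ) × ℤ where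
  toFun q := (q.2, q.2.1 + q.2.2 - q.1)
  invFun r := (r.1.1 + r.1.2 - r.2, r.1)
  left_inv q := by ext <;> simp
  right_inv r := by ext <;> simp

theorem tri_core {𝕜 : Type*} [NormedField 𝕜] [CompleteSpace 𝕜] (f g h : ℤ → 𝕜)
    (hf : Summable fun n => ‖f n‖) (hg : Summable fun n => ‖g n‖) (hh : Summable fun n => ‖h n‖) :
    (∀ n, Summable fun p : ℤ × ℤ => f p.1 * g (p.1 + p.2 - n) * h p.2) ∧
    HasSum (fun n => ∑' p : ℤ × ℤ, f p.1 * g (p.1 + p.2 - n) * h p.2)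
      ((∑' n, f n) * (∑' n, g n) * (∑' n, h n)) := by
  have h1 : Summable fun p : ℤ × ℤ => ‖f p.1 * h p.2‖ := by
    simpa only [norm_mul] using hf.mul_of_nonneg hh (fun _ => norm_nonneg _) (fun _ => norm_nonneg _)
  have h2 : Summable fun r : (ℤ × ℤ) × ℤ => (f r.1.1 * h r.1.2) * g r.2 :=
    summable_mul_of_summable_norm (f := fun p : ℤ × ℤ => f p.1 * h p.2) h1 hg
  have h3 : (∑' r : (ℤ × ℤ) × ℤ, (f r.1.1 * h r.1.2) * g r.2)
      = (∑' n, f n) * (∑' n, g n) * (∑' n, h n) := by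
    rw [← tsum_mul_tsum_of_summable_norm (f := fun p : ℤ × ℤ => f p.1 * h p.2) h1 hg,
      ← tsum_mul_tsum_of_summable_norm hf hh]
    ring
  have h4 := h2.hasSum
  rw [h3] at h4
  have h5 : HasSum (fun q : ℤ × (ℤ × ℤ) => f q.2.1 * g (q.2.1 + q.2.2 - q.1) * h q.2.2)
      ((∑' n, f n) * (∑' n, g n) * (∑' n, h n)) := by
    have := (triEquiv.hasSum_iff).2 h4
    refine this.congr_fun ?_ 
    intro q
    simp [triEquiv]
    ring
  have h6 : ∀ n, Summable fun p : ℤ × ℤ => f p.1 * g (p.1 + p.2 - n) * h p.2 :=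
    fun n => h5.summable.prod_factor n
  exact ⟨h6, h5.prod_fiberwise fun n => (h6 n).hasSum⟩

theorem summable_tri (a b c : ℤ → ℂ) (B : ℝ) (ha : Summable fun n => ‖a n‖)
    (hc : Summable fun n => ‖c n‖) (hb : ∀ n, ‖b n‖ ≤ B) (n : ℤ) :
    Summable (fun p : ℤ × ℤ => a p.1 * conj (b (p.1 + p.2 - n)) * c p.2) ∧
    ‖tri a b c n‖ ≤ (∑' n, ‖a n‖) * B * (∑' n, ‖c n‖) := by
  have h1 : Summable fun p : ℤ × ℤ => ‖a p.1‖ * ‖c p.2‖ :=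
    ha.mul_of_nonneg hc (fun _ => norm_nonneg _) (fun _ => norm_nonneg _)
  have h2 : ∀ p : ℤ × ℤ, ‖a p.1 * conj (b (p.1 + p.2 - n)) * c p.2‖ ≤ B * (‖a p.1‖ * ‖c p.2‖) := by
    intro p
    rw [norm_mul, norm_mul, RCLike.norm_conj]
    calc ‖a p.1‖ * ‖b (p.1 + p.2 - n)‖ * ‖c p.2‖ ≤ ‖a p.1‖ * B * ‖c p.2‖ := by
          gcongr; exact hb _
      _ = _ := by ring
  refine ⟨Summable.of_norm_bounded (h1.mul_left B) h2, ?_⟩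
  refine (tsum_of_norm_bounded ((h1.mul_left B).hasSum) h2).trans_eq ?_
  rw [tsum_mul_left, ← ha.tsum_mul_tsum hc h1]
  ring

theorem norm_le_tsum (a : ℤ → ℂ) (ha : Summable fun n => ‖a n‖) (n : ℤ) : ‖a n‖ ≤ ∑' n, ‖a n‖ :=
  ha.le_tsum n (fun _ _ => norm_nonneg _)

theorem hasSum_tri (a b c : ℤ → ℂ) (ha : Summable fun n => ‖a n‖)
    (hb : Summable fun n => ‖b n‖) (hc : Summable fun n => ‖c n‖) :
    HasSum (tri a b c) ((∑' n, a n) * conj (∑' n, b n) * (∑' n, c n)) := by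
  have := (tri_core a (fun n => conj (b n)) c ha (by simpa using hb) hc).2
  rw [← Complex.conj_tsum] at this
  exact this

noncomputable def wt (k : ℕ) (n : ℤ) : ℝ := (1 + |(n:ℝ)|)^k

theorem wt_pos (k : ℕ) (n : ℤ) : 0 < wt k n := by unfold wt; positivity
theorem one_le_wt (k : ℕ) (n : ℤ) : 1 ≤ wt k n := by
  unfold wt; exact one_le_pow₀ (by linarith [abs_nonneg (n:ℝ)])

theorem wt_tri (k : ℕ) (n1 n2 n3 : ℤ) :
    wt k (n1 - n2 + n3) ≤ 3^k * (wt k n1 + wt k n2 + wt k n3) := by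
  unfold wt
  push_cast
  set x := |(n1:ℝ)|
  set y := |(n2:ℝ)|
  set z := |(n3:ℝ)|
  have hx : 0 ≤ x := abs_nonneg _
  have hy : 0 ≤ y := abs_nonneg _
  have hz : 0 ≤ z := abs_nonneg _
  have h : |(n1:ℝ) - n2 + n3| ≤ x + y + z :=
    (abs_add_le _ _).trans (by gcongr; exact abs_sub _ _)
  set m := max (max (1+x) (1+y)) (1+z) with hm
  have h1 : 1 + |(n1:ℝ) - n2 + n3| ≤ 3 * m := by
    have a1 : 1+x ≤ m := le_max_of_le_left (le_max_left _ _)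
    have a2 : 1+y ≤ m := le_max_of_le_left (le_max_right _ _)
    have a3 : 1+z ≤ m := le_max_right _ _
    linarith
  calc (1 + |(n1:ℝ) - n2 + n3|)^k ≤ (3*m)^k := by gcongr
    _ = 3^k * m^k := by rw [mul_pow]
    _ ≤ _ := by
      gcongr
      have p1 : 0 ≤ (1+x)^k := by positivity
      have p2 : 0 ≤ (1+y)^k := by positivity
      have p3 : 0 ≤ (1+z)^k := by positivity
      rcases max_choice (max (1+x) (1+y)) (1+z) with h | h
      · rcases max_choice (1+x) (1+y) with h' | h' <;> rw [hm, h, h'] <;> linarith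
      · rw [hm, h]; linarith

theorem summable_wt_tri (k : ℕ) (a : ℤ → ℂ) (ha : Summable fun n => wt k n * ‖a n‖) :
    Summable (fun n => wt k n * ‖tri a a a n‖) ∧
    ∑' n, wt k n * ‖tri a a a n‖ ≤ 3^(k+1) * (∑' n, ‖a n‖)^2 * ∑' n, wt k n * ‖a n‖ := by
  have hw0 : ∀ n, 0 ≤ wt k n * ‖a n‖ := fun n => mul_nonneg (wt_pos k n).le (norm_nonneg _)
  have ha' : Summable fun n => ‖a n‖ := by
    refine Summable.of_nonneg_of_le (fun _ => norm_nonneg _) (fun n => ?_) ha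
    exact le_mul_of_one_le_left (norm_nonneg _) (one_le_wt k n)
  have hn1 : Summable fun n => ‖‖a n‖‖ := by simpa using ha'
  have hn2 : Summable fun n => ‖wt k n * ‖a n‖‖ := by
    refine ha.congr fun n => ?_
    rw [Real.norm_of_nonneg (hw0 n)]
  obtain ⟨s1, t1⟩ := tri_core (fun n => wt k n * ‖a n‖) (fun n => ‖a n‖) (fun n => ‖a n‖) hn2 hn1 hn1
  obtain ⟨s2, t2⟩ := tri_core (fun n => ‖a n‖) (fun n => wt k n * ‖a n‖) (fun n => ‖a n‖) hn1 hn2 hn1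
  obtain ⟨s3, t3⟩ := tri_core (fun n => ‖a n‖) (fun n => ‖a n‖) (fun n => wt k n * ‖a n‖) hn1 hn1 hn2
  have hs := ((t1.add t2).add t3).mul_left ((3:ℝ)^k)
  have hle : ∀ n, wt k n * ‖tri a a a n‖ ≤ 3^k *
      ((∑' p : ℤ × ℤ, (wt k p.1 * ‖a p.1‖) * ‖a (p.1+p.2-n)‖ * ‖a p.2‖)
      + (∑' p : ℤ × ℤ, ‖a p.1‖ * (wt k (p.1+p.2-n) * ‖a (p.1+p.2-n)‖) * ‖a p.2‖)
      + (∑' p : ℤ × ℤ, ‖a p.1‖ * ‖a (p.1+p.2-n)‖ * (wt k p.2 * ‖a p.2‖))) := by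
    intro n
    have e1 : wt k n * ‖tri a a a n‖ = ‖∑' p : ℤ × ℤ, ((wt k n : ℝ) : ℂ) *
        (a p.1 * conj (a (p.1 + p.2 - n)) * a p.2)‖ := by
      rw [tsum_mul_left, norm_mul, Complex.norm_real, Real.norm_of_nonneg (wt_pos k n).le]
      rfl
    rw [e1]
    refine tsum_of_norm_bounded ((((s1 n).hasSum.add (s2 n).hasSum).add (s3 n).hasSum).mul_left
      ((3:ℝ)^k)) ?_
    intro p
    rw [norm_mul, Complex.norm_real, Real.norm_of_nonneg (wt_pos k n).le, norm_mul, norm_mul,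
      RCLike.norm_conj]
    have e2 := wt_tri k p.1 (p.1+p.2-n) p.2
    have e3 : p.1 - (p.1+p.2-n) + p.2 = n := by ring
    rw [e3] at e2
    calc wt k n * (‖a p.1‖ * ‖a (p.1 + p.2 - n)‖ * ‖a p.2‖)
        ≤ (3^k * (wt k p.1 + wt k (p.1+p.2-n) + wt k p.2)) *
          (‖a p.1‖ * ‖a (p.1 + p.2 - n)‖ * ‖a p.2‖) := by gcongr
      _ = _ := by ring
  have hsum := Summable.of_nonneg_of_le (fun n => mul_nonneg (wt_pos k n).le (norm_nonneg _)) hle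
    hs.summable
  refine ⟨hsum, ?_⟩
  refine (hsum.tsum_le_tsum hle hs.summable).trans_eq ?_
  rw [hs.tsum_eq, pow_succ]
  ring

theorem tri_diff (a l : ℤ → ℂ) (A B D1 D : ℝ) (ha : Summable fun n => ‖a n‖)
    (hl : Summable fun n => ‖l n‖) (hA : ∑' n, ‖a n‖ ≤ A) (hlA : ∑' n, ‖l n‖ ≤ A)
    (hB : ∀ n, ‖a n‖ ≤ B) (hlB : ∀ n, ‖l n‖ ≤ B)
    (hD1 : ∑' n, ‖a n - l n‖ ≤ D1) (hD : ∀ n, ‖a n - l n‖ ≤ D) (n : ℤ) :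
    ‖tri a a a n - tri l l l n‖ ≤ 2 * (A * B * D1) + A * A * D := by
  have hd : Summable fun n => ‖a n - l n‖ :=
    Summable.of_nonneg_of_le (fun _ => norm_nonneg _) (fun n => norm_sub_le _ _) (ha.add hl)
  have hA0 : 0 ≤ A := le_trans (tsum_nonneg fun _ => norm_nonneg _) hA
  have hB0 : 0 ≤ B := le_trans (norm_nonneg _) (hB 0)
  have hD0 : 0 ≤ D := le_trans (norm_nonneg _) (hD 0)
  have hD10 : 0 ≤ D1 := le_trans (tsum_nonneg fun _ => norm_nonneg _) hD1
  obtain ⟨s1, b1⟩ := summable_tri (fun n => a n - l n) a a B hd ha hB n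
  obtain ⟨s2, b2⟩ := summable_tri l (fun n => a n - l n) a D hl ha hD n
  obtain ⟨s3, b3⟩ := summable_tri l l (fun n => a n - l n) B hl hd hlB n
  obtain ⟨s4, -⟩ := summable_tri a a a B ha ha hB n
  obtain ⟨s5, -⟩ := summable_tri l l l B hl hl hlB n
  have e : tri a a a n - tri l l l n = tri (fun n => a n - l n) a a n
      + tri l (fun n => a n - l n) a n + tri l l (fun n => a n - l n) n := by
    unfold tri
    rw [← s4.tsum_sub s5, ← s1.tsum_add s2, ← (s1.add s2).tsum_add s3]
    congr 1
    ext p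
    simp only [map_sub]
    ring
  rw [e]
  have n1 : 0 ≤ ∑' n, ‖a n‖ := tsum_nonneg fun _ => norm_nonneg _
  have n2 : 0 ≤ ∑' n, ‖l n‖ := tsum_nonneg fun _ => norm_nonneg _
  have n3 : 0 ≤ ∑' n, ‖a n - l n‖ := tsum_nonneg fun _ => norm_nonneg _
  have c1 : ‖tri (fun n => a n - l n) a a n‖ ≤ D1 * B * A := b1.trans (by gcongr)
  have c2 : ‖tri l (fun n => a n - l n) a n‖ ≤ A * D * A := b2.trans (by gcongr)
  have c3 : ‖tri l l (fun n => a n - l n) n‖ ≤ A * B * D1 := b3.trans (by gcongr)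
  refine (norm_add₃_le).trans ?_
  linarith

theorem bdry {E : Type*} [NormedAddCommGroup E] [NormedSpace ℝ E] (f f' : ℝ → E)
    (hf : ∀ t, HasDerivAt f (f' t) t) (T B0 : ℝ) (hT : 0 < T) (hB : 0 < B0) (h0 : ‖f 0‖ ≤ B0)
    (h : ∀ t ∈ Icc 0 T, ‖f t‖ ≤ 2 * B0 → ‖f' t‖ < B0 / T) :
    ∀ t ∈ Icc 0 T, ‖f t‖ ≤ 2 * B0 := by
  have hle : ∀ t ∈ Icc 0 T, B0 + B0 / T * t ≤ 2 * B0 := by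
    intro t ht
    have : B0 / T * t ≤ B0 / T * T := by
      have := ht.2
      gcongr
    rw [div_mul_cancel₀ _ hT.ne'] at this
    linarith
  have key := image_norm_le_of_norm_deriv_right_lt_deriv_boundary (a := 0) (b := T) (f := f)
    (f' := f') (fun t _ => (hf t).continuousAt.continuousWithinAt)
    (fun t _ => (hf t).hasDerivWithinAt) (B := fun t => B0 + B0 / T * t) (B' := fun _ => B0 / T)
    (by simpa using h0)
    (fun t => by simpa using ((hasDerivAt_id t).const_mul (B0 / T)).const_add B0)
    (fun t ht hft => h t (Ico_subset_Icc_self ht) (hft.trans_le (hle t (Ico_subset_Icc_self ht))))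
  intro t ht
  exact (key ht).trans (hle t ht)

noncomputable def l1v (s : Finset ℤ) (v : ℤ → ℂ) : PiLp 1 (fun _ : s => ℂ) :=
  WithLp.toLp 1 (fun i : s => v i)

theorem norm_l1v (s : Finset ℤ) (v : ℤ → ℂ) : ‖l1v s v‖ = ∑ n ∈ s, ‖v n‖ := by
  rw [PiLp.norm_eq_of_L1, ← Finset.sum_coe_sort s (fun n => ‖v n‖)]
  rfl

theorem hasDerivAt_l1v (s : Finset ℤ) (v v' : ℝ → ℤ → ℂ) (t : ℝ)
    (hv : ∀ n ∈ s, HasDerivAt (fun τ => v τ n) (v' t n) t) :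
    HasDerivAt (fun τ => l1v s (v τ)) (l1v s (v' t)) t := by
  have h1 : HasDerivAt (fun τ => (fun i : s => v τ i)) (fun i : s => v' t i) t :=
    hasDerivAt_pi.2 fun i => hv i i.2
  exact ((PiLp.continuousLinearEquiv 1 ℝ (fun _ : s => ℂ)).symm.hasFDerivAt).comp_hasDerivAt t h1

theorem l1_gronwall_pos (s : Finset ℤ) (v v' : ℝ → ℤ → ℂ)
    (hv : ∀ t, ∀ n ∈ s, HasDerivAt (fun τ => v τ n) (v' t n) t) (K : ℝ)
    (hK : ∀ t, ∑ n ∈ s, ‖v' t n‖ ≤ K * ∑ n ∈ s, ‖v t n‖) (t : ℝ) (ht : 0 ≤ t) :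
    ∑ n ∈ s, ‖v t n‖ ≤ (∑ n ∈ s, ‖v 0 n‖) * Real.exp (K * t) := by
  have hd := fun t => hasDerivAt_l1v s v v' t (hv t)
  have := norm_le_gronwallBound_of_norm_deriv_right_le (f := fun τ => l1v s (v τ))
    (f' := fun τ => l1v s (v' τ)) (δ := ∑ n ∈ s, ‖v 0 n‖) (K := K) (ε := 0) (a := 0) (b := t)
    (fun t _ => (hd t).continuousAt.continuousWithinAt)
    (fun t _ => (hd t).hasDerivWithinAt) (by rw [norm_l1v])
    (fun x _ => by rw [norm_l1v, norm_l1v, add_zero]; exact hK x) t ⟨ht, le_rfl⟩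
  rwa [gronwallBound_ε0, sub_zero, norm_l1v] at this

theorem l1_gronwall (s : Finset ℤ) (v v' : ℝ → ℤ → ℂ)
    (hv : ∀ t, ∀ n ∈ s, HasDerivAt (fun τ => v τ n) (v' t n) t) (K : ℝ)
    (hK : ∀ t, ∑ n ∈ s, ‖v' t n‖ ≤ K * ∑ n ∈ s, ‖v t n‖) (t : ℝ) :
    ∑ n ∈ s, ‖v t n‖ ≤ (∑ n ∈ s, ‖v 0 n‖) * Real.exp (K * |t|) := by
  rcases le_total 0 t with h | h
  · rw [abs_of_nonneg h]
    exact l1_gronwall_pos s v v' hv K hK t h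
  · rw [abs_of_nonpos h]
    have := l1_gronwall_pos s (fun τ => v (-τ)) (fun τ n => - v' (-τ) n) (fun t n hn => by
      have h1 := (hv (-t) n hn).scomp t (hasDerivAt_neg t)
      simpa [Function.comp_def] using h1) K (fun t => by simpa using hK (-t)) (-t) (by linarith)
    simpa using this

theorem l1_bdry (s : Finset ℤ) (v v' : ℝ → ℤ → ℂ)
    (hv : ∀ t, ∀ n ∈ s, HasDerivAt (fun τ => v τ n) (v' t n) t) (T B0 : ℝ) (hT : 0 < T)
    (hB : 0 < B0) (h0 : ∑ n ∈ s, ‖v 0 n‖ ≤ B0)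
    (h : ∀ t ∈ Icc 0 T, ∑ n ∈ s, ‖v t n‖ ≤ 2 * B0 → ∑ n ∈ s, ‖v' t n‖ < B0 / T) :
    ∀ t ∈ Icc 0 T, ∑ n ∈ s, ‖v t n‖ ≤ 2 * B0 := by
  have := bdry (fun τ => l1v s (v τ)) (fun τ => l1v s (v' τ))
    (fun t => hasDerivAt_l1v s v v' t (hv t)) T B0 hT hB (by rwa [norm_l1v])
    (by simpa only [norm_l1v] using h)
  simpa only [norm_l1v] using this

/-- mean value inequality in l1 -/
theorem l1_mvt (s : Finset ℤ) (v v' : ℝ → ℤ → ℂ)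
    (hv : ∀ t, ∀ n ∈ s, HasDerivAt (fun τ => v τ n) (v' t n) t) (T C : ℝ)
    (h : ∀ t ∈ Icc 0 T, ∑ n ∈ s, ‖v' t n‖ ≤ C) (t : ℝ) (ht : t ∈ Icc 0 T) :
    ∑ n ∈ s, ‖v t n - v 0 n‖ ≤ C * t := by
  have h1 := (convex_Icc 0 T).norm_image_sub_le_of_norm_hasDerivWithin_le
    (f := fun τ => l1v s (v τ)) (f' := fun τ => l1v s (v' τ)) (C := C)
    (fun t _ => (hasDerivAt_l1v s v v' t (hv t)).hasDerivWithinAt)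
    (fun t ht => by rw [norm_l1v]; exact h t ht) (left_mem_Icc.2 (ht.1.trans ht.2)) ht
  have h2 : l1v s (v t) - l1v s (v 0) = l1v s (fun n => v t n - v 0 n) := rfl
  rw [h2, norm_l1v] at h1
  simpa [abs_of_nonneg ht.1] using h1

theorem sup_bdry (s : Finset ℤ) (v v' : ℝ → ℤ → ℂ)
    (hv : ∀ t, ∀ n ∈ s, HasDerivAt (fun τ => v τ n) (v' t n) t) (T B0 : ℝ) (hT : 0 < T)
    (hB : 0 < B0) (h0 : ∀ n ∈ s, ‖v 0 n‖ ≤ B0)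
    (h : ∀ t ∈ Icc 0 T, (∀ n ∈ s, ‖v t n‖ ≤ 2 * B0) → ∀ n ∈ s, ‖v' t n‖ < B0 / T) :
    ∀ t ∈ Icc 0 T, ∀ n ∈ s, ‖v t n‖ ≤ 2 * B0 := by
  have := bdry (fun τ => (fun i : s => v τ i)) (fun τ => (fun i : s => v' τ i))
    (fun t => hasDerivAt_pi.2 fun i => hv t i i.2) T B0 hT hB
    ((pi_norm_le_iff_of_nonneg hB.le).2 fun i => h0 i i.2)
    (fun t ht hle => (pi_norm_lt_iff (div_pos hB hT)).2 fun i => h t ht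
      (fun n hn => (pi_norm_le_iff_of_nonneg (by positivity)).1 hle ⟨n, hn⟩) i i.2)
  intro t ht n hn
  exact (pi_norm_le_iff_of_nonneg (by positivity)).1 (this t ht) ⟨n, hn⟩

noncomputable def box (M : ℕ) : Finset ℤ := Finset.Icc (-(M:ℤ)) M

noncomputable def lam (n : ℤ) : ℝ := 4 * π^2 * (n:ℝ)^2

open Classical in
noncomputable def gv (M : ℕ) (a : ℤ → ℂ) (n : ℤ) : ℂ :=
  if n ∈ box M then Complex.I * (lam n * a n + tri a a a n) else 0

structure IsGal (M : ℕ) (a0 : ℤ → ℂ) (a : ℝ → ℤ → ℂ) : Prop where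
  initv : a 0 = a0
  supp : ∀ t n, n ∉ box M → a t n = 0
  deriv : ∀ t n, HasDerivAt (fun τ => a τ n) (gv M (a t) n) t

theorem tri_box {M : ℕ} {a : ℤ → ℂ} (ha : ∀ n ∉ box M, a n = 0) (n : ℤ) :
    tri a a a n = ∑ p1 ∈ box M, ∑ p2 ∈ box M, a p1 * conj (a (p1 + p2 - n)) * a p2 := by
  unfold tri
  rw [tsum_eq_sum (s := box M ×ˢ box M), Finset.sum_product]
  intro p hp
  rw [Finset.mem_product, not_and_or] at hp
  rcases hp with h | h
  · rw [ha _ h]; simp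
  · rw [ha _ h]; simp

noncomputable def bet (M : ℕ) (z a : ℤ → ℂ) (k : ℤ) : ℂ := ∑ n ∈ box M, z n * a (k - n)

theorem key_id {M : ℕ} {a : ℤ → ℂ} (ha : ∀ n ∉ box M, a n = 0) (z : ℤ → ℂ) :
    ∑ n ∈ box M, conj (z n) * tri a a a n
      = ∑ k ∈ box (2*M), conj (bet M z a k) * bet M a a k := by
  have hR : ∀ k, conj (bet M z a k) * bet M a a k
      = ∑ n ∈ box M, ∑ m ∈ box M, conj (z n) * conj (a (k - n)) * (a m * a (k - m)) := by
    intro k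
    unfold bet
    rw [map_sum, Finset.sum_mul_sum]
    simp only [map_mul]
  simp only [hR]
  rw [Finset.sum_comm]
  refine Finset.sum_congr rfl fun n _ => ?_
  rw [Finset.sum_comm, tri_box ha, Finset.mul_sum]
  refine Finset.sum_congr rfl fun m hm => ?_
  rw [Finset.mul_sum]
  symm
  rw [← tsum_eq_sum (L := SummationFilter.unconditional ℤ)
      (f := fun k => conj (z n) * conj (a (k - n)) * (a m * a (k - m))),
    ← tsum_eq_sum (L := SummationFilter.unconditional ℤ)
      (f := fun p2 => conj (z n) * (a m * conj (a (m + p2 - n)) * a p2)),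
    ← (Equiv.addLeft m).tsum_eq]
  · refine tsum_congr fun p => ?_
    simp
    ring
  · intro p hp
    rw [ha p hp]; simp
  · intro k hk
    have : k - m ∉ box M := by
      simp only [box, Finset.mem_Icc] at *
      omega
    rw [ha _ this]; simp

theorem gal_exists (M : ℕ) (a0 : ℤ → ℂ) (h0 : ∀ n ∉ box M, a0 n = 0) : ∃ a, IsGal M a0 a := by
  classical
  let ext : (box M → ℂ) → ℤ → ℂ := fun x n => if h : n ∈ box M then x ⟨n, h⟩ else 0
  have hext0 : ∀ x, ∀ n ∉ box M, ext x n = 0 := fun x n hn => by simp [ext, hn]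
  have hexti : ∀ x (i : box M), ext x i = x i := fun x i => by simp [ext]
  have hextc : ∀ n, ContDiff ℝ 1 (fun x => ext x n) := by
    intro n
    by_cases h : n ∈ box M
    · simp only [ext, h, dite_true]
      exact contDiff_apply ℝ ℂ (⟨n, h⟩ : box M)
    · simp only [ext, h, dite_false]
      exact contDiff_const
  let f : (box M → ℂ) → (box M → ℂ) := fun x i => gv M (ext x) i
  have hf : ContDiff ℝ 1 f := by
    rw [contDiff_pi]
    intro i
    have : (fun x => f x i) = fun x => Complex.I * (lam i * ext x i +
        ∑ p1 ∈ box M, ∑ p2 ∈ box M, ext x p1 * conj (ext x (p1 + p2 - i)) * ext x p2) := by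
      funext x
      simp only [f, gv, i.2, if_true]
      rw [tri_box (hext0 x)]
    rw [this]
    refine contDiff_const.mul ((contDiff_const.mul (hextc _)).add ?_)
    refine ContDiff.sum fun p1 _ => ContDiff.sum fun p2 _ => ?_
    refine ((hextc _).mul ?_).mul (hextc _)
    exact Complex.conjCLE.contDiff.comp (hextc _)
  have hq : ∀ x, ∑ i, (conj (x i) * f x i).re = 0 := by
    intro x
    have e1 : ∑ i, (conj (x i) * f x i).re
        = (∑ n ∈ box M, conj (ext x n) * (Complex.I * (lam n * ext x n + tri (ext x) (ext x) (ext x) n))).re := by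
      rw [← Finset.sum_coe_sort (box M), Complex.re_sum]
      refine Finset.sum_congr rfl fun i _ => ?_
      rw [hexti]
      simp only [f, gv, i.2, if_true, hexti]
    have e2 : (∑ n ∈ box M, conj (ext x n) * (Complex.I * (lam n * ext x n + tri (ext x) (ext x) (ext x) n)))
        = Complex.I * ((∑ n ∈ box M, ((lam n * ‖ext x n‖^2 : ℝ) : ℂ))
          + ∑ k ∈ box (2*M), ((‖bet M (ext x) (ext x) k‖^2 : ℝ) : ℂ)) := by
      have e3 := key_id (hext0 x) (ext x)
      have e4 : ∑ k ∈ box (2*M), ((‖bet M (ext x) (ext x) k‖^2 : ℝ) : ℂ)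
          = ∑ n ∈ box M, conj (ext x n) * tri (ext x) (ext x) (ext x) n := by
        rw [e3]
        refine Finset.sum_congr rfl fun k _ => ?_
        rw [Complex.conj_mul']; push_cast; rfl
      rw [e4, ← Finset.sum_add_distrib, Finset.mul_sum]
      refine Finset.sum_congr rfl fun n _ => ?_
      push_cast
      rw [← Complex.conj_mul']
      ring
    rw [e1, e2, ← Complex.ofReal_sum, ← Complex.ofReal_sum, ← Complex.ofReal_add,
      Complex.I_mul_re, Complex.ofReal_im, neg_zero]
  obtain ⟨α, hα0, hα⟩ := ode_global_cons f hf hq (fun i => a0 i)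
  refine ⟨fun t => ext (α t), ?_, fun t n hn => hext0 _ n hn, ?_⟩
  · funext n
    by_cases h : n ∈ box M
    · simp [ext, h, hα0]
    · simp [ext, h, h0]
  · intro t n
    by_cases h : n ∈ box M
    · have := hasDerivAt_pi.1 (hα t) ⟨n, h⟩
      simpa [ext, h] using this
    · simpa [ext, h, gv] using hasDerivAt_const t (0:ℂ)

theorem gal_mass {M : ℕ} {a0 : ℤ → ℂ} {a : ℝ → ℤ → ℂ} (h : IsGal M a0 a) (t : ℝ) :
    ∑ n ∈ box M, ‖a t n‖^2 = ∑ n ∈ box M, ‖a0 n‖^2 := by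
  have hd : ∀ t, HasDerivAt (fun s => ∑ n ∈ box M, ‖a s n‖^2) 0 t := by
    intro t
    have h1 : HasDerivAt (fun s => ∑ n ∈ box M, ‖a s n‖^2)
        (∑ n ∈ box M, 2 * inner ℝ (a t n) (gv M (a t) n)) t :=
      HasDerivAt.fun_sum fun n _ => (h.deriv t n).norm_sq
    convert h1 using 1
    have e2 : (∑ n ∈ box M, conj (a t n) * tri (a t) (a t) (a t) n)
        = ((∑ k ∈ box (2*M), ‖bet M (a t) (a t) k‖^2 : ℝ) : ℂ) := by
      rw [key_id (h.supp t), Complex.ofReal_sum]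
      refine Finset.sum_congr rfl fun k _ => ?_
      rw [Complex.conj_mul']; push_cast; rfl
    have e3 : ∀ n ∈ box M, 2 * inner ℝ (a t n) (gv M (a t) n)
        = -2 * (conj (a t n) * tri (a t) (a t) (a t) n).im := by
      intro n hn
      rw [Complex.inner]
      simp [gv, hn]
      ring
    rw [Finset.sum_congr rfl e3, ← Finset.mul_sum, ← Complex.im_sum, e2, Complex.ofReal_im]
    simp
  have := is_const_of_deriv_eq_zero (fun s => (hd s).differentiableAt) (fun s => (hd s).deriv) t 0
  refine this.trans ?_
  rw [h.initv]

noncomputable def ham (M : ℕ) (a : ℤ → ℂ) : ℝ :=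
  ∑ n ∈ box M, lam n * ‖a n‖^2 + 1/2 * ∑ k ∈ box (2*M), ‖bet M a a k‖^2

theorem bet_comm {M : ℕ} {z a : ℤ → ℂ} (hz : ∀ n ∉ box M, z n = 0) (ha : ∀ n ∉ box M, a n = 0)
    (k : ℤ) : bet M a z k = bet M z a k := by
  unfold bet
  rw [← tsum_eq_sum (L := SummationFilter.unconditional ℤ) (f := fun n => a n * z (k - n)),
    ← tsum_eq_sum (L := SummationFilter.unconditional ℤ) (f := fun n => z n * a (k - n)),
    ← (Equiv.subLeft k).tsum_eq]
  · refine tsum_congr fun p => ?_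
    simp
    ring
  · intro n hn; simp [hz n hn]
  · intro n hn; simp [ha n hn]

theorem gal_ham {M : ℕ} {a0 : ℤ → ℂ} {a : ℝ → ℤ → ℂ} (h : IsGal M a0 a) (t : ℝ) :
    ham M (a t) = ham M a0 := by
  have hd : ∀ t, HasDerivAt (fun s => ham M (a s)) 0 t := by
    intro t
    set z := gv M (a t) with hz
    have hz0 : ∀ n ∉ box M, z n = 0 := fun n hn => by simp [hz, gv, hn]
    have hb : ∀ k, HasDerivAt (fun s => bet M (a s) (a s) k) (2 * bet M z (a t) k) t := by
      intro k
      have : HasDerivAt (fun s => bet M (a s) (a s) k) (bet M z (a t) k + bet M (a t) z k) t := by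
        unfold bet
        rw [← Finset.sum_add_distrib]
        exact HasDerivAt.fun_sum fun n _ => (h.deriv t n).mul (h.deriv t (k - n))
      rw [bet_comm hz0 (h.supp t)] at this
      convert this using 1
      ring
    have h1 : HasDerivAt (fun s => ham M (a s))
        (∑ n ∈ box M, lam n * (2 * inner ℝ (a t n) (z n)) +
          1/2 * ∑ k ∈ box (2*M), 2 * inner ℝ (bet M (a t) (a t) k) (2 * bet M z (a t) k)) t := by
      unfold ham
      refine HasDerivAt.add (HasDerivAt.fun_sum fun n _ => ((h.deriv t n).norm_sq).const_mul _) ?_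
      exact (HasDerivAt.fun_sum fun k _ => (hb k).norm_sq).const_mul _
    convert h1 using 1
    have e1 : ∑ k ∈ box (2*M), 2 * inner ℝ (bet M (a t) (a t) k) (2 * bet M z (a t) k)
        = 4 * (∑ n ∈ box M, conj (z n) * tri (a t) (a t) (a t) n).re := by
      rw [key_id (h.supp t), Complex.re_sum, Finset.mul_sum]
      refine Finset.sum_congr rfl fun k _ => ?_
      rw [Complex.inner]
      simp
      ring
    have e2 : ∀ n ∈ box M, lam n * (2 * inner ℝ (a t n) (z n))
        = -2 * (conj (z n) * tri (a t) (a t) (a t) n).re := by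
      intro n hn
      rw [Complex.inner]
      simp [hz, gv, hn]
      ring
    rw [e1, Finset.sum_congr rfl e2, ← Finset.mul_sum, ← Complex.re_sum]
    ring
  have := is_const_of_deriv_eq_zero (fun s => (hd s).differentiableAt) (fun s => (hd s).deriv) t 0
  refine this.trans ?_
  rw [h.initv]

theorem box_mono {M0 M : ℕ} (h : M0 ≤ M) : box M0 ⊆ box M := by
  intro n hn
  simp only [box, Finset.mem_Icc] at *
  omega

theorem sum_box_eq {E : Type*} [AddCommMonoid E] {M0 M : ℕ} (h : M0 ≤ M) (f : ℤ → E)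
    (hf : ∀ n ∉ box M0, f n = 0) : ∑ n ∈ box M, f n = ∑ n ∈ box M0, f n :=
  (Finset.sum_subset (box_mono h) fun n _ hn => hf n hn).symm

theorem tsum_box {M : ℕ} (f : ℤ → ℝ) (hf : ∀ n ∉ box M, f n = 0) :
    Summable f ∧ ∑' n, f n = ∑ n ∈ box M, f n :=
  ⟨summable_of_ne_finset_zero (s := box M) hf, tsum_eq_sum hf⟩

theorem ham_eq {M0 M : ℕ} (h : M0 ≤ M) {a0 : ℤ → ℂ} (h0 : ∀ n ∉ box M0, a0 n = 0) :
    ham M a0 = ham M0 a0 := by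
  have hM : ∀ n ∉ box M, a0 n = 0 := fun n hn => h0 n fun h' => hn (box_mono h h')
  have key : ∀ K : ℕ, (∀ n ∉ box K, a0 n = 0) → ∑ k ∈ box (2*K), ‖bet K a0 a0 k‖^2
      = (∑ n ∈ box K, conj (a0 n) * tri a0 a0 a0 n).re := by
    intro K hK
    rw [key_id hK, Complex.re_sum]
    refine Finset.sum_congr rfl fun k _ => ?_
    rw [Complex.conj_mul', ← Complex.ofReal_pow, Complex.ofReal_re]
  unfold ham
  rw [key M hM, key M0 h0, sum_box_eq h, sum_box_eq h]
  · intro n hn; simp [h0 n hn]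
  · intro n hn; simp [h0 n hn]

theorem summable_inv_sq : Summable fun n : ℤ => 1 / (1 + (n:ℝ)^2) := by
  have h1 : Summable fun n : ℤ => 1 / (n:ℝ)^2 := Real.summable_one_div_int_pow.2 (by norm_num)
  refine h1.of_norm_bounded_eventually ?_
  rw [Filter.eventually_cofinite]
  refine (Set.finite_singleton (0:ℤ)).subset ?_
  intro n hn
  by_contra h
  apply hn
  have h : n ≠ 0 := h
  have : (0:ℝ) < (n:ℝ)^2 := by positivity
  rw [Real.norm_of_nonneg (by positivity)]
  gcongr
  linarith

theorem gal_l1 (M0 : ℕ) (a0 : ℤ → ℂ) (h0 : ∀ n ∉ box M0, a0 n = 0) :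
    ∃ W : ℝ, 0 ≤ W ∧ ∀ M ≥ M0, ∀ a, IsGal M a0 a → ∀ t, ∑' n, ‖a t n‖ ≤ W := by
  set S := ∑' n : ℤ, 1 / (1 + (n:ℝ)^2) with hS
  set m := ∑ n ∈ box M0, ‖a0 n‖^2 with hm
  have key : ∀ M ≥ M0, ∀ a, IsGal M a0 a → ∀ t, ∑' n, ‖a t n‖ ≤ 1/2 * (S + (m + ham M0 a0)) := by
    intro M hM a ha t
    rw [(tsum_box (fun n => ‖a t n‖) fun n hn => by simp [ha.supp t n hn]).2]
    have e1 : ∀ n ∈ box M, ‖a t n‖ ≤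
        1/2 * (1 / (1 + (n:ℝ)^2) + (‖a t n‖^2 + lam n * ‖a t n‖^2)) := by
      intro n _
      have hl : (n:ℝ)^2 ≤ lam n := by
        unfold lam
        have : (1:ℝ) ≤ 4 * π^2 := by nlinarith [Real.pi_gt_three]
        nlinarith [sq_nonneg (n:ℝ)]
      have hp : 0 < 1 + (n:ℝ)^2 := by positivity
      set x := ‖a t n‖
      have h3 : 2 * x ≤ 1 / (1 + (n:ℝ)^2) + (1 + (n:ℝ)^2) * x^2 := by
        have : 0 ≤ (1 + (n:ℝ)^2) * (x - 1/(1 + (n:ℝ)^2))^2 := by positivity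
        have e : (1 + (n:ℝ)^2) * (x - 1/(1 + (n:ℝ)^2))^2
            = (1 + (n:ℝ)^2) * x^2 - 2 * x + 1/(1 + (n:ℝ)^2) := by
          field_simp
          ring
        linarith
      nlinarith [sq_nonneg x]
    refine (Finset.sum_le_sum e1).trans ?_
    rw [← Finset.mul_sum, Finset.sum_add_distrib, Finset.sum_add_distrib, gal_mass ha]
    have e2 : ∑ n ∈ box M, 1 / (1 + (n:ℝ)^2) ≤ S :=
      summable_inv_sq.sum_le_tsum _ fun n _ => by positivity
    have e3 : ∑ n ∈ box M, lam n * ‖a t n‖^2 ≤ ham M0 a0 := by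
      rw [← ham_eq hM h0, ← gal_ham ha t]
      unfold ham
      have : 0 ≤ ∑ k ∈ box (2*M), ‖bet M (a t) (a t) k‖^2 :=
        Finset.sum_nonneg fun _ _ => by positivity
      linarith
    have e4 : ∑ n ∈ box M, ‖a0 n‖^2 = m := sum_box_eq hM _ fun n hn => by simp [h0 n hn]
    rw [e4]
    linarith
  refine ⟨max 0 (1/2 * (S + (m + ham M0 a0))), le_max_left _ _, fun M hM a ha t => ?_⟩
  exact (key M hM a ha t).trans (le_max_right _ _)

theorem norm_exp_lam (n : ℤ) (t : ℝ) : ‖Complex.exp (-Complex.I * lam n * t)‖ = 1 := by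
  have : -Complex.I * lam n * t = ((-(lam n * t) : ℝ) : ℂ) * Complex.I := by push_cast; ring
  rw [this, Complex.norm_exp_ofReal_mul_I]

theorem gal_ip {M : ℕ} {a0 : ℤ → ℂ} {a : ℝ → ℤ → ℂ} (h : IsGal M a0 a) (t : ℝ) (n : ℤ)
    (hn : n ∈ box M) : HasDerivAt (fun τ : ℝ => Complex.exp (-Complex.I * lam n * τ) * a τ n)
      (Complex.exp (-Complex.I * lam n * t) * (Complex.I * tri (a t) (a t) (a t) n)) t := by
  have h1 : HasDerivAt (fun τ : ℝ => Complex.exp (-Complex.I * lam n * τ))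
      (Complex.exp (-Complex.I * lam n * t) * (-Complex.I * lam n * 1)) t :=
    (((hasDerivAt_id t).ofReal_comp).const_mul _).cexp
  refine (h1.mul (h.deriv t n)).congr_deriv ?_
  simp only [gv, hn, if_true]
  ring

theorem gal_wt (M0 : ℕ) (a0 : ℤ → ℂ) (h0 : ∀ n ∉ box M0, a0 n = 0) (k : ℕ) (T : ℝ) :
    ∃ C : ℝ, ∀ M ≥ M0, ∀ a, IsGal M a0 a → ∀ t, |t| ≤ T → ∑' n, wt k n * ‖a t n‖ ≤ C := by
  obtain ⟨W, hW0, hW⟩ := gal_l1 M0 a0 h0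
  refine ⟨(∑ n ∈ box M0, wt k n * ‖a0 n‖) * Real.exp (3^(k+1) * W^2 * T), ?_⟩
  intro M hM a ha t ht
  have hs := fun t : ℝ => tsum_box (M := M) (fun n => wt k n * ‖a t n‖)
    (fun n hn => by simp [ha.supp t n hn])
  have := l1_gronwall (box M) (fun τ n => wt k n * (Complex.exp (-Complex.I * lam n * τ) * a τ n))
    (fun τ n => wt k n * (Complex.exp (-Complex.I * lam n * τ) *
      (Complex.I * tri (a τ) (a τ) (a τ) n)))
    (fun t n hn => (gal_ip ha t n hn).const_mul _) (3^(k+1) * W^2) (by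
      intro t
      simp only [norm_mul, norm_exp_lam, Complex.norm_real, Real.norm_of_nonneg (wt_pos k _).le,
        one_mul, Complex.norm_I]
      rw [← (hs t).2]
      obtain ⟨s1, b1⟩ := summable_wt_tri k (a t) (hs t).1
      refine (s1.sum_le_tsum _ fun n _ => mul_nonneg (wt_pos k n).le (norm_nonneg _)).trans
        (b1.trans ?_)
      have n1 : 0 ≤ ∑' n, ‖a t n‖ := tsum_nonneg fun _ => norm_nonneg _
      have n2 : 0 ≤ ∑' n, wt k n * ‖a t n‖ :=
        tsum_nonneg fun n => mul_nonneg (wt_pos k n).le (norm_nonneg _)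
      gcongr
      exact hW M hM a ha t) t
  simp only [norm_mul, norm_exp_lam, Complex.norm_real, Real.norm_of_nonneg (wt_pos k _).le,
        one_mul, ← (hs t).2] at this
  refine this.trans ?_
  rw [ha.initv, sum_box_eq hM (fun n => wt k n * ‖a0 n‖) fun n hn => by simp [h0 n hn]]
  have : 0 ≤ ∑ n ∈ box M0, wt k n * ‖a0 n‖ :=
    Finset.sum_nonneg fun n _ => mul_nonneg (wt_pos k n).le (norm_nonneg _)
  gcongr

structure IsSol (a0 : ℤ → ℂ) (a : ℝ → ℤ → ℂ) : Prop where
  initv : a 0 = a0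
  decay : ∀ (k : ℕ) (T : ℝ), ∃ C : ℝ, ∀ t, |t| ≤ T → ∀ n, wt k n * ‖a t n‖ ≤ C
  deriv : ∀ t n, HasDerivAt (fun τ => a τ n)
    (Complex.I * (lam n * a t n + tri (a t) (a t) (a t) n)) t
  mass : ∀ t, ∑' n, ‖a t n‖^2 = ∑' n, ‖a0 n‖^2

theorem summable_inv_wt : Summable fun n : ℤ => 1 / wt 2 n := by
  refine Summable.of_nonneg_of_le (fun n => (div_pos one_pos (wt_pos 2 n)).le) (fun n => ?_)
    summable_inv_sq
  refine one_div_le_one_div_of_le (by positivity) ?_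
  unfold wt
  nlinarith [abs_nonneg (n:ℝ), sq_abs (n:ℝ)]

theorem l1_lip (s : Finset ℤ) (v v' : ℝ → ℤ → ℂ)
    (hv : ∀ t, ∀ n ∈ s, HasDerivAt (fun τ => v τ n) (v' t n) t) (T C : ℝ)
    (h : ∀ t ∈ Icc (-T) T, ∑ n ∈ s, ‖v' t n‖ ≤ C) (t r : ℝ) (ht : t ∈ Icc (-T) T)
    (hr : r ∈ Icc (-T) T) :
    ∑ n ∈ s, ‖v t n - v r n‖ ≤ C * |t - r| := by
  have h1 := (convex_Icc (-T) T).norm_image_sub_le_of_norm_hasDerivWithin_le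
    (f := fun τ => l1v s (v τ)) (f' := fun τ => l1v s (v' τ)) (C := C)
    (fun t _ => (hasDerivAt_l1v s v v' t (hv t)).hasDerivWithinAt)
    (fun t ht => by rw [norm_l1v]; exact h t ht) hr ht
  have h2 : l1v s (v t) - l1v s (v r) = l1v s (fun n => v t n - v r n) := rfl
  rw [h2, norm_l1v] at h1
  simpa using h1

theorem gal_summable {M : ℕ} {a0 : ℤ → ℂ} {a : ℝ → ℤ → ℂ} (ha : IsGal M a0 a) (k : ℕ) (t : ℝ) :
    Summable fun n => wt k n * ‖a t n‖ :=
  (tsum_box (M := M) _ (fun n hn => by simp [ha.supp t n hn])).1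

theorem gal_summable' {M : ℕ} {a0 : ℤ → ℂ} {a : ℝ → ℤ → ℂ} (ha : IsGal M a0 a) (t : ℝ) :
    Summable fun n => ‖a t n‖ :=
  (tsum_box (M := M) _ (fun n hn => by simp [ha.supp t n hn])).1

theorem lam_le (n : ℤ) : lam n ≤ 40 * wt 2 n := by
  unfold lam wt
  have h1 : 4 * π^2 ≤ 40 := by nlinarith [Real.pi_lt_d4, Real.pi_pos]
  have h2 : (n:ℝ)^2 ≤ (1 + |(n:ℝ)|)^2 := by nlinarith [abs_nonneg (n:ℝ), sq_abs (n:ℝ)]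
  calc 4 * π^2 * (n:ℝ)^2 ≤ 40 * (n:ℝ)^2 := by gcongr
    _ ≤ _ := by gcongr

theorem lam_nonneg (n : ℤ) : 0 ≤ lam n := by unfold lam; positivity

/-- uniform second order Taylor estimate -/
theorem gal_taylor (M0 : ℕ) (a0 : ℤ → ℂ) (h0 : ∀ n ∉ box M0, a0 n = 0) (T : ℝ) (n : ℤ) :
    ∃ K : ℝ, ∀ M ≥ M0, n ∈ box M → ∀ a, IsGal M a0 a → ∀ t r, |t| ≤ T → |r| ≤ T →
      ‖a r n - a t n - (r - t) * (Complex.I * (lam n * a t n + tri (a t) (a t) (a t) n))‖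
        ≤ K * |r - t| * |r - t| := by
  obtain ⟨W, hW0, hW⟩ := gal_l1 M0 a0 h0
  obtain ⟨C, hC⟩ := gal_wt M0 a0 h0 2 T
  set D := 40 * C + 3 * W^2 * W with hD
  refine ⟨lam n * D + 3 * W^2 * D, fun M hM hn a ha t r ht hr => ?_⟩
  have hgv : ∀ τ, |τ| ≤ T → ∑ k ∈ box M, ‖gv M (a τ) k‖ ≤ D := by
    intro τ hτ
    have e1 : ∀ k ∈ box M, ‖gv M (a τ) k‖ ≤ 40 * (wt 2 k * ‖a τ k‖) + wt 0 k * ‖tri (a τ) (a τ) (a τ) k‖ := by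
      intro k hk
      simp only [gv, hk, if_true, norm_mul, Complex.norm_I, one_mul]
      refine (norm_add_le _ _).trans ?_
      rw [norm_mul, Complex.norm_real, Real.norm_of_nonneg (lam_nonneg k)]
      have := mul_le_mul_of_nonneg_right (lam_le k) (norm_nonneg (a τ k))
      simp only [wt, pow_zero, one_mul] at *
      linarith
    refine (Finset.sum_le_sum e1).trans ?_
    rw [Finset.sum_add_distrib, ← Finset.mul_sum]
    have e2 : ∑ k ∈ box M, wt 2 k * ‖a τ k‖ ≤ C :=
      ((gal_summable ha 2 τ).sum_le_tsum _ fun k _ => mul_nonneg (wt_pos 2 k).le (norm_nonneg _)).trans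
        (hC M hM a ha τ hτ)
    obtain ⟨s1, b1⟩ := summable_wt_tri 0 (a τ) (gal_summable ha 0 τ)
    have e3 : ∑ k ∈ box M, wt 0 k * ‖tri (a τ) (a τ) (a τ) k‖ ≤ 3 * W^2 * W := by
      refine (s1.sum_le_tsum _ fun k _ => mul_nonneg (wt_pos 0 k).le (norm_nonneg _)).trans
        (b1.trans ?_)
      have hw := hW M hM a ha τ
      have : 0 ≤ ∑' n, ‖a τ n‖ := tsum_nonneg fun _ => norm_nonneg _
      simp only [wt, pow_zero, one_mul, zero_add, pow_one]
      gcongr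
    rw [hD]; linarith
  have hlip : ∀ τ, |τ| ≤ T → ∑' k, ‖a τ k - a t k‖ ≤ D * |τ - t| := by
    intro τ hτ
    have := l1_lip (box M) a (fun τ => gv M (a τ)) (fun t n _ => ha.deriv t n) T D
      (fun τ hτ => hgv τ (abs_le.2 hτ)) τ t (abs_le.1 hτ) (abs_le.1 ht)
    rwa [(tsum_box (M := M) (fun k => ‖a τ k - a t k‖)
      (fun k hk => by simp [ha.supp τ k hk, ha.supp t k hk])).2]
  have hFlip : ∀ τ, |τ| ≤ T → ‖gv M (a τ) n - gv M (a t) n‖ ≤ (lam n * D + 3 * W^2 * D) * |τ - t| := by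
    intro τ hτ
    have hsum : Summable fun k => ‖a τ k - a t k‖ :=
      (tsum_box (M := M) _ (fun k hk => by simp [ha.supp τ k hk, ha.supp t k hk])).1
    have hs1 := gal_summable' ha τ
    have hs2 := gal_summable' ha t
    have hle : ∀ k, ‖a τ k - a t k‖ ≤ D * |τ - t| := fun k =>
      (hsum.le_tsum k fun _ _ => norm_nonneg _).trans (hlip τ hτ)
    have h3 := tri_diff (a τ) (a t) W W _ _ hs1 hs2 (hW M hM a ha τ) (hW M hM a ha t)
      (fun k => (norm_le_tsum _ hs1 k).trans (hW M hM a ha τ))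
      (fun k => (norm_le_tsum _ hs2 k).trans (hW M hM a ha t)) (hlip τ hτ) hle n
    simp only [gv, hn, if_true]
    rw [← mul_sub, norm_mul, Complex.norm_I, one_mul, add_sub_add_comm, ← mul_sub]
    refine (norm_add_le _ _).trans ?_
    rw [norm_mul, Complex.norm_real, Real.norm_of_nonneg (lam_nonneg n)]
    have := mul_le_mul_of_nonneg_left (hle n) (lam_nonneg n)
    nlinarith
  have hK0 : 0 ≤ lam n * D + 3 * W^2 * D := by
    have hD0 : 0 ≤ D := (Finset.sum_nonneg fun _ _ => norm_nonneg _).trans (hgv t ht)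
    have := lam_nonneg n
    positivity
  have hseg : ∀ τ ∈ uIcc t r, |τ| ≤ T ∧ |τ - t| ≤ |r - t| := by
    intro τ hτ
    refine ⟨?_, abs_sub_left_of_mem_uIcc hτ⟩
    have : uIcc t r ⊆ Icc (-T) T := uIcc_subset_Icc (abs_le.1 ht) (abs_le.1 hr)
    exact abs_le.2 (this hτ)
  have h4 := (convex_uIcc t r).norm_image_sub_le_of_norm_hasDerivWithin_le
    (f := fun τ : ℝ => a τ n - (τ:ℂ) * gv M (a t) n)
    (f' := fun τ => gv M (a τ) n - 1 * gv M (a t) n)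
    (C := (lam n * D + 3 * W^2 * D) * |r - t|)
    (fun τ _ => ((ha.deriv τ n).sub
      (((hasDerivAt_id τ).ofReal_comp).mul_const _)).hasDerivWithinAt)
    (fun τ hτ => by
      rw [one_mul]
      exact (hFlip τ (hseg τ hτ).1).trans (mul_le_mul_of_nonneg_left (hseg τ hτ).2 hK0))
    left_mem_uIcc right_mem_uIcc
  have e : gv M (a t) n = Complex.I * (lam n * a t n + tri (a t) (a t) (a t) n) := by
    simp only [gv, hn, if_true]
  rw [e, Real.norm_eq_abs] at h4
  refine le_trans (le_of_eq ?_) h4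
  congr 1
  ring

theorem sol_exists (M0 : ℕ) (a0 : ℤ → ℂ) (h0 : ∀ n ∉ box M0, a0 n = 0) :
    ∃ a, IsSol a0 a ∧ ∀ t n ρ, (∀ M ≥ M0, ∀ b, IsGal M a0 b → ρ ≤ ‖b t n‖) → ρ ≤ ‖a t n‖ := by
  obtain ⟨W, hW0, hW⟩ := gal_l1 M0 a0 h0
  have hex : ∀ j : ℕ, ∃ a, IsGal (M0 + j) a0 a := fun j =>
    gal_exists _ a0 fun n hn => h0 n fun h => hn (box_mono (Nat.le_add_right _ _) h)
  choose A hA using hex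
  set U := Filter.hyperfilter ℕ with hU
  have hMj : ∀ j, M0 + j ≥ M0 := fun j => Nat.le_add_right _ _
  have hbW : ∀ j t n, ‖A j t n‖ ≤ W := fun j t n =>
    (norm_le_tsum _ (gal_summable' (hA j) t) n).trans (hW _ (hMj j) _ (hA j) t)
  have hlim : ∀ t n, ∃ z, Filter.Tendsto (fun j => A j t n) U (𝓝 z) := by
    intro t n
    obtain ⟨z, -, hz⟩ := (isCompact_closedBall (0:ℂ) W).ultrafilter_le_nhds'
      (U.map fun j => A j t n) (Ultrafilter.mem_map.2 (Filter.univ_mem' fun j => by simpa using hbW j t n))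
    exact ⟨z, hz⟩
  choose a ha using hlim
  have hwt : ∀ (k : ℕ) (T : ℝ), ∃ C, ∀ j t, |t| ≤ T → ∀ n, wt k n * ‖A j t n‖ ≤ C := by
    intro k T
    obtain ⟨C, hC⟩ := gal_wt M0 a0 h0 k T
    refine ⟨C, fun j t ht n => ?_⟩
    exact ((gal_summable (hA j) k t).le_tsum n
      fun n _ => mul_nonneg (wt_pos k n).le (norm_nonneg _)).trans (hC _ (hMj j) _ (hA j) t ht)
  have hbox : ∀ n : ℤ, ∀ᶠ j in (U : Filter ℕ), n ∈ box (M0 + j) := by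
    intro n
    have h1 : ∀ᶠ j : ℕ in Filter.atTop, n ∈ box (M0 + j) := by
      filter_upwards [Filter.eventually_ge_atTop n.natAbs] with j hj
      simp only [box, Finset.mem_Icc]
      omega
    rw [← Nat.cofinite_eq_atTop] at h1
    exact Filter.hyperfilter_le_cofinite h1
  have hdec : ∀ t, ∃ C, 0 ≤ C ∧ ∀ j n, ‖A j t n‖ ≤ C * (1 / wt 2 n) := by
    intro t
    obtain ⟨C, hC⟩ := hwt 2 |t|
    refine ⟨C, (mul_nonneg (wt_pos 2 0).le (norm_nonneg _)).trans (hC 0 t le_rfl 0), fun j n => ?_⟩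
    rw [mul_one_div, le_div_iff₀ (wt_pos 2 n), mul_comm]
    exact hC j t le_rfl n
  have htri : ∀ t n, Filter.Tendsto (fun j => tri (A j t) (A j t) (A j t) n) U
      (𝓝 (tri (a t) (a t) (a t) n)) := by
    intro t n
    obtain ⟨C, hC0, hC⟩ := hdec t
    refine tendsto_tsum_of_dominated_convergence
      (bound := fun p : ℤ × ℤ => (C * (1 / wt 2 p.1)) * W * (C * (1 / wt 2 p.2))) ?_ ?_ ?_
    · have h1 : Summable fun p : ℤ × ℤ => (1 / wt 2 p.1) * (1 / wt 2 p.2) :=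
        summable_inv_wt.mul_of_nonneg summable_inv_wt
          (fun n => (div_pos one_pos (wt_pos 2 n)).le) (fun n => (div_pos one_pos (wt_pos 2 n)).le)
      refine (h1.mul_left (C * W * C)).congr fun p => ?_
      ring
    · intro p
      exact ((ha t p.1).mul ((Complex.continuous_conj.tendsto _).comp (ha t _))).mul (ha t p.2)
    · refine Filter.Eventually.of_forall fun j p => ?_
      rw [norm_mul, norm_mul, RCLike.norm_conj]
      have := (div_pos one_pos (wt_pos 2 p.1)).le
      gcongr
      · exact hC j p.1
      · exact hbW j t _
      · exact hC j p.2
  refine ⟨a, ⟨?_, ?_, ?_, ?_⟩, ?_⟩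
  · ext n
    refine tendsto_nhds_unique (ha 0 n) ?_
    refine tendsto_const_nhds.congr fun j => ?_
    rw [(hA j).initv]
  · intro k T
    obtain ⟨C, hC⟩ := hwt k T
    refine ⟨C, fun t ht n => ?_⟩
    exact le_of_tendsto ((ha t n).norm.const_mul (wt k n))
      (Filter.Eventually.of_forall fun j => hC j t ht n)
  · intro t n
    obtain ⟨K, hK⟩ := gal_taylor M0 a0 h0 (|t| + 1) n
    have hest : ∀ r, |r| ≤ |t| + 1 →
        ‖a r n - a t n - (r - t) * (Complex.I * (lam n * a t n + tri (a t) (a t) (a t) n))‖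
        ≤ K * |r - t| * |r - t| := by
      intro r hr
      refine le_of_tendsto (((ha r n).sub (ha t n)).sub
        ((((ha t n).const_mul (lam n : ℂ)).add (htri t n)).const_mul Complex.I
          |>.const_mul ((r:ℂ) - t))).norm ?_
      filter_upwards [hbox n] with j hj
      exact hK _ (hMj j) hj _ (hA j) t r (by linarith) hr
    rw [hasDerivAt_iff_isLittleO]
    refine Asymptotics.IsBigO.trans_isLittleO (g := fun r : ℝ => (r - t) * (r - t)) ?_ ?_
    · refine Asymptotics.IsBigO.of_bound K ?_
      have : Icc (t - 1) (t + 1) ∈ 𝓝 t := Icc_mem_nhds (by linarith) (by linarith)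
      filter_upwards [this] with r hr
      have hr' : |r| ≤ |t| + 1 := by
        have h1 : |r - t| ≤ 1 := abs_le.2 ⟨by linarith [hr.1], by linarith [hr.2]⟩
        have h2 := abs_add_le (r - t) t
        rw [sub_add_cancel] at h2
        linarith
      have := hest r hr'
      rw [norm_mul, Real.norm_eq_abs, ← mul_assoc]
      simpa [Complex.real_smul] using this
    · have h1 : Filter.Tendsto (fun r : ℝ => r - t) (𝓝 t) (𝓝 0) := by
        have : ContinuousAt (fun r : ℝ => r - t) t := by fun_prop
        simpa [ContinuousAt] using this
      simpa using ((Asymptotics.isLittleO_one_iff ℝ).2 h1).mul_isBigO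
        (Asymptotics.isBigO_refl (fun r : ℝ => r - t) (𝓝 t))
  · intro t
    obtain ⟨C, hC0, hC⟩ := hdec t
    have h1 : Filter.Tendsto (fun j => ∑' n, ‖A j t n‖^2) U (𝓝 (∑' n, ‖a t n‖^2)) := by
      refine tendsto_tsum_of_dominated_convergence
        (bound := fun n : ℤ => W * (C * (1 / wt 2 n))) ?_ ?_ ?_
      · exact (summable_inv_wt.mul_left C).mul_left W
      · intro n
        exact (ha t n).norm.pow 2
      · refine Filter.Eventually.of_forall fun j n => ?_
        rw [norm_pow, norm_norm, sq]
        gcongr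
        · exact hbW j t n
        · exact hC j n
    refine tendsto_nhds_unique h1 (tendsto_const_nhds.congr fun j => ?_)
    rw [(tsum_box (M := M0 + j) (fun n => ‖A j t n‖^2) (fun n hn => by simp [(hA j).supp t n hn])).2,
      gal_mass (hA j), (tsum_box (M := M0) (fun n => ‖a0 n‖^2) (fun n hn => by simp [h0 n hn])).2,
      sum_box_eq (hMj j)]
    intro n hn; simp [h0 n hn]
  · intro t n ρ h
    exact ge_of_tendsto (ha t n).norm (Filter.Eventually.of_forall fun j => h _ (hMj j) _ (hA j))

open Classical in
noncomputable def dat (m : ℕ) (R : ℝ) (n : ℤ) : ℂ :=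
  if n ∈ Finset.Icc (2 * (m:ℤ)) (6 * m) then (R:ℂ) else 0

theorem dat_supp (m : ℕ) (R : ℝ) : ∀ n ∉ box (6 * m), dat m R n = 0 := by
  intro n hn
  unfold dat
  rw [if_neg]
  intro h
  apply hn
  simp only [box, Finset.mem_Icc] at *
  push_cast
  omega

theorem dat_norm (m : ℕ) (R : ℝ) (hR : 0 < R) (n : ℤ) : ‖dat m R n‖ ≤ R := by
  unfold dat
  split_ifs
  · rw [Complex.norm_real, Real.norm_of_nonneg hR.le]
  · simpa using hR.le

theorem dat_l1 (m : ℕ) (hm : 1 ≤ m) (R : ℝ) (hR : 0 < R) (M : ℕ) (hM : 6 * m ≤ M) :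
    ∑ n ∈ box M, ‖dat m R n‖ ≤ 5 * m * R := by
  classical
  have h1 : ∑ n ∈ box M, ‖dat m R n‖ = ∑ n ∈ Finset.Icc (2 * (m:ℤ)) (6 * m), ‖dat m R n‖ := by
    symm
    apply Finset.sum_subset
    · intro n hn
      simp only [box, Finset.mem_Icc] at *
      omega
    · intro n _ hn
      simp [dat, hn]
  rw [h1]
  refine (Finset.sum_le_card_nsmul _ _ R fun n _ => dat_norm m R hR n).trans ?_
  rw [Int.card_Icc, nsmul_eq_mul]
  have : (6 * (m:ℤ) + 1 - 2 * m).toNat = 4 * m + 1 := by omega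
  rw [this]
  push_cast
  have : (1:ℝ) ≤ m := by exact_mod_cast hm
  gcongr
  linarith

noncomputable def fre (m : ℕ) (R : ℝ) (t : ℝ) (n : ℤ) : ℂ :=
  Complex.exp (Complex.I * lam n * t) * dat m R n

theorem fre_norm (m : ℕ) (R t : ℝ) (n : ℤ) : ‖fre m R t n‖ = ‖dat m R n‖ := by
  have : Complex.I * lam n * t = ((lam n * t : ℝ) : ℂ) * Complex.I := by push_cast; ring
  rw [fre, norm_mul, this, Complex.norm_exp_ofReal_mul_I, one_mul]

theorem fre_term (m : ℕ) (hm : 1 ≤ m) (R : ℝ) (hR : 0 < R) (κ : ℝ) (hκ : κ ≤ 1/2880)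
    (t : ℝ) (ht : t ∈ Icc 0 (κ / m^2)) (n : ℤ) (hn0 : 0 ≤ n) (hn : n ≤ m) (p q : ℤ) :
    0 ≤ (Complex.exp (-Complex.I * lam n * t) *
      (fre m R t p * conj (fre m R t (p + q - n)) * fre m R t q)).re ∧
    (p ∈ Finset.Icc (2 * (m:ℤ)) (3 * m) → q ∈ Finset.Icc (2 * (m:ℤ)) (3 * m) →
      R^3 / 2 ≤ (Complex.exp (-Complex.I * lam n * t) *
      (fre m R t p * conj (fre m R t (p + q - n)) * fre m R t q)).re) := by
  classical
  by_cases h : p ∈ Finset.Icc (2 * (m:ℤ)) (6 * m) ∧ q ∈ Finset.Icc (2 * (m:ℤ)) (6 * m) ∧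
    p + q - n ∈ Finset.Icc (2 * (m:ℤ)) (6 * m)
  · obtain ⟨hp, hq, hr⟩ := h
    have e : Complex.exp (-Complex.I * lam n * t) *
      (fre m R t p * conj (fre m R t (p + q - n)) * fre m R t q) =
      ((R^3 : ℝ) : ℂ) * Complex.exp (((lam p + lam q - lam (p + q - n) - lam n) * t : ℝ) * Complex.I) := by
      simp only [fre, dat, hp, hq, hr, if_true, map_mul, ← Complex.exp_conj, Complex.conj_I,
        Complex.conj_ofReal]
      have : (((lam p + lam q - lam (p + q - n) - lam n) * t : ℝ) : ℂ) * Complex.I =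
        -Complex.I * lam n * t + Complex.I * lam p * t + -Complex.I * lam (p + q - n) * t
        + Complex.I * lam q * t := by push_cast; ring
      rw [this, Complex.exp_add, Complex.exp_add, Complex.exp_add]
      push_cast
      ring
    have key : 1/2 ≤ Real.cos ((lam p + lam q - lam (p + q - n) - lam n) * t) := by
      have hmpos : (0:ℝ) < m := by exact_mod_cast hm
      have hb : |(lam p + lam q - lam (p + q - n) - lam n) * t| ≤ 1 := by
        have hpi : 4 * π^2 ≤ 40 := by nlinarith [Real.pi_lt_d4, Real.pi_pos]
        have hb1 : |lam p + lam q - lam (p + q - n) - lam n| ≤ 40 * (72 * (m:ℝ)^2) := by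
          have e2 : lam p + lam q - lam (p + q - n) - lam n =
            4 * π^2 * ((p:ℝ)^2 + q^2 - ((p + q - n : ℤ):ℝ)^2 - n^2) := by
            unfold lam; push_cast; ring
          rw [e2, abs_mul, abs_of_nonneg (by positivity : 0 ≤ 4 * π^2)]
          have hz : |p^2 + q^2 - (p+q-n)^2 - n^2| ≤ 72 * (m:ℤ)^2 := by
            simp only [Finset.mem_Icc] at hp hq hr
            have hm0 : (0:ℤ) ≤ m := by positivity
            have i1 : p^2 ≤ (6 * (m:ℤ))^2 := pow_le_pow_left₀ (by linarith [hp.1]) hp.2 2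
            have i2 : q^2 ≤ (6 * (m:ℤ))^2 := pow_le_pow_left₀ (by linarith [hq.1]) hq.2 2
            have i3 : (p+q-n)^2 ≤ (6 * (m:ℤ))^2 := pow_le_pow_left₀ (by linarith [hr.1]) hr.2 2
            have i4 : n^2 ≤ (m:ℤ)^2 := pow_le_pow_left₀ hn0 hn 2
            have := sq_nonneg p
            have := sq_nonneg q
            have := sq_nonneg (p+q-n)
            have := sq_nonneg n
            have := sq_nonneg (m:ℤ)
            rw [abs_le]
            constructor <;> nlinarith
          have hz' : |(p:ℝ)^2 + q^2 - ((p + q - n : ℤ):ℝ)^2 - n^2| ≤ 72 * (m:ℝ)^2 := by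
            exact_mod_cast hz
          gcongr
        rw [abs_mul, abs_of_nonneg ht.1]
        calc _ ≤ 40 * (72 * (m:ℝ)^2) * (κ / m^2) := by
              have := ht.1
              gcongr
              exact ht.2
          _ = 2880 * κ := by field_simp; ring
          _ ≤ 1 := by linarith
      have h1 := Real.one_sub_sq_div_two_le_cos
        (x := (lam p + lam q - lam (p + q - n) - lam n) * t)
      have h2 := (sq_le_one_iff_abs_le_one _).2 hb
      linarith
    rw [e, Complex.re_ofReal_mul, Complex.exp_ofReal_mul_I_re]
    have hR3 : 0 < R^3 := by positivity
    constructor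
    · exact mul_nonneg hR3.le (by linarith)
    · intro _ _
      nlinarith
  · constructor
    · refine le_of_eq ?_
      rw [not_and_or, not_and_or] at h
      rcases h with h | h | h <;> simp [fre, dat, h]
    · intro h1 h2
      exfalso
      apply h
      simp only [Finset.mem_Icc] at *
      omega

theorem fre_lower (m : ℕ) (hm : 1 ≤ m) (R : ℝ) (hR : 0 < R) (κ : ℝ) (hκ : κ ≤ 1/2880)
    (t : ℝ) (ht : t ∈ Icc 0 (κ / m^2)) (n : ℤ) (hn0 : 0 ≤ n) (hn : n ≤ m) :
    (m:ℝ)^2 * R^3 / 2 ≤ (Complex.exp (-Complex.I * lam n * t) *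
      tri (fre m R t) (fre m R t) (fre m R t) n).re := by
  classical
  have hT := fun p q => fre_term m hm R hR κ hκ t ht n hn0 hn p q
  rw [tri_box (M := 6 * m) (fun n hn => by simp [fre, dat_supp m R n hn])]
  simp only [Finset.mul_sum, Complex.re_sum]
  set S := Finset.Icc (2 * (m:ℤ)) (3 * m) with hS
  have hsub : S ⊆ box (6 * m) := by
    intro n hn
    simp only [hS, box, Finset.mem_Icc] at *
    push_cast
    omega
  calc (m:ℝ)^2 * R^3 / 2 ≤ ∑ p ∈ S, ∑ q ∈ S, R^3 / 2 := by
        simp only [Finset.sum_const, nsmul_eq_mul, hS, Int.card_Icc]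
        have : (3 * (m:ℤ) + 1 - 2 * m).toNat = m + 1 := by omega
        rw [this]
        push_cast
        have hR3 : 0 < R^3 := by positivity
        have : (0:ℝ) ≤ m := by positivity
        nlinarith
    _ ≤ ∑ p ∈ S, ∑ q ∈ S, (Complex.exp (-Complex.I * lam n * t) *
      (fre m R t p * conj (fre m R t (p + q - n)) * fre m R t q)).re :=
        Finset.sum_le_sum fun p hp => Finset.sum_le_sum fun q hq => (hT p q).2 hp hq
    _ ≤ ∑ p ∈ S, ∑ q ∈ box (6 * m), (Complex.exp (-Complex.I * lam n * t) *
      (fre m R t p * conj (fre m R t (p + q - n)) * fre m R t q)).re :=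
        Finset.sum_le_sum fun p _ =>
          Finset.sum_le_sum_of_subset_of_nonneg hsub fun q _ _ => (hT p q).1
    _ ≤ _ := Finset.sum_le_sum_of_subset_of_nonneg hsub fun p _ _ =>
          Finset.sum_nonneg fun q _ => (hT p q).1

theorem gal_inflate (m : ℕ) (hm : 1 ≤ m) (R κ : ℝ) (hR : 0 < R) (hκ0 : 0 < κ)
    (hκ : κ ≤ 1/2880) (hκR : κ * R^2 ≤ 1/1000000) (M : ℕ) (hM : 6 * m ≤ M)
    (a : ℝ → ℤ → ℂ) (ha : IsGal M (dat m R) a) (n : ℤ) (hn0 : 0 ≤ n) (hn : n ≤ m) :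
    κ * R^3 / 4 ≤ ‖a (κ / m^2) n‖ := by
  have hmpos : (0:ℝ) < m := by exact_mod_cast hm
  set T := κ / (m:ℝ)^2 with hTdef
  have hT : 0 < T := by positivity
  have hTm : T * (m:ℝ)^2 = κ := by rw [hTdef]; field_simp
  set v : ℝ → ℤ → ℂ := fun τ n => Complex.exp (-Complex.I * lam n * τ) * a τ n with hv
  set v' : ℝ → ℤ → ℂ := fun τ n => Complex.exp (-Complex.I * lam n * τ) *
    (Complex.I * tri (a τ) (a τ) (a τ) n) with hv'
  have hd : ∀ t, ∀ n ∈ box M, HasDerivAt (fun τ => v τ n) (v' t n) t :=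
    fun t n hn => gal_ip ha t n hn
  have hvn : ∀ t n, ‖v t n‖ = ‖a t n‖ := fun t n => by
    simp only [hv, norm_mul, norm_exp_lam, one_mul]
  have hvn' : ∀ t n, ‖v' t n‖ = ‖tri (a t) (a t) (a t) n‖ := fun t n => by
    simp only [hv', norm_mul, norm_exp_lam, one_mul, Complex.norm_I]
  have hv0 : ∀ n, v 0 n = dat m R n := fun n => by simp [hv, ha.initv]
  have hts : ∀ t, ∑' n, ‖a t n‖ = ∑ n ∈ box M, ‖a t n‖ := fun t =>
    (tsum_box (M := M) (fun n => ‖a t n‖) (fun n hn => by simp [ha.supp t n hn])).2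
  have hmR : 0 < (m:ℝ) * R := by positivity
  have hsm : ∀ t, ∑ n ∈ box M, ‖a t n‖ ≤ 2 * (5 * m * R) → ∑ n ∈ box M, ‖v' t n‖ ≤ 3000 * (m * R)^3 := by
    intro t ht
    simp only [hvn']
    obtain ⟨s1, b1⟩ := summable_wt_tri 0 (a t) (gal_summable ha 0 t)
    simp only [wt, pow_zero, one_mul, zero_add, pow_one, hts] at s1 b1
    refine (s1.sum_le_tsum _ fun k _ => norm_nonneg _).trans (b1.trans ?_)
    have h0 : 0 ≤ ∑ n ∈ box M, ‖a t n‖ := Finset.sum_nonneg fun _ _ => norm_nonneg _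
    calc _ ≤ 3 * (2 * (5 * m * R))^2 * (2 * (5 * m * R)) := by gcongr
      _ = _ := by ring
  have hsmall : T * (m * R)^2 ≤ 1/1000000 := by
    calc T * (m*R)^2 = (T * m^2) * R^2 := by ring
      _ ≤ _ := by rw [hTm]; exact hκR
  have hl1 : ∀ t ∈ Icc 0 T, ∑ n ∈ box M, ‖a t n‖ ≤ 2 * (5 * m * R) := by
    have := l1_bdry (box M) v v' hd T (5 * m * R) hT (by positivity)
      (by simp only [hv0]; exact dat_l1 m hm R hR M hM)
      (fun t _ h => by
        simp only [hvn] at h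
        refine (hsm t h).trans_lt ?_
        rw [lt_div_iff₀ hT]
        calc 3000 * (m * R)^3 * T = 3000 * (m * R) * (T * (m * R)^2) := by ring
          _ ≤ 3000 * (m * R) * (1/1000000) := by gcongr
          _ < _ := by linarith)
    simpa only [hvn] using this
  have htrisup : ∀ t ∈ Icc 0 T, (∀ n, ‖a t n‖ ≤ 2 * R) → ∀ n, ‖v' t n‖ ≤ 200 * m^2 * R^3 := by
    intro t ht h n
    rw [hvn']
    refine (summable_tri (a t) (a t) (a t) (2 * R) (gal_summable' ha t) (gal_summable' ha t) h n).2.trans ?_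
    have h0 : 0 ≤ ∑ n ∈ box M, ‖a t n‖ := Finset.sum_nonneg fun _ _ => norm_nonneg _
    rw [hts]
    have := hl1 t ht
    calc _ ≤ (2 * (5 * m * R)) * (2 * R) * (2 * (5 * m * R)) := by gcongr
      _ = _ := by ring
  have hall : ∀ t, (∀ n ∈ box M, ‖a t n‖ ≤ 2 * R) → ∀ n, ‖a t n‖ ≤ 2 * R := by
    intro t h n
    by_cases hn : n ∈ box M
    · exact h n hn
    · rw [ha.supp t n hn]; simpa using hR.le
  have hsup : ∀ t ∈ Icc 0 T, ∀ n, ‖a t n‖ ≤ 2 * R := by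
    have := sup_bdry (box M) v v' hd T R hT hR
      (by intro n _; rw [hv0]; exact dat_norm m R hR n)
      (fun t ht h n _ => by
        simp only [hvn] at h
        refine (htrisup t ht (hall t h) n).trans_lt ?_
        rw [lt_div_iff₀ hT]
        calc 200 * m^2 * R^3 * T = 200 * R * (T * (m * R)^2) := by ring
          _ ≤ 200 * R * (1/1000000) := by gcongr
          _ < _ := by linarith)
    simp only [hvn] at this
    exact fun t ht => hall t (this t ht)
  -- closeness
  have hdiff : ∀ t n, ‖a t n - fre m R t n‖ = ‖v t n - v 0 n‖ := by
    intro t n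
    have : v t n - v 0 n = Complex.exp (-Complex.I * lam n * t) * (a t n - fre m R t n) := by
      rw [hv0, mul_sub, fre, ← mul_assoc, ← Complex.exp_add]
      have : -Complex.I * lam n * t + Complex.I * lam n * t = 0 := by ring
      rw [this, Complex.exp_zero, one_mul]
    rw [this, norm_mul, norm_exp_lam, one_mul]
  have hdz : ∀ t, ∀ n ∉ box M, a t n - fre m R t n = 0 := by
    intro t n hn
    have : dat m R n = 0 := dat_supp m R n fun h => hn (box_mono hM h)
    simp [ha.supp t n hn, fre, this]
  have hD1 : ∀ t ∈ Icc 0 T, ∑' n, ‖a t n - fre m R t n‖ ≤ 3000 * κ * R^2 * (m * R) := by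
    intro t ht
    rw [(tsum_box (M := M) (fun n => ‖a t n - fre m R t n‖) (fun n hn => by simp [hdz t n hn])).2]
    simp only [hdiff]
    refine (l1_mvt (box M) v v' hd T _ (fun t ht => hsm t (hl1 t ht)) t ht).trans ?_
    calc 3000 * (m * R)^3 * t ≤ 3000 * (m*R)^3 * T := by
          have := ht.2
          gcongr
      _ = 3000 * (T * m^2) * R^2 * (m * R) := by ring
      _ = _ := by rw [hTm]
  have hD : ∀ t ∈ Icc 0 T, ∀ n, ‖a t n - fre m R t n‖ ≤ 200 * κ * R^3 := by
    intro t ht n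
    by_cases hn : n ∈ box M
    · rw [hdiff]
      have := (convex_Icc 0 T).norm_image_sub_le_of_norm_hasDerivWithin_le
        (f := fun τ => v τ n) (f' := fun τ => v' τ n) (C := 200 * m^2 * R^3)
        (fun t _ => (hd t n hn).hasDerivWithinAt)
        (fun t ht => htrisup t ht (hsup t ht) n) (left_mem_Icc.2 hT.le) ht
      refine this.trans ?_
      rw [sub_zero, Real.norm_of_nonneg ht.1]
      calc 200 * m^2 * R^3 * t ≤ 200 * m^2 * R^3 * T := by
            have := ht.2
            gcongr
        _ = 200 * (T * m^2) * R^3 := by ring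
        _ = _ := by rw [hTm]
    · rw [hdz t n hn]; simp; positivity
  have htd : ∀ t ∈ Icc 0 T, ‖tri (a t) (a t) (a t) n - tri (fre m R t) (fre m R t) (fre m R t) n‖
      ≤ m^2 * R^3 / 4 := by
    intro t ht
    obtain ⟨f1, f2⟩ := tsum_box (M := M) (fun n => ‖fre m R t n‖) (fun n hn => by
      simp [fre_norm, dat_supp m R n fun h => hn (box_mono hM h)])
    have := tri_diff (a t) (fre m R t) (2 * (5 * m * R)) (2 * R) _ _ (gal_summable' ha t) f1
      (by rw [hts]; exact hl1 t ht)
      (by rw [f2]; simp only [fre_norm]; linarith [dat_l1 m hm R hR M hM])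
      (hsup t ht) (fun n => by rw [fre_norm]; linarith [dat_norm m R hR n]) (hD1 t ht) (hD t ht) n
    refine this.trans ?_
    calc _ = 140000 * (κ * R^2) * (m^2 * R^3) := by ring
      _ ≤ 140000 * (1/1000000) * (m^2 * R^3) := by gcongr
      _ ≤ _ := by
        have : 0 < m^2 * R^3 := by positivity
        linarith
  have hnM : n ∈ box M := by
    simp only [box, Finset.mem_Icc]
    omega
  have hdim : ∀ t, HasDerivAt (fun τ => (v τ n).im) (v' t n).im t := fun t =>
    (Complex.imCLM.hasFDerivAt).comp_hasDerivAt t (hd t n hnM)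
  have hlow : ∀ t ∈ Icc 0 T, m^2 * R^3 / 4 ≤ (v' t n).im := by
    intro t ht
    have h1 := fre_lower m hm R hR κ hκ t ht n hn0 hn
    have h2 : (v' t n).im = (Complex.exp (-Complex.I * lam n * t) * tri (a t) (a t) (a t) n).re := by
      have : v' t n = Complex.I * (Complex.exp (-Complex.I * lam n * t) * tri (a t) (a t) (a t) n) := by
        simp only [hv']; ring
      rw [this, Complex.I_mul_im]
    have h3 : (Complex.exp (-Complex.I * lam n * t) *
        tri (fre m R t) (fre m R t) (fre m R t) n).re -
        (Complex.exp (-Complex.I * lam n * t) * tri (a t) (a t) (a t) n).re ≤ m^2 * R^3 / 4 := by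
      rw [← Complex.sub_re, ← mul_sub]
      refine (Complex.re_le_norm _).trans ?_
      rw [norm_mul, norm_exp_lam, one_mul, norm_sub_rev]
      exact htd t ht
    rw [h2]; linarith
  have hfin := (convex_Icc 0 T).mul_sub_le_image_sub_of_le_deriv (f := fun τ => (v τ n).im)
    (C := m^2 * R^3 / 4) (fun t _ => (hdim t).continuousAt.continuousWithinAt)
    (fun t _ => (hdim t).differentiableAt.differentiableWithinAt)
    (fun t ht => by rw [(hdim t).deriv]; exact hlow t (interior_subset ht))
    0 (left_mem_Icc.2 hT.le) T (right_mem_Icc.2 hT.le) hT.le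
  have h00 : v 0 n = 0 := by
    rw [hv0, dat, if_neg]
    simp only [Finset.mem_Icc]
    omega
  simp only [h00, Complex.zero_im, sub_zero] at hfin
  rw [← hvn]
  refine le_trans ?_ (Complex.im_le_norm _)
  refine le_trans (le_of_eq ?_) hfin
  rw [← hTm]; ring

noncomputable def frq (n : ℤ) : ℂ := 2 * (π:ℂ) * Complex.I * (n:ℂ)

noncomputable def ee (n : ℤ) (x : ℝ) : ℂ := Complex.exp (frq n * x)

/-- `j`-th derivative of the Fourier series -/
noncomputable def FS (j : ℕ) (b : ℤ → ℂ) (x : ℝ) : ℂ := ∑' n, (frq n)^j * b n * ee n x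

theorem norm_ee (n : ℤ) (x : ℝ) : ‖ee n x‖ = 1 := by
  have : frq n * x = ((2 * π * n * x : ℝ) : ℂ) * Complex.I := by unfold frq; push_cast; ring
  rw [ee, this, Complex.norm_exp_ofReal_mul_I]

theorem norm_frq (n : ℤ) : ‖frq n‖ ≤ 7 * (1 + |(n:ℝ)|) := by
  unfold frq
  rw [norm_mul, norm_mul, norm_mul, Complex.norm_I, Complex.norm_real, Complex.norm_intCast,
    Real.norm_of_nonneg Real.pi_pos.le, Complex.norm_ofNat]
  nlinarith [Real.pi_lt_d4, Real.pi_pos, abs_nonneg (n:ℝ)]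

theorem frq_sq (n : ℤ) : (lam n : ℂ) = -(frq n)^2 := by
  unfold lam frq
  rw [mul_pow, mul_pow, Complex.I_sq]
  push_cast
  ring

theorem hasDerivAt_ee (n : ℤ) (x : ℝ) : HasDerivAt (ee n) (frq n * ee n x) x := by
  have := (((hasDerivAt_id x).ofReal_comp).const_mul (frq n)).cexp
  refine this.congr_deriv ?_
  simp [ee]; ring

theorem term_bound (j : ℕ) (z : ℂ) (n : ℤ) (x C : ℝ) (h : wt (j+2) n * ‖z‖ ≤ C) :
    ‖(frq n)^j * z * ee n x‖ ≤ 7^j * C * (1 / wt 2 n) := by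
  rw [norm_mul, norm_mul, norm_ee, mul_one, norm_pow, mul_one_div, le_div_iff₀ (wt_pos 2 n)]
  have e : wt (j+2) n = wt j n * wt 2 n := by unfold wt; ring
  have h1 : ‖frq n‖^j ≤ 7^j * wt j n := by
    unfold wt
    rw [← mul_pow]
    exact pow_le_pow_left₀ (norm_nonneg _) (norm_frq n) j
  have h2 := wt_pos 2 n
  calc ‖frq n‖^j * ‖z‖ * wt 2 n ≤ (7^j * wt j n) * ‖z‖ * wt 2 n := by gcongr
    _ = 7^j * (wt (j+2) n * ‖z‖) := by rw [e]; ring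
    _ ≤ _ := by gcongr

def Rapid (b : ℤ → ℂ) : Prop := ∀ k : ℕ, ∃ C : ℝ, ∀ n, wt k n * ‖b n‖ ≤ C

theorem Rapid.summable {b : ℤ → ℂ} (hb : Rapid b) (j : ℕ) (x : ℝ) :
    Summable fun n => (frq n)^j * b n * ee n x := by
  obtain ⟨C, hC⟩ := hb (j+2)
  exact Summable.of_norm_bounded (summable_inv_wt.mul_left (7^j * C))
    fun n => term_bound j (b n) n x C (hC n)

theorem Rapid.summable_wt {b : ℤ → ℂ} (hb : Rapid b) (k : ℕ) :
    Summable fun n => wt k n * ‖b n‖ := by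
  obtain ⟨C, hC⟩ := hb (k+2)
  refine Summable.of_nonneg_of_le (fun n => mul_nonneg (wt_pos k n).le (norm_nonneg _)) (fun n => ?_)
    (summable_inv_wt.mul_left C)
  rw [mul_one_div, le_div_iff₀ (wt_pos 2 n)]
  have e : wt (k+2) n = wt k n * wt 2 n := by unfold wt; ring
  have := hC n
  rw [e] at this
  linarith

theorem Rapid.summable_norm {b : ℤ → ℂ} (hb : Rapid b) : Summable fun n => ‖b n‖ := by
  simpa [wt] using hb.summable_wt 0

theorem Rapid.hasDerivAt {b : ℤ → ℂ} (hb : Rapid b) (j : ℕ) (x : ℝ) :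
    HasDerivAt (FS j b) (FS (j+1) b x) x := by
  obtain ⟨C, hC⟩ := hb (j+1+2)
  refine hasDerivAt_tsum (summable_inv_wt.mul_left (7^(j+1) * C)) (fun n y => ?_) (fun n y =>
    term_bound (j+1) (b n) n y C (hC n)) (hb.summable j 0) x
  refine ((hasDerivAt_ee n y).const_mul _).congr_deriv ?_
  ring

namespace IsSol

variable {a0 : ℤ → ℂ} {a : ℝ → ℤ → ℂ}

theorem rapid (h : IsSol a0 a) (t : ℝ) : Rapid (a t) := fun k => by
  obtain ⟨C, hC⟩ := h.decay k |t|
  exact ⟨C, hC t le_rfl⟩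

theorem tri_decay (h : IsSol a0 a) (k : ℕ) (T : ℝ) :
    ∃ C : ℝ, ∀ t, |t| ≤ T → ∀ n, wt k n * ‖tri (a t) (a t) (a t) n‖ ≤ C := by
  obtain ⟨C, hC⟩ := h.decay (k+2) T
  obtain ⟨C', hC'⟩ := h.decay (0+2) T
  have gen : ∀ (k : ℕ) (C : ℝ), (∀ t, |t| ≤ T → ∀ n, wt (k+2) n * ‖a t n‖ ≤ C) → ∀ t, |t| ≤ T →
      ∑' n, wt k n * ‖a t n‖ ≤ C * ∑' n, 1 / wt 2 n := by
    intro k C hC t ht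
    rw [← tsum_mul_left]
    refine ((h.rapid t).summable_wt k).tsum_le_tsum (fun n => ?_) (summable_inv_wt.mul_left C)
    rw [mul_one_div, le_div_iff₀ (wt_pos 2 n)]
    have e : wt (k+2) n = wt k n * wt 2 n := by unfold wt; ring
    have := hC t ht n
    rw [e] at this
    linarith
  set S := ∑' n, 1 / wt 2 n
  refine ⟨3^(k+1) * (C' * S)^2 * (C * S), fun t ht n => ?_⟩
  obtain ⟨s1, b1⟩ := summable_wt_tri k (a t) ((h.rapid t).summable_wt k)
  refine (s1.le_tsum n fun n _ => mul_nonneg (wt_pos k n).le (norm_nonneg _)).trans (b1.trans ?_)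
  have h1 := gen k C hC t ht
  have h2 := gen 0 C' hC' t ht
  simp only [wt, pow_zero, one_mul] at h2
  have h3 : 0 ≤ ∑' n, ‖a t n‖ := tsum_nonneg fun _ => norm_nonneg _
  have h4 : 0 ≤ ∑' n, wt k n * ‖a t n‖ :=
    tsum_nonneg fun n => mul_nonneg (wt_pos k n).le (norm_nonneg _)
  gcongr

theorem tri_rapid (h : IsSol a0 a) (t : ℝ) : Rapid (tri (a t) (a t) (a t)) := fun k => by
  obtain ⟨C, hC⟩ := h.tri_decay k |t|
  exact ⟨C, hC t le_rfl⟩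

theorem continuous_FS (h : IsSol a0 a) (j : ℕ) : Continuous fun p : ℝ × ℝ => FS j (a p.2) p.1 := by
  rw [continuous_iff_continuousAt]
  intro p
  obtain ⟨C, hC⟩ := h.decay (j+2) (|p.2| + 1)
  have ho : IsOpen {q : ℝ × ℝ | |q.2| < |p.2| + 1} :=
    isOpen_lt (by fun_prop) continuous_const
  refine ContinuousOn.continuousAt (s := {q : ℝ × ℝ | |q.2| < |p.2| + 1}) ?_ (ho.mem_nhds (by simp))
  refine continuousOn_tsum (fun n => Continuous.continuousOn ?_)
    (summable_inv_wt.mul_left (7^j * C)) (fun n q hq => term_bound j _ n q.1 C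
      (hC q.2 (le_of_lt hq) n))
  have h1 : Continuous fun t => a t n :=
    continuous_iff_continuousAt.2 fun t => (h.deriv t n).continuousAt
  have h2 : Continuous (ee n) := continuous_iff_continuousAt.2 fun x => (hasDerivAt_ee n x).continuousAt
  fun_prop

theorem hasDerivAt_t (h : IsSol a0 a) (j : ℕ) (x t : ℝ) :
    HasDerivAt (fun τ => FS j (a τ) x)
      (Complex.I * (-FS (j+2) (a t) x + FS j (tri (a t) (a t) (a t)) x)) t := by
  obtain ⟨C, hC⟩ := h.decay (j+2+2) (|t| + 1)
  obtain ⟨C', hC'⟩ := h.tri_decay (j+2) (|t| + 1)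
  have key := hasDerivAt_tsum_of_isPreconnected
    (g := fun n τ => (frq n)^j * a τ n * ee n x)
    (g' := fun n τ => (frq n)^j * (Complex.I * (lam n * a τ n + tri (a τ) (a τ) (a τ) n)) * ee n x)
    (u := fun n => 7^(j+2) * C * (1 / wt 2 n) + 7^j * C' * (1 / wt 2 n))
    (t := Ioo (-(|t| + 1)) (|t| + 1)) (y₀ := t) (y := t)
    ((summable_inv_wt.mul_left _).add (summable_inv_wt.mul_left _)) isOpen_Ioo isPreconnected_Ioo
    (fun n τ _ => ((h.deriv τ n).const_mul _).mul_const _)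
    (fun n τ hτ => by
      have hτ' : |τ| ≤ |t| + 1 := abs_le.2 ⟨hτ.1.le, hτ.2.le⟩
      have e : (frq n)^j * (Complex.I * (lam n * a τ n + tri (a τ) (a τ) (a τ) n)) * ee n x
        = Complex.I * (-((frq n)^(j+2) * a τ n * ee n x)
          + (frq n)^j * tri (a τ) (a τ) (a τ) n * ee n x) := by
        rw [frq_sq]; ring
      rw [e, norm_mul, Complex.norm_I, one_mul]
      refine (norm_add_le _ _).trans ?_
      rw [norm_neg]
      exact add_le_add (term_bound _ _ n x C (hC τ hτ' n)) (term_bound _ _ n x C' (hC' τ hτ' n)))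
    (abs_lt.1 (by linarith)) ((h.rapid t).summable j x) (abs_lt.1 (by linarith))
  refine key.congr_deriv ?_
  unfold FS
  rw [← tsum_neg, ← Summable.tsum_add ((h.rapid t).summable (j+2) x).neg
    ((h.tri_rapid t).summable j x), ← tsum_mul_left]
  refine tsum_congr fun n => ?_
  rw [frq_sq]; ring

theorem FS_tri (h : IsSol a0 a) (x t : ℝ) : FS 0 (tri (a t) (a t) (a t)) x =
    FS 0 (a t) x * conj (FS 0 (a t) x) * FS 0 (a t) x := by
  have hs : Summable fun n => ‖a t n * ee n x‖ := by
    simpa only [norm_mul, norm_ee, mul_one] using (h.rapid t).summable_norm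
  have := (hasSum_tri _ _ _ hs hs hs).tsum_eq
  unfold FS
  simp only [pow_zero, one_mul]
  rw [← this]
  refine tsum_congr fun n => ?_
  unfold tri
  rw [← tsum_mul_right]
  refine tsum_congr fun p => ?_
  have e : ee n x = ee p.1 x * conj (ee (p.1 + p.2 - n) x) * ee p.2 x := by
    unfold ee
    rw [← Complex.exp_conj, ← Complex.exp_add, ← Complex.exp_add]
    congr 1
    simp only [frq, map_mul, Complex.conj_ofReal, Complex.conj_I, map_ofNat]
    push_cast
    simp only [map_sub, map_add, map_intCast]
    ring
  rw [e, map_mul]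
  ring

end IsSol

/-- polynomial expressions in the spatial derivatives of the solution -/
inductive PolyE (a : ℝ → ℤ → ℂ) : (ℝ → ℝ → ℂ) → Prop
  | w (j : ℕ) : PolyE a (fun x t => FS j (a t) x)
  | cw (j : ℕ) : PolyE a (fun x t => conj (FS j (a t) x))
  | mul {f g : ℝ → ℝ → ℂ} : PolyE a f → PolyE a g → PolyE a (fun x t => f x t * g x t)
  | add {f g : ℝ → ℝ → ℂ} : PolyE a f → PolyE a g → PolyE a (fun x t => f x t + g x t)

theorem PolyE.deriv {a0 : ℤ → ℂ} {a : ℝ → ℤ → ℂ} (h : IsSol a0 a) {f : ℝ → ℝ → ℂ}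
    (hf : PolyE a f) : ∃ g, PolyE a g ∧ ∀ x t, HasDerivAt (fun y => f y t) (g x t) x := by
  induction hf with
  | w j => exact ⟨_, PolyE.w (j+1), fun x t => (h.rapid t).hasDerivAt j x⟩
  | cw j => exact ⟨_, PolyE.cw (j+1), fun x t => ((h.rapid t).hasDerivAt j x).star⟩
  | mul h1 h2 i1 i2 =>
    obtain ⟨g1, p1, d1⟩ := i1
    obtain ⟨g2, p2, d2⟩ := i2
    exact ⟨_, (p1.mul h2).add (h1.mul p2), fun x t => (d1 x t).mul (d2 x t)⟩
  | add h1 h2 i1 i2 =>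
    obtain ⟨g1, p1, d1⟩ := i1
    obtain ⟨g2, p2, d2⟩ := i2
    exact ⟨_, p1.add p2, fun x t => (d1 x t).add (d2 x t)⟩

theorem PolyE.contDiff {a : ℝ → ℤ → ℂ} (k : ℕ)
    (hk : ∀ j, ContDiff ℝ k fun p : ℝ × ℝ => FS j (a p.2) p.1) {f : ℝ → ℝ → ℂ}
    (hf : PolyE a f) : ContDiff ℝ k fun p : ℝ × ℝ => f p.1 p.2 := by
  induction hf with
  | w j => exact hk j
  | cw j => exact Complex.conjCLE.contDiff.comp (hk j)
  | mul h1 h2 i1 i2 => exact i1.mul i2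
  | add h1 h2 i1 i2 => exact i1.add i2

theorem PolyE.tri {a0 : ℤ → ℂ} {a : ℝ → ℤ → ℂ} (h : IsSol a0 a) (j : ℕ) :
    PolyE a (fun x t => FS j (tri (a t) (a t) (a t)) x) := by
  induction j with
  | zero =>
    simp only [h.FS_tri]
    exact ((PolyE.w 0).mul (PolyE.cw 0)).mul (PolyE.w 0)
  | succ j ih =>
    obtain ⟨g, pg, dg⟩ := ih.deriv h
    convert pg using 3 with x t
    exact ((h.tri_rapid t).hasDerivAt j x).unique (dg x t)

theorem contDiff_of_partials (k : ℕ) (f fx ft : ℝ → ℝ → ℂ)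
    (hx : ∀ x t, HasDerivAt (fun y => f y t) (fx x t) x)
    (ht : ∀ x t, HasDerivAt (fun τ => f x τ) (ft x t) t)
    (cx : ContDiff ℝ k fun p : ℝ × ℝ => fx p.1 p.2) (ct : ContDiff ℝ k fun p : ℝ × ℝ => ft p.1 p.2) :
    ContDiff ℝ (k+1) fun p : ℝ × ℝ => f p.1 p.2 := by
  rw [contDiff_succ_iff_hasFDerivAt]
  refine ⟨fun p => (ContinuousLinearMap.toSpanSingleton ℝ (fx p.1 p.2)).coprod
    (ContinuousLinearMap.toSpanSingleton ℝ (ft p.1 p.2)), ?_, fun p => ?_⟩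
  · have e : (fun p : ℝ × ℝ => (ContinuousLinearMap.toSpanSingleton ℝ (fx p.1 p.2)).coprod
      (ContinuousLinearMap.toSpanSingleton ℝ (ft p.1 p.2))) = fun p : ℝ × ℝ =>
        (ContinuousLinearMap.fst ℝ ℝ ℝ).smulRight (fx p.1 p.2)
        + (ContinuousLinearMap.snd ℝ ℝ ℝ).smulRight (ft p.1 p.2) := by
      funext p
      ext <;> simp
    rw [e]
    exact (contDiff_const.smulRight cx).add (contDiff_const.smulRight ct)
  · have hc : ∀ g : ℝ → ℝ → ℂ, (ContDiff ℝ k fun p : ℝ × ℝ => g p.1 p.2) →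
        Continuous fun p : ℝ × ℝ => ContinuousLinearMap.toSpanSingleton ℝ (g p.1 p.2) := by
      intro g hg
      exact (ContinuousLinearMap.toSpanSingletonCLE (𝕜 := ℝ) (E := ℂ)).continuous.comp hg.continuous
    exact (hasStrictFDerivAt_uncurry_coprod (𝕜 := ℝ) (u := p) (f := f)
      (f₁ := fun x t => ContinuousLinearMap.toSpanSingleton ℝ (fx x t))
      (f₂ := fun x t => ContinuousLinearMap.toSpanSingleton ℝ (ft x t))
      (Filter.Eventually.of_forall fun v => (hx v.1 v.2).hasFDerivAt)
      (Filter.Eventually.of_forall fun v => (ht v.1 v.2).hasFDerivAt)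
      (hc fx cx).continuousAt (hc ft ct).continuousAt).hasFDerivAt

theorem IsSol.contDiff {a0 : ℤ → ℂ} {a : ℝ → ℤ → ℂ} (h : IsSol a0 a) (k : ℕ) :
    ∀ j, ContDiff ℝ k fun p : ℝ × ℝ => FS j (a p.2) p.1 := by
  induction k with
  | zero =>
    intro j
    exact contDiff_zero.2 (h.continuous_FS j)
  | succ k ih =>
    intro j
    have := contDiff_of_partials k (fun x t => FS j (a t) x) (fun x t => FS (j+1) (a t) x) _
      (fun x t => (h.rapid t).hasDerivAt j x) (fun x t => h.hasDerivAt_t j x t) (ih (j+1))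
      (contDiff_const.mul ((ih (j+2)).neg.add ((PolyE.tri h j).contDiff k ih)))
    exact_mod_cast this

theorem continuous_ee (n : ℤ) : Continuous (ee n) :=
  continuous_iff_continuousAt.2 fun x => (hasDerivAt_ee n x).continuousAt

theorem int_swap (b : ℤ → ℂ) (hb : Summable fun n => ‖b n‖) (f : ℤ → ℝ → ℂ)
    (hf : ∀ n, Continuous (f n)) (hf1 : ∀ n x, ‖f n x‖ = 1) (g : ℝ → ℂ) (hg : Continuous g) :
    ∫ x in (0:ℝ)..1, g x * ∑' n, b n * f n x = ∑' n, b n * ∫ x in (0:ℝ)..1, g x * f n x := by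
  have key := intervalIntegral.hasSum_integral_of_dominated_convergence
    (μ := MeasureTheory.volume) (a := 0) (b := 1)
    (F := fun n x => b n * (g x * f n x)) (f := fun x => g x * ∑' n, b n * f n x)
    (fun n x => ‖b n‖ * ‖g x‖)
    (fun n => (continuous_const.mul (hg.mul (hf n))).aestronglyMeasurable)
    (fun n => Filter.Eventually.of_forall fun x _ => by
      rw [norm_mul, norm_mul, hf1, mul_one])
    (Filter.Eventually.of_forall fun x _ => hb.mul_right _)
    (by
      simp only [tsum_mul_right]
      exact (continuous_const.mul hg.norm).intervalIntegrable _ _)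
    (Filter.Eventually.of_forall fun x _ => by
      have h1 : Summable fun n => b n * f n x :=
        Summable.of_norm (by simpa only [norm_mul, hf1, mul_one] using hb)
      refine (h1.hasSum.mul_left (g x)).congr_fun ?_
      intro n
      ring)
  rw [← key.tsum_eq]
  refine tsum_congr fun n => ?_
  rw [intervalIntegral.integral_const_mul]

theorem int_ee (k : ℤ) : ∫ x in (0:ℝ)..1, ee k x = if k = 0 then 1 else 0 := by
  split_ifs with h
  · subst h
    simp [ee, frq]
  · have hk : frq k ≠ 0 := by
      unfold frq
      have : (k:ℂ) ≠ 0 := by exact_mod_cast h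
      have : (π:ℂ) ≠ 0 := by exact_mod_cast Real.pi_ne_zero
      simp [*]
    unfold ee
    rw [integral_exp_mul_complex hk]
    have : Complex.exp (frq k * (1:ℝ)) = 1 := by
      rw [Complex.exp_eq_one_iff]
      exact ⟨k, by unfold frq; push_cast; ring⟩
    rw [this]
    simp

theorem exp_eq_ee (n : ℤ) (x : ℝ) :
    Complex.exp (-2 * (π : ℂ) * Complex.I * (n : ℂ) * (x : ℂ)) = ee (-n) x := by
  unfold ee frq
  push_cast
  congr 1
  ring

theorem coeff_FS {b : ℤ → ℂ} (hb : Rapid b) (m : ℤ) : fourierCoeff1 (fun x => FS 0 b x) m = b m := by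
  unfold fourierCoeff1
  simp only [exp_eq_ee]
  have h1 := int_swap b hb.summable_norm ee continuous_ee norm_ee (ee (-m)) (continuous_ee _)
  have h2 : ∀ n, ∫ x in (0:ℝ)..1, ee (-m) x * ee n x = if n = m then 1 else 0 := by
    intro n
    have : ∀ x, ee (-m) x * ee n x = ee (n - m) x := by
      intro x
      unfold ee frq
      rw [← Complex.exp_add]
      push_cast
      congr 1
      ring
    simp only [this, int_ee, sub_eq_zero]
  simp only [h2, mul_ite, mul_one, mul_zero, tsum_ite_eq] at h1
  rw [← h1]
  refine intervalIntegral.integral_congr fun x _ => ?_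
  simp only [FS, pow_zero, one_mul]
  ring

theorem mass_FS {b : ℤ → ℂ} (hb : Rapid b) :
    ∫ x in (0:ℝ)..1, ‖FS 0 b x‖^2 = ∑' n, ‖b n‖^2 := by
  have hc : Continuous (FS 0 b) := continuous_iff_continuousAt.2 fun x => (hb.hasDerivAt 0 x).continuousAt
  have h1 := int_swap (fun n => conj (b n)) (by simpa using hb.summable_norm) (fun n => ee (-n))
    (fun n => continuous_ee _) (fun n x => norm_ee _ x) (FS 0 b) hc
  have h2 : ∀ n, ∫ x in (0:ℝ)..1, FS 0 b x * ee (-n) x = b n := by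
    intro n
    have := coeff_FS hb n
    unfold fourierCoeff1 at this
    simpa only [exp_eq_ee] using this
  simp only [h2, Complex.conj_mul'] at h1
  have h3 : ∀ x, FS 0 b x * ∑' n, conj (b n) * ee (-n) x = ((‖FS 0 b x‖^2 : ℝ) : ℂ) := by
    intro x
    have : ∑' n, conj (b n) * ee (-n) x = conj (FS 0 b x) := by
      unfold FS
      rw [Complex.conj_tsum]
      refine tsum_congr fun n => ?_
      simp only [pow_zero, one_mul, map_mul]
      congr 1
      unfold ee frq
      rw [← Complex.exp_conj]
      simp only [map_mul, Complex.conj_ofReal, Complex.conj_I, map_ofNat, map_intCast]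
      push_cast
      congr 1
      ring
    rw [this, Complex.mul_conj']
    push_cast
    rfl
  simp only [h3] at h1
  rw [intervalIntegral.integral_ofReal] at h1
  have h4 : ∑' n, ((‖b n‖:ℂ))^2 = ((∑' n, ‖b n‖^2 : ℝ) : ℂ) := by
    rw [Complex.ofReal_tsum]
    push_cast
    rfl
  rw [h4] at h1
  exact_mod_cast h1

theorem FS_periodic (b : ℤ → ℂ) (x : ℝ) : FS 0 b (x + 1) = FS 0 b x := by
  unfold FS
  refine tsum_congr fun n => ?_
  congr 1
  unfold ee
  have : frq n * ((x + 1 : ℝ) : ℂ) = frq n * x + n * (2 * π * Complex.I) := by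
    unfold frq; push_cast; ring
  rw [this, Complex.exp_add, Complex.exp_int_mul_two_pi_mul_I, mul_one]

theorem pde_of_sol {a0 : ℤ → ℂ} {a : ℝ → ℤ → ℂ} (h : IsSol a0 a) :
    ∃ u : ℝ → ℝ → ℂ, ContDiff ℝ (⊤ : ℕ∞) (fun p : ℝ × ℝ => u p.1 p.2) ∧
      (∀ x t : ℝ, u (x + 1) t = u x t) ∧
      (∀ x t : ℝ,
        Complex.I * deriv (fun τ => u x τ) t
          - deriv (deriv fun y => u y t) x
          + ((‖u x t‖^2 - 2 * ∫ y in (0:ℝ)..1, ‖u y t‖^2 : ℝ) : ℂ) * u x t = 0) ∧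
      ∀ t n, ‖fourierCoeff1 (fun x => u x t) n‖ = ‖a t n‖ := by
  set μ : ℝ := ∑' n, ‖a0 n‖^2 with hμ
  set θ : ℝ → ℂ := fun t => Complex.exp (((-(2 * μ) * t : ℝ) : ℂ) * Complex.I) with hθ
  have hθn : ∀ t, ‖θ t‖ = 1 := fun t => Complex.norm_exp_ofReal_mul_I _
  have hθd : ∀ t, HasDerivAt θ (-(2 * μ) * Complex.I * θ t) t := by
    intro t
    have h1 : HasDerivAt (fun t : ℝ => ((-(2 * μ) * t : ℝ) : ℂ)) (((-(2 * μ) * 1 : ℝ) : ℂ)) t :=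
      ((hasDerivAt_id t).const_mul (-(2 * μ))).ofReal_comp
    refine ((h1.mul_const Complex.I).cexp).congr_deriv ?_
    simp only [hθ]
    push_cast
    ring
  have hun : ∀ x t, ‖θ t * FS 0 (a t) x‖ = ‖FS 0 (a t) x‖ := fun x t => by
    rw [norm_mul, hθn, one_mul]
  refine ⟨fun x t => θ t * FS 0 (a t) x, ?_, ?_, ?_, ?_⟩
  · rw [contDiff_infty]
    intro k
    refine ContDiff.mul ?_ (h.contDiff k 0)
    simp only [hθ]
    have : ContDiff ℝ k fun p : ℝ × ℝ => ((-(2 * μ) * p.2 : ℝ) : ℂ) :=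
      Complex.ofRealCLM.contDiff.comp (contDiff_const.mul contDiff_snd)
    exact (this.mul contDiff_const).cexp
  · intro x t
    simp only [FS_periodic]
  · intro x t
    have e1 : deriv (fun y => θ t * FS 0 (a t) y) = fun y => θ t * FS 1 (a t) y :=
      funext fun y => (((h.rapid t).hasDerivAt 0 y).const_mul (θ t)).deriv
    have e2 : deriv (fun y => θ t * FS 1 (a t) y) x = θ t * FS 2 (a t) x :=
      (((h.rapid t).hasDerivAt 1 x).const_mul (θ t)).deriv
    have e3 : deriv (fun τ => θ τ * FS 0 (a τ) x) t = _ :=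
      ((hθd t).mul (h.hasDerivAt_t 0 x t)).deriv
    have e4 : ∫ y in (0:ℝ)..1, ‖FS 0 (a t) y‖^2 = μ := by
      rw [mass_FS (h.rapid t), h.mass]
    simp only [e1, e2, e3, hun, e4, h.FS_tri]
    rw [Complex.mul_conj']
    push_cast
    linear_combination ((-(2 * μ)) * θ t * FS 0 (a t) x + θ t * (-FS 2 (a t) x + (‖FS 0 (a t) x‖:ℂ)^2 * FS 0 (a t) x)) * Complex.I_sq
  · intro t n
    have : fourierCoeff1 (fun x => θ t * FS 0 (a t) x) n = θ t * fourierCoeff1 (fun x => FS 0 (a t) x) n := by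
      unfold fourierCoeff1
      simp only [mul_assoc]
      rw [intervalIntegral.integral_const_mul]
    rw [this, norm_mul, hθn, one_mul, coeff_FS (h.rapid t)]

theorem params (s : ℝ) (hs : s ≤ -(1/2)) (ε : ℝ) (hε : 0 < ε) :
    ∃ (m : ℕ) (R κ : ℝ), 1 ≤ m ∧ 0 < R ∧ 0 < κ ∧ κ ≤ 1/2880 ∧ κ * R^2 ≤ 1/1000000 ∧
      κ / (m:ℝ)^2 < ε ∧ 5 * R^2 * (m:ℝ)^(1 + 2*s) < ε^2 ∧
      (ε⁻¹)^2 < (κ * R^3 / 4)^2 * ∑ n ∈ Finset.range (m+1), ((1:ℝ) + (n:ℝ)^2)^s := by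
  have htime : ∀ κ : ℝ, ∀ᶠ m : ℕ in Filter.atTop, κ / (m:ℝ)^2 < ε := by
    intro κ
    have : Filter.Tendsto (fun m : ℕ => κ / (m:ℝ)^2) Filter.atTop (𝓝 0) :=
      Filter.Tendsto.const_div_atTop
        ((Filter.tendsto_pow_atTop (by norm_num)).comp tendsto_natCast_atTop_atTop) κ
    exact this.eventually_lt_const hε
  rcases eq_or_lt_of_le hs with rfl | hs
  · set R := ε / 3 with hR
    have hR0 : 0 < R := by positivity
    set κ := min (1/2880) (1 / (1000000 * R^2)) with hκ
    have hκ0 : 0 < κ := lt_min (by norm_num) (by positivity)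
    have hκR : κ * R^2 ≤ 1/1000000 := by
      calc κ * R^2 ≤ 1 / (1000000 * R^2) * R^2 := by gcongr; exact min_le_right _ _
        _ = _ := by field_simp
    have hharm : ∀ᶠ m : ℕ in Filter.atTop,
        (ε⁻¹)^2 / (κ * R^3 / 4)^2 < ∑ i ∈ Finset.range m, (1 / ((i:ℝ) + 1)) :=
      Real.tendsto_sum_range_one_div_nat_succ_atTop.eventually_gt_atTop _
    obtain ⟨m, h1, h2, h3⟩ := ((htime κ).and (hharm.and (Filter.eventually_ge_atTop 1))).exists
    refine ⟨m, R, κ, h3, hR0, hκ0, min_le_left _ _, hκR, h1, ?_, ?_⟩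
    · have : (1:ℝ) + 2 * (-(1/2)) = 0 := by norm_num
      rw [this, Real.rpow_zero, hR]
      nlinarith [sq_nonneg ε, pow_pos hε 2]
    · rw [div_lt_iff₀ (by positivity), mul_comm] at h2
      refine h2.trans_le ?_
      gcongr
      refine (Finset.sum_le_sum fun i _ => ?_).trans
        (Finset.sum_le_sum_of_subset_of_nonneg (Finset.range_mono (Nat.le_succ m))
          fun i _ _ => by positivity)
      have hi : (0:ℝ) ≤ i := by positivity
      have e : 1 / ((i:ℝ) + 1) = (((i:ℝ)+1)^2)^(-(1/2) : ℝ) := by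
        rw [← Real.rpow_natCast, ← Real.rpow_mul (by positivity)]
        norm_num
        rw [Real.rpow_neg_one]
      rw [e]
      exact Real.rpow_le_rpow_of_nonpos (by positivity) (by nlinarith) (by norm_num)
  · set R := 1 + 10^7 / ε with hR
    have hR1 : 1 ≤ R := by
      have : 0 < 10^7 / ε := by positivity
      linarith
    have hR0 : 0 < R := by linarith
    set κ := 1 / (1000000 * R^2) with hκ
    have hκ0 : 0 < κ := by positivity
    have hdec : ∀ᶠ m : ℕ in Filter.atTop, 5 * R^2 * (m:ℝ)^(1 + 2*s) < ε^2 := by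
      have h1 := (tendsto_rpow_neg_atTop (y := -(1 + 2*s)) (by linarith)).comp
        (tendsto_natCast_atTop_atTop (R := ℝ))
      have h2 := h1.const_mul (5 * R^2)
      rw [mul_zero] at h2
      simpa using h2.eventually_lt_const (pow_pos hε 2)
    obtain ⟨m, h1, h2, h3⟩ := ((htime κ).and (hdec.and (Filter.eventually_ge_atTop 1))).exists
    refine ⟨m, R, κ, h3, hR0, hκ0, ?_, ?_, h1, h2, ?_⟩
    · rw [hκ]
      apply one_div_le_one_div_of_le (by norm_num)
      nlinarith
    · rw [hκ]
      apply le_of_eq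
      field_simp
    · have e1 : κ * R^3 / 4 = R / 4000000 := by
        rw [hκ]; field_simp; norm_num
      have e2 : (1:ℝ) ≤ ∑ n ∈ Finset.range (m+1), ((1:ℝ) + (n:ℝ)^2)^s := by
        have := Finset.single_le_sum (f := fun n : ℕ => ((1:ℝ) + (n:ℝ)^2)^s)
          (fun i _ => by positivity) (Finset.mem_range.2 (Nat.succ_pos m))
        simpa using this
      have e3 : ε⁻¹ < R / 4000000 := by
        rw [hR, lt_div_iff₀ (by norm_num), inv_mul_eq_div]
        have : 4000000 / ε ≤ 10^7 / ε := by gcongr; norm_num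
        linarith
      rw [e1]
      calc (ε⁻¹)^2 < (R / 4000000)^2 := by gcongr
        _ = (R / 4000000)^2 * 1 := by ring
        _ ≤ _ := by gcongr

theorem dat_Hs (s : ℝ) (hs : s ≤ -(1/2)) (m : ℕ) (hm : 1 ≤ m) (R : ℝ) (hR : 0 < R) :
    ∑' n : ℤ, ((1:ℝ) + (n:ℝ)^2) ^ s * ‖dat m R n‖^2 ≤ 5 * R^2 * (m:ℝ)^(1 + 2*s) := by
  classical
  have hmpos : (0:ℝ) < m := by exact_mod_cast hm
  rw [tsum_eq_sum (s := Finset.Icc (2 * (m:ℤ)) (6 * m))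
    (fun n hn => by simp [dat, hn])]
  have h1 : ∀ n ∈ Finset.Icc (2 * (m:ℤ)) (6 * m),
      ((1:ℝ) + (n:ℝ)^2) ^ s * ‖dat m R n‖^2 ≤ (m:ℝ)^(2*s) * R^2 := by
    intro n hn
    have h2 : ((1:ℝ) + (n:ℝ)^2) ^ s ≤ (m:ℝ)^(2*s) := by
      rw [Real.rpow_mul hmpos.le, Real.rpow_ofNat]
      refine Real.rpow_le_rpow_of_nonpos (by positivity) ?_ (by linarith)
      have : (2:ℝ) * m ≤ n := by exact_mod_cast (Finset.mem_Icc.1 hn).1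
      nlinarith
    have := dat_norm m R hR n
    gcongr
  refine (Finset.sum_le_card_nsmul _ _ _ h1).trans ?_
  rw [Int.card_Icc, nsmul_eq_mul]
  have : (6 * (m:ℤ) + 1 - 2 * m).toNat = 4 * m + 1 := by omega
  rw [this, Real.rpow_add hmpos, Real.rpow_one]
  push_cast
  have h3 : (1:ℝ) ≤ m := by exact_mod_cast hm
  calc (4 * (m:ℝ) + 1) * ((m:ℝ)^(2*s) * R^2) ≤ (5 * m) * ((m:ℝ)^(2*s) * R^2) := by
        gcongr; linarith
    _ = _ := by ring

theorem Hs_lower (s : ℝ) (hs : s ≤ -(1/2)) (b : ℤ → ℂ) (hb : Rapid b) (m : ℕ) (ρ : ℝ) (hρ : 0 ≤ ρ)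
    (h : ∀ n : ℤ, 0 ≤ n → n ≤ m → ρ ≤ ‖b n‖) :
    ρ^2 * ∑ n ∈ Finset.range (m+1), ((1:ℝ) + (n:ℝ)^2)^s
      ≤ ∑' n : ℤ, ((1:ℝ) + (n:ℝ)^2) ^ s * ‖b n‖^2 := by
  have hsum : Summable fun n : ℤ => ((1:ℝ) + (n:ℝ)^2) ^ s * ‖b n‖^2 := by
    obtain ⟨C, hC⟩ := hb 0
    refine Summable.of_nonneg_of_le (fun n => by positivity) (fun n => ?_)
      (hb.summable_norm.mul_left C)
    have h1 : ((1:ℝ) + (n:ℝ)^2) ^ s ≤ 1 :=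
      Real.rpow_le_one_of_one_le_of_nonpos (by nlinarith [sq_nonneg (n:ℝ)]) (by linarith)
    have h2 : ‖b n‖ ≤ C := by simpa [wt] using hC n
    calc ((1:ℝ) + (n:ℝ)^2) ^ s * ‖b n‖^2 ≤ 1 * ‖b n‖^2 := by gcongr
      _ = ‖b n‖ * ‖b n‖ := by ring
      _ ≤ _ := by gcongr
  refine le_trans ?_ (hsum.sum_le_tsum ((Finset.range (m+1)).map Nat.castEmbedding)
    fun n _ => by positivity)
  rw [Finset.sum_map, Finset.mul_sum]
  refine Finset.sum_le_sum fun n hn => ?_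
  have := h n (by positivity) (by have := Finset.mem_range.1 hn; omega)
  simp only [Nat.castEmbedding_apply, Int.cast_natCast]
  rw [mul_comm]
  gcongr

end Helpers

/-- Norm inflation for the defocusing Wick ordered cubic NLS on the circle for `s ≤ −1/2`. -/
theorem norm_inflation_wick_cubic_NLS_circle (s : ℝ) (hs : s ≤ -(1/2)) (ε : ℝ) (hε : 0 < ε) :
    ∃ (T : ℝ) (u : ℝ → ℝ → ℂ),
      0 < T ∧ T < ε ∧
      ContDiff ℝ (⊤ : ℕ∞) (fun p : ℝ × ℝ => u p.1 p.2) ∧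
      (∀ x t : ℝ, u (x + 1) t = u x t) ∧
      (∀ x t : ℝ,
        Complex.I * deriv (fun τ => u x τ) t
          - deriv (deriv fun y => u y t) x
          + ((‖u x t‖^2 - 2 * ∫ y in (0:ℝ)..1, ‖u y t‖^2 : ℝ) : ℂ) * u x t = 0) ∧
      HsNormT s (fun x => u x 0) < ε ∧
      HsNormT s (fun x => u x T) > ε⁻¹ := by
  obtain ⟨m, R, κ, hm, hR, hκ0, hκ, hκR, hT, hini, hfin⟩ := params s hs ε hε
  have hmpos : (0:ℝ) < m := by exact_mod_cast hm
  obtain ⟨a, ha, hlow⟩ := sol_exists (6 * m) (dat m R) (dat_supp m R)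
  obtain ⟨u, hu1, hu2, hu3, hu4⟩ := pde_of_sol ha
  refine ⟨κ / (m:ℝ)^2, u, by positivity, hT, hu1, hu2, hu3, ?_, ?_⟩
  · unfold HsNormT
    simp only [hu4, ha.initv]
    rw [Real.sqrt_lt' hε]
    exact (dat_Hs s hs m hm R hR).trans_lt hini
  · unfold HsNormT
    simp only [hu4]
    rw [gt_iff_lt, Real.lt_sqrt (by positivity)]
    refine hfin.trans_le ?_
    refine Hs_lower s hs _ (ha.rapid _) m _ (by positivity) fun n hn0 hn => ?_
    exact hlow _ _ _ fun M hM b hb => gal_inflate m hm R κ hR hκ0 hκ hκR M hM b hb n hn0 hn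
end

section
/- Let φ ∈ C_c^∞(ℝ) and β ∈ (0,2). Then there exist c > 0, C > 0, δ₀ > 0, and L₀ ≥ 1 such that the following holds for every L ≥ L₀ with supp φ ⊂ (−L/2, L/2) and every δ ∈ (0, δ₀]: if v : ℝ × ℝ → ℂ is smooth, L-periodic in the first variable, satisfies the small dispersion cubic NLS i ∂_t v − δ² ∂_x² v + |v|² v = 0 for all (x,t), and v(x,0) = φ_L(x) where φ_L(x) = Σ_{n∈ℤ} φ(x − nL), then ‖v(·,t) − φ_L e^{i|φ_L|² t}‖_{H¹(𝕋_L)} ≤ C δ^β for all t with |t| ≤ c (log(1/δ))^c. -/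
open scoped Real

/-- Fourier coefficient of an `L`-periodic function `f : ℝ → ℂ`:
`f̂(n/L) = (1/L) ∫₀^L f(x) e^{−2πi(n/L)x} dx`. -/
noncomputable def fourierCoeffL (L : ℝ) (f : ℝ → ℂ) (n : ℤ) : ℂ :=
  (1 / (L : ℂ)) *
    ∫ x in (0:ℝ)..L, f x * Complex.exp (-2 * (π : ℂ) * Complex.I * ((n : ℂ) / (L : ℂ)) * (x : ℂ))

/-- Sobolev norm on the scaled torus `𝕋_L`:
`‖f‖_{H^s(𝕋_L)} = L^{1/2} (Σ_{n∈ℤ} (1+(n/L)²)^s |f̂(n/L)|²)^{1/2}`. -/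
noncomputable def HsNormL (L s : ℝ) (f : ℝ → ℂ) : ℝ :=
  Real.sqrt (L * ∑' n : ℤ, ((1:ℝ) + ((n:ℝ)/L)^2) ^ s * ‖fourierCoeffL L f n‖^2)

/-- Periodization of `φ` with period `L`: `φ_L(x) = Σ_{n∈ℤ} φ(x − nL)`. -/
noncomputable def periodization (φ : ℝ → ℂ) (L x : ℝ) : ℂ :=
  ∑' n : ℤ, φ (x - n * L)

/-! ### Fourier side: the `H¹` norm is bounded by the energy -/

lemma SDA_fourierCoeffL_eq {L : ℝ} (hL : 0 < L) (f : ℝ → ℂ) (n : ℤ) :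
    fourierCoeffL L f n = fourierCoeffOn hL f n := by
  rw [fourierCoeffOn_eq_integral, fourierCoeffL]
  rw [Complex.real_smul]
  push_cast
  rw [sub_zero]
  congr 1
  apply intervalIntegral.integral_congr
  intro x _
  simp only [smul_eq_mul]
  rw [mul_comm, fourier_coe_apply]
  congr 2
  push_cast
  rw [sub_zero]
  ring

lemma SDA_memLp {L : ℝ} {f : ℝ → ℂ} (hf : Continuous f) :
    MeasureTheory.MemLp f 2 (MeasureTheory.volume.restrict (Set.Ioc 0 L)) := by
  have h1 : MeasureTheory.MemLp f 2 (MeasureTheory.volume.restrict (Set.Icc 0 L)) := by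
    obtain ⟨C, hC⟩ := (isCompact_Icc (a := (0:ℝ)) (b := L)).exists_bound_of_continuousOn
      hf.continuousOn
    refine MeasureTheory.MemLp.of_bound hf.aestronglyMeasurable C ?_
    exact (MeasureTheory.ae_restrict_mem measurableSet_Icc).mono hC
  exact h1.mono_measure (MeasureTheory.Measure.restrict_mono Set.Ioc_subset_Icc_self le_rfl)

lemma SDA_Hs_le {L : ℝ} (hL : 0 < L) (f f' : ℝ → ℂ) (hf' : Continuous f')
    (hd : ∀ x, HasDerivAt f (f' x) x) (hper : f L = f 0) :
    HsNormL L 1 f ≤ Real.sqrt ((∫ x in (0:ℝ)..L, ‖f x‖ ^ 2) + ∫ x in (0:ℝ)..L, ‖f' x‖ ^ 2) := by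
  have hf : Continuous f := continuous_iff_continuousAt.2 fun x => (hd x).continuousAt
  have h1 := hasSum_sq_fourierCoeffOn hL (SDA_memLp (L := L) hf)
  have h2 := hasSum_sq_fourierCoeffOn hL (SDA_memLp (L := L) hf')
  have key : ∀ n : ℤ, (((n:ℝ)/L)^2) * ‖fourierCoeffOn hL f n‖^2 ≤ ‖fourierCoeffOn hL f' n‖^2 := by
    intro n
    by_cases hn : n = 0
    · subst hn; simp
    have h := fourierCoeffOn_of_hasDerivAt hL hn (fun x _ => hd x) (hf'.intervalIntegrable _ _)
    have h3 : ‖fourierCoeffOn hL f n‖ * (2 * π * |(n:ℝ)|) = L * ‖fourierCoeffOn hL f' n‖ := by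
      rw [h, hper]
      have : |(n:ℝ)| ≠ 0 := by simpa using hn
      simp [abs_of_pos Real.pi_pos, abs_of_pos hL]
      field_simp
    have h4 : |(n:ℝ)| / L * ‖fourierCoeffOn hL f n‖ ≤ ‖fourierCoeffOn hL f' n‖ := by
      rw [div_mul_eq_mul_div, div_le_iff₀ hL, mul_comm _ L, ← h3]
      have : 1 ≤ 2 * π := by linarith [Real.pi_gt_three]
      have h5 : 0 ≤ |(n:ℝ)| * ‖fourierCoeffOn hL f n‖ := by positivity
      nlinarith
    have h6 : ((n:ℝ)/L)^2 = (|(n:ℝ)| / L)^2 := by rw [div_pow, div_pow, sq_abs]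
    rw [h6, ← mul_pow]
    gcongr
  unfold HsNormL
  apply Real.sqrt_le_sqrt
  have h12 := h1.add h2
  have hle : ∀ n : ℤ, ((1:ℝ) + ((n:ℝ)/L)^2) ^ (1:ℝ) * ‖fourierCoeffL L f n‖^2 ≤
      ‖fourierCoeffOn hL f n‖ ^ 2 + ‖fourierCoeffOn hL f' n‖ ^ 2 := by
    intro n
    rw [Real.rpow_one, SDA_fourierCoeffL_eq hL]
    linarith [key n]
  have hs : Summable fun n : ℤ => ((1:ℝ) + ((n:ℝ)/L)^2) ^ (1:ℝ) * ‖fourierCoeffL L f n‖^2 :=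
    Summable.of_nonneg_of_le (fun n => by positivity) hle h12.summable
  have h := hs.tsum_le_tsum hle h12.summable
  rw [h12.tsum_eq] at h
  calc _ ≤ L * _ := mul_le_mul_of_nonneg_left h hL.le
    _ = _ := by simp only [smul_eq_mul, sub_zero]; field_simp

/-! ### Smooth functions of two variables -/

/-- joint smoothness -/
def SDASm (f : ℝ → ℝ → ℂ) : Prop := ContDiff ℝ (⊤ : ℕ∞) (fun p : ℝ × ℝ => f p.1 p.2)

/-- space derivative -/
noncomputable def SDADx (f : ℝ → ℝ → ℂ) : ℝ → ℝ → ℂ := fun x t => deriv (fun y => f y t) x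

/-- time derivative -/
noncomputable def SDADt (f : ℝ → ℝ → ℂ) : ℝ → ℝ → ℂ := fun x t => deriv (fun s => f x s) t

lemma SDASm.hx' {f : ℝ → ℝ → ℂ} (hf : SDASm f) (x t : ℝ) :
    HasDerivAt (fun y => f y t) (fderiv ℝ (fun p : ℝ × ℝ => f p.1 p.2) (x, t) (1, 0)) x := by
  have h1 : HasFDerivAt (fun p : ℝ × ℝ => f p.1 p.2) _ (x, t) :=
    ((hf.differentiable (by simp)) (x, t)).hasFDerivAt
  have h2 : HasDerivAt (fun y : ℝ => (y, t)) ((1 : ℝ), (0 : ℝ)) x :=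
    (hasDerivAt_id x).prodMk (hasDerivAt_const x t)
  exact h1.comp_hasDerivAt x h2

lemma SDASm.ht' {f : ℝ → ℝ → ℂ} (hf : SDASm f) (x t : ℝ) :
    HasDerivAt (fun s => f x s) (fderiv ℝ (fun p : ℝ × ℝ => f p.1 p.2) (x, t) (0, 1)) t := by
  have h1 : HasFDerivAt (fun p : ℝ × ℝ => f p.1 p.2) _ (x, t) :=
    ((hf.differentiable (by simp)) (x, t)).hasFDerivAt
  have h2 : HasDerivAt (fun y : ℝ => (x, y)) ((0 : ℝ), (1 : ℝ)) t :=
    (hasDerivAt_const t x).prodMk (hasDerivAt_id t)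
  exact h1.comp_hasDerivAt t h2

lemma SDASm.Dx_eq {f : ℝ → ℝ → ℂ} (hf : SDASm f) :
    SDADx f = fun x t => fderiv ℝ (fun p : ℝ × ℝ => f p.1 p.2) (x, t) (1, 0) := by
  ext x t; exact (hf.hx' x t).deriv

lemma SDASm.Dt_eq {f : ℝ → ℝ → ℂ} (hf : SDASm f) :
    SDADt f = fun x t => fderiv ℝ (fun p : ℝ × ℝ => f p.1 p.2) (x, t) (0, 1) := by
  ext x t; exact (hf.ht' x t).deriv

lemma SDASm.fd {f : ℝ → ℝ → ℂ} (hf : SDASm f) :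
    ContDiff ℝ (⊤ : ℕ∞) (fderiv ℝ (fun p : ℝ × ℝ => f p.1 p.2)) :=
  hf.fderiv_right (by simp)

lemma SDASm.dx {f : ℝ → ℝ → ℂ} (hf : SDASm f) : SDASm (SDADx f) := by
  rw [hf.Dx_eq]; exact hf.fd.clm_apply contDiff_const

lemma SDASm.dt {f : ℝ → ℝ → ℂ} (hf : SDASm f) : SDASm (SDADt f) := by
  rw [hf.Dt_eq]; exact hf.fd.clm_apply contDiff_const

lemma SDASm.hx {f : ℝ → ℝ → ℂ} (hf : SDASm f) (x t : ℝ) :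
    HasDerivAt (fun y => f y t) (SDADx f x t) x := by
  rw [hf.Dx_eq]; exact hf.hx' x t

lemma SDASm.ht {f : ℝ → ℝ → ℂ} (hf : SDASm f) (x t : ℝ) :
    HasDerivAt (fun s => f x s) (SDADt f x t) t := by
  rw [hf.Dt_eq]; exact hf.ht' x t

lemma SDASm.comm {f : ℝ → ℝ → ℂ} (hf : SDASm f) : SDADt (SDADx f) = SDADx (SDADt f) := by
  rw [hf.dx.Dt_eq, hf.dt.Dx_eq, hf.Dx_eq, hf.Dt_eq]
  ext x t
  have hd : DifferentiableAt ℝ (fderiv ℝ (fun p : ℝ × ℝ => f p.1 p.2)) (x, t) :=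
    hf.fd.differentiable (by simp) _
  have hs : IsSymmSndFDerivAt ℝ (fun p : ℝ × ℝ => f p.1 p.2) (x, t) :=
    (ContDiff.contDiffAt hf).isSymmSndFDerivAt (by simp; exact WithTop.coe_le_coe.2 le_top)
  have e : ∀ a b : ℝ × ℝ, fderiv ℝ (fun p : ℝ × ℝ =>
      fderiv ℝ (fun p : ℝ × ℝ => f p.1 p.2) (p.1, p.2) a) (x, t) b =
      fderiv ℝ (fderiv ℝ (fun p : ℝ × ℝ => f p.1 p.2)) (x, t) b a := by
    intro a b
    have := (hd.hasFDerivAt.clm_apply (hasFDerivAt_const a (x, t))).fderiv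
    simp only [Prod.mk.eta]
    rw [this]; simp
  rw [e, e]
  exact hs _ _

lemma SDASm.cont {f : ℝ → ℝ → ℂ} (hf : SDASm f) : Continuous (fun p : ℝ × ℝ => f p.1 p.2) :=
  ContDiff.continuous hf

lemma SDASm.cx {f : ℝ → ℝ → ℂ} (hf : SDASm f) (t : ℝ) : Continuous (fun x => f x t) :=
  hf.cont.comp (by fun_prop : Continuous fun x : ℝ => (x, t))

lemma SDADx_per {f : ℝ → ℝ → ℂ} {L : ℝ} (hf : ∀ x t, f (x + L) t = f x t) :
    ∀ x t, SDADx f (x + L) t = SDADx f x t := by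
  intro x t
  unfold SDADx
  rw [← deriv_comp_add_const]
  simp_rw [hf]

/-! ### Energy identity -/

lemma SDA_deriv_int {g : ℝ → ℝ → ℂ} (hg : SDASm g) (a b t : ℝ) :
    HasDerivAt (fun s => ∫ x in a..b, ‖g x s‖ ^ 2)
      (∫ x in a..b, 2 * ((starRingEnd ℂ (g x t)) * SDADt g x t).re) t := by
  have hder : ∀ x s, HasDerivAt (fun s => ‖g x s‖ ^ 2)
      (2 * ((starRingEnd ℂ (g x s)) * SDADt g x s).re) s := by
    intro x s
    have h := (hg.ht x s).norm_sq
    convert h using 1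
    simp [inner, Complex.mul_re, mul_comm]
  have hc : Continuous fun p : ℝ × ℝ =>
      (2 * ((starRingEnd ℂ (g p.1 p.2)) * SDADt g p.1 p.2).re : ℝ) := by
    have h1 := hg.cont
    have h2 := hg.dt.cont
    exact continuous_const.mul (Complex.continuous_re.comp
      ((Complex.continuous_conj.comp h1).mul h2))
  obtain ⟨C, hC⟩ := ((isCompact_uIcc (a := a) (b := b)).prod
    (isCompact_closedBall t 1)).exists_bound_of_continuousOn hc.continuousOn
  refine (intervalIntegral.hasDerivAt_integral_of_dominated_loc_of_deriv_le
    (F := fun s x => ‖g x s‖ ^ 2)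
    (F' := fun s x => 2 * ((starRingEnd ℂ (g x s)) * SDADt g x s).re)
    (bound := fun _ => C) (Metric.ball_mem_nhds t one_pos) ?_ ?_ ?_ ?_ ?_ ?_).2
  · filter_upwards with s
    exact ((hg.cx s).norm.pow 2).aestronglyMeasurable
  · exact ((hg.cx t).norm.pow 2).intervalIntegrable _ _
  · exact (hc.comp (by fun_prop : Continuous fun x : ℝ => (x, t))).aestronglyMeasurable
  · filter_upwards with x hx s hs
    exact hC (x, s) ⟨Set.uIoc_subset_uIcc hx, Metric.ball_subset_closedBall hs⟩
  · simp
  · filter_upwards with x hx s hs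
    exact hder x s

lemma SDA_energy {g G : ℝ → ℝ → ℂ} (hg : SDASm g) (hG : SDASm G) {a L κ : ℝ}
    (hper : ∀ x t, g (x + L) t = g x t)
    (heq : ∀ x t, SDADt g x t = -Complex.I * κ * SDADx (SDADx g) x t + G x t) (t : ℝ) :
    HasDerivAt (fun s => ∫ x in a..(a+L), ‖g x s‖ ^ 2)
      (∫ x in a..(a+L), 2 * ((starRingEnd ℂ (g x t)) * G x t).re) t := by
  have h := SDA_deriv_int hg a (a+L) t
  convert h using 1
  have hF : ∀ x, HasDerivAt (fun x => 2 * κ * ((starRingEnd ℂ (g x t)) * SDADx g x t).im)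
      (2 * κ * ((starRingEnd ℂ (g x t)) * SDADx (SDADx g) x t).im) x := by
    intro x
    have h1 := hg.hx x t
    have h2 := hg.dx.hx x t
    have h3 := (Complex.imCLM.hasFDerivAt.comp_hasDerivAt x
      ((h1.star).mul h2)).const_mul (2 * κ)
    have e : 2 * κ * ((starRingEnd ℂ (g x t)) * SDADx (SDADx g) x t).im = 2 * κ * Complex.imCLM
        (star (SDADx g x t) * SDADx g x t + star (g x t) * SDADx (SDADx g) x t) := by
      simp [Complex.add_im, Complex.mul_im]
      left; ring
    rw [e]
    exact h3
  have hcF : Continuous fun x => 2 * κ * ((starRingEnd ℂ (g x t)) * SDADx (SDADx g) x t).im :=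
    continuous_const.mul (Complex.continuous_im.comp
      ((Complex.continuous_conj.comp (hg.cx t)).mul (hg.dx.dx.cx t)))
  have hcG : Continuous fun x => 2 * ((starRingEnd ℂ (g x t)) * G x t).re :=
    continuous_const.mul (Complex.continuous_re.comp
      ((Complex.continuous_conj.comp (hg.cx t)).mul (hG.cx t)))
  have hint := intervalIntegral.integral_eq_sub_of_hasDerivAt (a := a) (b := a + L)
    (fun x _ => hF x) (hcF.intervalIntegrable _ _)
  rw [hper, SDADx_per hper, sub_self] at hint
  rw [← add_zero (∫ x in a..(a+L), 2 * ((starRingEnd ℂ (g x t)) * G x t).re), ← hint,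
    ← intervalIntegral.integral_add (hcG.intervalIntegrable _ _) (hcF.intervalIntegrable _ _)]
  apply intervalIntegral.integral_congr
  intro x _
  simp only [heq]
  simp [Complex.mul_re, Complex.mul_im]
  ring

/-! ### Sobolev embedding, nonlinear estimates, barrier argument -/

lemma SDA_sobolev {f f' : ℝ → ℂ} (hf' : Continuous f') (hd : ∀ x, HasDerivAt f (f' x) x)
    {a L : ℝ} (hL : 1 ≤ L) {x : ℝ} (hx : x ∈ Set.Icc a (a + L)) :
    ‖f x‖ ^ 2 ≤ 2 * ((∫ y in a..(a+L), ‖f y‖ ^ 2) + ∫ y in a..(a+L), ‖f' y‖ ^ 2) := by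
  have hf : Continuous f := continuous_iff_continuousAt.2 fun x => (hd x).continuousAt
  have haL : a ≤ a + L := by linarith
  have i1 : ∀ b c : ℝ, IntervalIntegrable (fun y => ‖f y‖ ^ 2) MeasureTheory.volume b c :=
    fun b c => (hf.norm.pow 2).intervalIntegrable _ _
  have i2 : ∀ b c : ℝ, IntervalIntegrable (fun y => ‖f' y‖ ^ 2) MeasureTheory.volume b c :=
    fun b c => (hf'.norm.pow 2).intervalIntegrable _ _
  set E := (∫ y in a..(a+L), ‖f y‖ ^ 2) + ∫ y in a..(a+L), ‖f' y‖ ^ 2 with hE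
  have hder : ∀ s, HasDerivAt (fun s => ‖f s‖ ^ 2) (2 * ((starRingEnd ℂ (f s)) * f' s).re) s := by
    intro s
    have h := (hd s).norm_sq
    convert h using 1
    simp [inner, Complex.mul_re, mul_comm]
  have hc : Continuous fun s => 2 * ((starRingEnd ℂ (f s)) * f' s).re :=
    continuous_const.mul (Complex.continuous_re.comp ((Complex.continuous_conj.comp hf).mul hf'))
  have hpt : ∀ y ∈ Set.Icc a (a + L), ‖f x‖ ^ 2 ≤ ‖f y‖ ^ 2 + E := by
    intro y hy
    have h1 := intervalIntegral.integral_eq_sub_of_hasDerivAt (a := y) (b := x)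
      (fun s _ => hder s) (hc.intervalIntegrable _ _)
    have h2 : |∫ s in y..x, 2 * ((starRingEnd ℂ (f s)) * f' s).re| ≤
        |∫ s in y..x, (‖f s‖ ^ 2 + ‖f' s‖ ^ 2)| := by
      have := intervalIntegral.norm_integral_le_abs_of_norm_le (μ := MeasureTheory.volume)
        (a := y) (b := x) (f := fun s => 2 * ((starRingEnd ℂ (f s)) * f' s).re)
        (g := fun s => ‖f s‖ ^ 2 + ‖f' s‖ ^ 2) ?_ ((i1 _ _).add (i2 _ _))
      · simpa using this
      · filter_upwards with s
        have h3 := Complex.abs_re_le_norm ((starRingEnd ℂ (f s)) * f' s)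
        rw [norm_mul, RCLike.norm_conj] at h3
        rw [Real.norm_eq_abs, abs_mul, abs_two]
        nlinarith [sq_nonneg (‖f s‖ - ‖f' s‖)]
    have h4 : |∫ s in y..x, (‖f s‖ ^ 2 + ‖f' s‖ ^ 2)| ≤
        |∫ s in a..(a+L), (‖f s‖ ^ 2 + ‖f' s‖ ^ 2)| := by
      apply intervalIntegral.abs_integral_mono_interval
      · rw [Set.uIoc_of_le haL]
        intro z hz
        rcases Set.mem_uIoc.1 hz with h | h
        · exact ⟨lt_of_le_of_lt hy.1 h.1, h.2.trans hx.2⟩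
        · exact ⟨lt_of_le_of_lt hx.1 h.1, h.2.trans hy.2⟩
      · filter_upwards with s
        show (0:ℝ) ≤ ‖f s‖ ^ 2 + ‖f' s‖ ^ 2
        positivity
      · exact (i1 _ _).add (i2 _ _)
    have h5 : |∫ s in a..(a+L), (‖f s‖ ^ 2 + ‖f' s‖ ^ 2)| = E := by
      rw [abs_of_nonneg, intervalIntegral.integral_add (i1 _ _) (i2 _ _)]
      exact intervalIntegral.integral_nonneg haL (fun s _ => by positivity)
    have h6 := le_abs_self (∫ s in y..x, 2 * ((starRingEnd ℂ (f s)) * f' s).re)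
    rw [h1] at h6 h2
    linarith
  have hint := intervalIntegral.integral_mono_on haL
    (intervalIntegrable_const (c := ‖f x‖ ^ 2)) ((i1 a (a+L)).add (intervalIntegrable_const (c := E)))
    hpt
  rw [intervalIntegral.integral_add (i1 _ _) intervalIntegrable_const] at hint
  simp only [intervalIntegral.integral_const, smul_eq_mul, add_sub_cancel_left] at hint
  have hE1 : (∫ y in a..(a+L), ‖f y‖ ^ 2) ≤ E := by
    rw [hE]
    linarith [intervalIntegral.integral_nonneg (μ := MeasureTheory.volume) haL
      (fun s _ => by positivity : ∀ s ∈ Set.Icc a (a+L), 0 ≤ ‖f' s‖ ^ 2)]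
  have hE0 : 0 ≤ E := le_trans (intervalIntegral.integral_nonneg haL (fun s _ => by positivity)) hE1
  nlinarith

lemma SDA_pointwise (u w ux wx wxx wxxx : ℂ) (κ M : ℝ) (hκ : 0 ≤ κ) (hu : ‖u‖ ≤ 2) (hw : ‖w‖ ≤ M)
    (hwx : ‖wx‖ ≤ M) :
    |2 * (starRingEnd ℂ u * (-Complex.I * κ * wxx + Complex.I *
        ((u + w) * starRingEnd ℂ (u + w) * (u + w) - w * starRingEnd ℂ w * w))).re
      + 2 * (starRingEnd ℂ ux * (-Complex.I * κ * wxxx + Complex.I *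
        ((2 * ((u + w) * starRingEnd ℂ (u + w)) * (ux + wx)
            + (u + w) ^ 2 * starRingEnd ℂ (ux + wx))
          - (2 * (w * starRingEnd ℂ w) * wx + w ^ 2 * starRingEnd ℂ wx)))).re| ≤
    (1 + 12 * (M + 2) ^ 2) * (‖u‖ ^ 2 + ‖ux‖ ^ 2) + κ ^ 2 * (‖wxx‖ ^ 2 + ‖wxxx‖ ^ 2) := by
  have hM : 0 ≤ M := (norm_nonneg _).trans hw
  have hN : ‖(u + w) * starRingEnd ℂ (u + w) * (u + w) - w * starRingEnd ℂ w * w‖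
      ≤ 3 * (M + 2) ^ 2 * ‖u‖ := by
    have e : (u + w) * starRingEnd ℂ (u + w) * (u + w) - w * starRingEnd ℂ w * w =
      (u + w) * starRingEnd ℂ (u + w) * u + u * starRingEnd ℂ (u + w) * w
        + w * starRingEnd ℂ u * w := by
      simp only [map_add]; ring
    rw [e]
    have hv : ‖u + w‖ ≤ M + 2 := (norm_add_le _ _).trans (by linarith)
    refine (norm_add₃_le).trans ?_
    simp only [norm_mul, RCLike.norm_conj]
    have a1 : ‖u + w‖ * ‖u + w‖ * ‖u‖ ≤ (M+2) * (M+2) * ‖u‖ := by gcongr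
    have a2 : ‖u‖ * ‖u + w‖ * ‖w‖ ≤ ‖u‖ * (M+2) * (M+2) := by gcongr; linarith
    have a3 : ‖w‖ * ‖u‖ * ‖w‖ ≤ (M+2) * ‖u‖ * (M+2) := by gcongr <;> linarith
    nlinarith
  have hNx : ‖(2 * ((u + w) * starRingEnd ℂ (u + w)) * (ux + wx)
            + (u + w) ^ 2 * starRingEnd ℂ (ux + wx))
          - (2 * (w * starRingEnd ℂ w) * wx + w ^ 2 * starRingEnd ℂ wx)‖
      ≤ 3 * (M + 2) ^ 2 * ‖ux‖ + 6 * (M + 2) ^ 2 * ‖u‖ := by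
    have e : (2 * ((u + w) * starRingEnd ℂ (u + w)) * (ux + wx)
            + (u + w) ^ 2 * starRingEnd ℂ (ux + wx))
          - (2 * (w * starRingEnd ℂ w) * wx + w ^ 2 * starRingEnd ℂ wx) =
      (2 * ((u + w) * starRingEnd ℂ (u + w)) * ux + (u + w) ^ 2 * starRingEnd ℂ ux)
      + (2 * (u * starRingEnd ℂ (u + w)) * wx + 2 * (w * starRingEnd ℂ u) * wx)
      + (u * (u + w) * starRingEnd ℂ wx + u * w * starRingEnd ℂ wx) := by
      simp only [map_add]; ring
    rw [e]
    have hv : ‖u + w‖ ≤ M + 2 := (norm_add_le _ _).trans (by linarith)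
    have hw2 : ‖w‖ ≤ M + 2 := by linarith
    have hwx2 : ‖wx‖ ≤ M + 2 := by linarith
    refine (norm_add₃_le).trans ?_
    refine (add_le_add_three (norm_add_le _ _) (norm_add_le _ _) (norm_add_le _ _)).trans ?_
    simp only [norm_mul, norm_pow, RCLike.norm_conj, Complex.norm_ofNat]
    have b1 : ‖u + w‖ * ‖u + w‖ * ‖ux‖ ≤ (M+2) * (M+2) * ‖ux‖ := by gcongr
    have b2 : ‖u + w‖ ^ 2 * ‖ux‖ ≤ (M+2) ^ 2 * ‖ux‖ := by gcongr
    have b3 : ‖u‖ * ‖u + w‖ * ‖wx‖ ≤ ‖u‖ * (M+2) * (M+2) := by gcongr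
    have b4 : ‖w‖ * ‖u‖ * ‖wx‖ ≤ (M+2) * ‖u‖ * (M+2) := by gcongr
    have b6 : ‖u‖ * ‖w‖ * ‖wx‖ ≤ ‖u‖ * (M+2) * (M+2) := by gcongr
    nlinarith
  have main : ∀ z y n : ℂ, |2 * (starRingEnd ℂ z * (-Complex.I * κ * y + Complex.I * n)).re| ≤
      ‖z‖ ^ 2 + κ ^ 2 * ‖y‖ ^ 2 + 2 * (‖z‖ * ‖n‖) := by
    intro z y n
    rw [abs_mul, abs_two]
    have h1 := Complex.abs_re_le_norm (starRingEnd ℂ z * (-Complex.I * κ * y + Complex.I * n))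
    have h2 : ‖starRingEnd ℂ z * (-Complex.I * κ * y + Complex.I * n)‖ ≤
        ‖z‖ * (κ * ‖y‖ + ‖n‖) := by
      rw [norm_mul, RCLike.norm_conj]
      gcongr
      refine (norm_add_le _ _).trans ?_
      simp [abs_of_nonneg hκ]
    nlinarith [sq_nonneg (‖z‖ - κ * ‖y‖)]
  refine (abs_add_le _ _).trans ?_
  refine (add_le_add (main _ _ _) (main _ _ _)).trans ?_
  have c1 := mul_le_mul_of_nonneg_left hN (norm_nonneg u)
  have c2 := mul_le_mul_of_nonneg_left hNx (norm_nonneg ux)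
  have c3 := mul_nonneg (sq_nonneg (M+2)) (sq_nonneg (‖u‖ - ‖ux‖))
  nlinarith

lemma SDA_barrier_aux {E E' : ℝ → ℝ} (hE : ∀ t, HasDerivAt E (E' t) t) (hE0 : E 0 = 0)
    {R ε T : ℝ} (hR : 0 < R) (hε : 0 < ε) (hB : ε * Real.exp (3 * R * T) ≤ 1)
    (hb : ∀ t, |t| ≤ T → E t ≤ 1 → |E' t| ≤ R * (E t + ε)) :
    ∀ t ∈ Set.Icc 0 T, E t ≤ ε * Real.exp (3 * R * t) := by
  have hBd : ∀ x, HasDerivAt (fun t => ε * Real.exp (3 * R * t))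
      (ε * (Real.exp (3 * R * x) * (3 * R))) x := by
    intro x
    have h1 : HasDerivAt (fun t : ℝ => 3 * R * t) (3 * R) x := by
      simpa using (hasDerivAt_id x).const_mul (3 * R)
    exact (h1.exp).const_mul ε
  refine image_le_of_deriv_right_lt_deriv_boundary (f := E) (f' := E')
    (fun x _ => (hE x).continuousAt.continuousWithinAt)
    (fun x _ => (hE x).hasDerivWithinAt) (by simp [hE0, hε.le]) hBd ?_
  intro x hx hEx
  have hx1 : ε * Real.exp (3 * R * x) ≤ 1 := by
    refine le_trans ?_ hB
    gcongr
    exact hx.2.le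
  have h1 := hb x (by rw [abs_of_nonneg hx.1]; exact hx.2.le) (hEx ▸ hx1)
  have h2 := le_abs_self (E' x)
  have h3 : 1 ≤ Real.exp (3 * R * x) := Real.one_le_exp (by have := hx.1; positivity)
  rw [hEx] at h1
  have h4 : ε ≤ ε * Real.exp (3 * R * x) := le_mul_of_one_le_right hε.le h3
  have h5 : 0 < R * (ε * Real.exp (3 * R * x)) := by positivity
  nlinarith

lemma SDA_barrier {E E' : ℝ → ℝ} (hE : ∀ t, HasDerivAt E (E' t) t) (hE0 : E 0 = 0)
    {R ε T : ℝ} (hR : 0 < R) (hε : 0 < ε) (hB : ε * Real.exp (3 * R * T) ≤ 1)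
    (hb : ∀ t, |t| ≤ T → E t ≤ 1 → |E' t| ≤ R * (E t + ε)) :
    ∀ t, |t| ≤ T → E t ≤ ε * Real.exp (3 * R * T) := by
  intro t ht
  have h0 : E t ≤ ε * Real.exp (3 * R * |t|) := by
    rcases le_total 0 t with h | h
    · rw [abs_of_nonneg h] at ht ⊢
      exact SDA_barrier_aux hE hE0 hR hε hB hb t ⟨h, ht⟩
    · rw [abs_of_nonpos h] at ht ⊢
      have h1 : ∀ s, HasDerivAt (fun s => E (-s)) (-(E' (-s))) s := by
        intro s
        have e : -(E' (-s)) = E' (-s) * (-1) := by ring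
        rw [e]
        exact (hE (-s)).comp s (hasDerivAt_neg s)
      have := SDA_barrier_aux h1 (by simpa using hE0) hR hε hB
        (fun s hs hs1 => by rw [abs_neg]; exact hb (-s) (by rwa [abs_neg]) hs1) (-t)
        ⟨by linarith, ht⟩
      simpa using this
  refine h0.trans ?_
  gcongr

/-! ### Derivative bound for the energy -/

/-- cubic nonlinearity -/
noncomputable def SDAcub (f : ℝ → ℝ → ℂ) : ℝ → ℝ → ℂ :=
  fun x t => f x t * starRingEnd ℂ (f x t) * f x t

lemma SDASm.cub {f : ℝ → ℝ → ℂ} (hf : SDASm f) : SDASm (SDAcub f) := by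
  have h : ContDiff ℝ (⊤ : ℕ∞) (fun p : ℝ × ℝ => starRingEnd ℂ (f p.1 p.2)) :=
    Complex.conjCLE.contDiff.comp hf
  exact (ContDiff.mul hf h).mul hf

lemma SDASm.add {f g : ℝ → ℝ → ℂ} (hf : SDASm f) (hg : SDASm g) :
    SDASm (fun x t => f x t + g x t) := ContDiff.add hf hg

lemma SDASm.sub {f g : ℝ → ℝ → ℂ} (hf : SDASm f) (hg : SDASm g) :
    SDASm (fun x t => f x t - g x t) := ContDiff.sub hf hg

lemma SDASm.cmul {f : ℝ → ℝ → ℂ} (hf : SDASm f) (c : ℂ) :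
    SDASm (fun x t => c * f x t) := ContDiff.mul contDiff_const hf

lemma SDA_cub_deriv {f : ℝ → ℝ → ℂ} (hf : SDASm f) (x t : ℝ) :
    HasDerivAt (fun y => SDAcub f y t) (2 * (f x t * starRingEnd ℂ (f x t)) * SDADx f x t
      + (f x t) ^ 2 * starRingEnd ℂ (SDADx f x t)) x := by
  have h := hf.hx x t
  have h3 := (h.mul h.star).mul h
  have e : 2 * (f x t * starRingEnd ℂ (f x t)) * SDADx f x t
      + (f x t) ^ 2 * starRingEnd ℂ (SDADx f x t) =
      (SDADx f x t * star (f x t) + f x t * star (SDADx f x t)) * f x t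
        + (f x t * star (f x t)) * SDADx f x t := by
    simp only [starRingEnd_apply]; ring
  rw [e]
  exact h3

/-- the forcing term -/
noncomputable def SDAG (κ : ℝ) (u w : ℝ → ℝ → ℂ) : ℝ → ℝ → ℂ :=
  fun x t => -Complex.I * κ * SDADx (SDADx w) x t +
    Complex.I * (SDAcub (fun x t => u x t + w x t) x t - SDAcub w x t)

lemma SDAG_sm {κ : ℝ} {u w : ℝ → ℝ → ℂ} (hu : SDASm u) (hw : SDASm w) : SDASm (SDAG κ u w) :=
  (hw.dx.dx.cmul _).add (((hu.add hw).cub.sub hw.cub).cmul _)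

lemma SDAG_dx {κ : ℝ} {u w : ℝ → ℝ → ℂ} (hu : SDASm u) (hw : SDASm w) (x t : ℝ) :
    SDADx (SDAG κ u w) x t = -Complex.I * κ * SDADx (SDADx (SDADx w)) x t + Complex.I *
        ((2 * ((u x t + w x t) * starRingEnd ℂ (u x t + w x t)) * (SDADx u x t + SDADx w x t)
            + (u x t + w x t) ^ 2 * starRingEnd ℂ (SDADx u x t + SDADx w x t))
          - (2 * (w x t * starRingEnd ℂ (w x t)) * SDADx w x t
            + (w x t) ^ 2 * starRingEnd ℂ (SDADx w x t))) := by
  have e : SDADx (fun x t => u x t + w x t) x t = SDADx u x t + SDADx w x t :=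
    ((hu.hx x t).add (hw.hx x t)).deriv
  have h1 := SDA_cub_deriv (hu.add hw) x t
  rw [e] at h1
  exact (((hw.dx.dx.hx x t).const_mul (-Complex.I * κ)).add
    ((h1.sub (SDA_cub_deriv hw x t)).const_mul Complex.I)).deriv

lemma SDA_deriv_bound {u w : ℝ → ℝ → ℂ} (hu : SDASm u) (hw : SDASm w) {a L κ M H t : ℝ}
    (hL : 1 ≤ L) (hκ : 0 ≤ κ)
    (hE : (∫ x in a..(a+L), ‖u x t‖ ^ 2) + (∫ x in a..(a+L), ‖SDADx u x t‖ ^ 2) ≤ 1)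
    (hw0 : ∀ x ∈ Set.Ioo a (a+L), ‖w x t‖ ≤ M) (hw1 : ∀ x ∈ Set.Ioo a (a+L), ‖SDADx w x t‖ ≤ M)
    (hH : (∫ x in a..(a+L), (‖SDADx (SDADx w) x t‖ ^ 2 + ‖SDADx (SDADx (SDADx w)) x t‖ ^ 2)) ≤ H) :
    |(∫ x in a..(a+L), 2 * ((starRingEnd ℂ (u x t)) * SDAG κ u w x t).re) +
      (∫ x in a..(a+L), 2 * ((starRingEnd ℂ (SDADx u x t)) * SDADx (SDAG κ u w) x t).re)| ≤
    (1 + 12 * (M + 2) ^ 2 + H) *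
      ((∫ x in a..(a+L), ‖u x t‖ ^ 2) + (∫ x in a..(a+L), ‖SDADx u x t‖ ^ 2) + κ ^ 2) := by
  have haL : a ≤ a + L := by linarith
  have hG : SDASm (SDAG κ u w) := SDAG_sm hu hw
  have c1 : Continuous fun x => 2 * ((starRingEnd ℂ (u x t)) * SDAG κ u w x t).re :=
    continuous_const.mul (Complex.continuous_re.comp
      ((Complex.continuous_conj.comp (hu.cx t)).mul (hG.cx t)))
  have c2 : Continuous fun x => 2 * ((starRingEnd ℂ (SDADx u x t)) * SDADx (SDAG κ u w) x t).re :=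
    continuous_const.mul (Complex.continuous_re.comp
      ((Complex.continuous_conj.comp (hu.dx.cx t)).mul (hG.dx.cx t)))
  have d1 : Continuous fun x => ‖u x t‖ ^ 2 := (hu.cx t).norm.pow 2
  have d2 : Continuous fun x => ‖SDADx u x t‖ ^ 2 := (hu.dx.cx t).norm.pow 2
  have d3 : Continuous fun x =>
      (‖SDADx (SDADx w) x t‖ ^ 2 + ‖SDADx (SDADx (SDADx w)) x t‖ ^ 2) :=
    ((hw.dx.dx.cx t).norm.pow 2).add ((hw.dx.dx.dx.cx t).norm.pow 2)
  have d4 : Continuous fun x =>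
      (1 + 12 * (M + 2) ^ 2) * (‖u x t‖ ^ 2 + ‖SDADx u x t‖ ^ 2) :=
    continuous_const.mul (d1.add d2)
  have d5 : Continuous fun x => κ ^ 2 *
      (‖SDADx (SDADx w) x t‖ ^ 2 + ‖SDADx (SDADx (SDADx w)) x t‖ ^ 2) :=
    continuous_const.mul d3
  rw [← intervalIntegral.integral_add (c1.intervalIntegrable _ _) (c2.intervalIntegrable _ _)]
  refine (intervalIntegral.abs_integral_le_integral_abs haL).trans ?_
  have hmono := intervalIntegral.integral_mono_on_of_le_Ioo haL
    (f := fun x => |2 * ((starRingEnd ℂ (u x t)) * SDAG κ u w x t).re +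
      2 * ((starRingEnd ℂ (SDADx u x t)) * SDADx (SDAG κ u w) x t).re|)
    (g := fun x => (1 + 12 * (M + 2) ^ 2) * (‖u x t‖ ^ 2 + ‖SDADx u x t‖ ^ 2) + κ ^ 2 *
      (‖SDADx (SDADx w) x t‖ ^ 2 + ‖SDADx (SDADx (SDADx w)) x t‖ ^ 2))
    (μ := MeasureTheory.volume)
    ((c1.add c2).abs.intervalIntegrable _ _)
    ((d4.add d5).intervalIntegrable _ _) ?_
  · refine hmono.trans ?_
    rw [intervalIntegral.integral_add (d4.intervalIntegrable _ _)
      (d5.intervalIntegrable _ _), intervalIntegral.integral_const_mul,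
      intervalIntegral.integral_const_mul, intervalIntegral.integral_add
      (d1.intervalIntegrable _ _) (d2.intervalIntegrable _ _)]
    have hE0 : 0 ≤ (∫ x in a..(a+L), ‖u x t‖ ^ 2) + (∫ x in a..(a+L), ‖SDADx u x t‖ ^ 2) :=
      add_nonneg (intervalIntegral.integral_nonneg haL (fun s _ => by positivity))
        (intervalIntegral.integral_nonneg haL (fun s _ => by positivity))
    have hH0 : 0 ≤ H := le_trans (intervalIntegral.integral_nonneg haL
      (fun s _ => by positivity)) hH
    have k1 := mul_le_mul_of_nonneg_left hH (sq_nonneg κ)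
    have k2 := mul_nonneg hH0 hE0
    have k3 : 0 ≤ (1 + 12 * (M+2)^2) * κ ^ 2 := by positivity
    nlinarith
  · intro x hx
    have hs := SDA_sobolev (hu.dx.cx t) (fun y => hu.hx y t) hL (Set.Ioo_subset_Icc_self hx)
    have hu2 : ‖u x t‖ ≤ 2 := by
      have : ‖u x t‖ ^ 2 ≤ 2 := by linarith
      nlinarith [norm_nonneg (u x t)]
    have := SDA_pointwise (u x t) (w x t) (SDADx u x t) (SDADx w x t) (SDADx (SDADx w) x t)
      (SDADx (SDADx (SDADx w)) x t) κ M hκ hu2 (hw0 x hx) (hw1 x hx)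
    rw [SDAG_dx hu hw]
    exact this

/-! ### The dispersionless profile: derivatives grow at most polynomially in time -/

/-- Functions of the form (polynomial in `t` with smooth compactly supported coefficients) times
`exp (i q(x) t)`. -/
inductive SDANice (q : ℝ → ℝ) : (ℝ → ℝ → ℂ) → Prop
  | base (p : ℝ → ℂ) (hp : ContDiff ℝ (⊤ : ℕ∞) p) (hc : HasCompactSupport p) :
      SDANice q (fun x t => p x * Complex.exp (Complex.I * ((q x : ℝ) : ℂ) * (t : ℂ)))
  | add (f g : ℝ → ℝ → ℂ) (hf : SDANice q f) (hg : SDANice q g) :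
      SDANice q (fun x t => f x t + g x t)
  | tmul (f : ℝ → ℝ → ℂ) (hf : SDANice q f) : SDANice q (fun x t => (t : ℂ) * f x t)

lemma SDA_profile_sm {p : ℝ → ℂ} {q : ℝ → ℝ} (hp : ContDiff ℝ (⊤ : ℕ∞) p)
    (hq : ContDiff ℝ (⊤ : ℕ∞) q) :
    SDASm (fun x t => p x * Complex.exp (Complex.I * ((q x : ℝ) : ℂ) * (t : ℂ))) := by
  have h1 : ContDiff ℝ (⊤ : ℕ∞) (fun z : ℝ × ℝ => p z.1) := hp.comp contDiff_fst
  have h2 : ContDiff ℝ (⊤ : ℕ∞) (fun z : ℝ × ℝ => ((q z.1 : ℝ) : ℂ)) :=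
    Complex.ofRealCLM.contDiff.comp (hq.comp contDiff_fst)
  have h3 : ContDiff ℝ (⊤ : ℕ∞) (fun z : ℝ × ℝ => ((z.2 : ℝ) : ℂ)) :=
    Complex.ofRealCLM.contDiff.comp contDiff_snd
  exact h1.mul ((contDiff_const.mul h2).mul h3).cexp

lemma SDANice.sm {q : ℝ → ℝ} (hq : ContDiff ℝ (⊤ : ℕ∞) q) {f : ℝ → ℝ → ℂ} (hf : SDANice q f) :
    SDASm f := by
  induction hf with
  | base p hp hc => exact SDA_profile_sm hp hq
  | add f g _ _ h1 h2 => exact h1.add h2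
  | tmul f _ h =>
    have h3 : ContDiff ℝ (⊤ : ℕ∞) (fun z : ℝ × ℝ => ((z.2 : ℝ) : ℂ)) :=
      Complex.ofRealCLM.contDiff.comp contDiff_snd
    exact ContDiff.mul h3 h

lemma SDANice.dx {q : ℝ → ℝ} (hq : ContDiff ℝ (⊤ : ℕ∞) q) {f : ℝ → ℝ → ℂ} (hf : SDANice q f) :
    SDANice q (SDADx f) := by
  induction hf with
  | base p hp hc =>
    have hp' : ContDiff ℝ (⊤ : ℕ∞) (deriv p) := ((contDiff_infty_iff_deriv (f := p)).1 hp).2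
    have hq' : ContDiff ℝ (⊤ : ℕ∞) (deriv q) := ((contDiff_infty_iff_deriv (f := q)).1 hq).2
    have hr : ContDiff ℝ (⊤ : ℕ∞) (fun x => Complex.I * ((deriv q x : ℝ) : ℂ) * p x) :=
      (contDiff_const.mul (Complex.ofRealCLM.contDiff.comp hq')).mul hp
    have key := SDANice.add (q := q) _ _ (SDANice.base _ hp' hc.deriv)
      (SDANice.tmul _ (SDANice.base _ hr hc.mul_left))
    convert key using 1
    ext x t
    have h1 : HasDerivAt p (deriv p x) x := (hp.differentiable (by simp) x).hasDerivAt
    have h2 : HasDerivAt q (deriv q x) x := (hq.differentiable (by simp) x).hasDerivAt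
    have h3 := h1.mul ((h2.ofReal_comp.const_mul Complex.I).mul_const (t : ℂ)).cexp
    refine (HasDerivAt.deriv h3).trans ?_
    ring
  | add f g hf hg h1 h2 =>
    convert SDANice.add _ _ h1 h2 using 1
    ext x t
    exact (((hf.sm hq).hx x t).add ((hg.sm hq).hx x t)).deriv
  | tmul f hf h =>
    convert SDANice.tmul _ h using 1
    ext x t
    exact (((hf.sm hq).hx x t).const_mul (t : ℂ)).deriv

lemma SDANice.bound {q : ℝ → ℝ} {f : ℝ → ℝ → ℂ} (hf : SDANice q f) :
    ∃ (g : ℝ → ℝ) (k : ℕ), Continuous g ∧ HasCompactSupport g ∧ (∀ x, 0 ≤ g x) ∧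
      ∀ x t, ‖f x t‖ ≤ (1 + |t|) ^ k * g x := by
  induction hf with
  | base p hp hc =>
    refine ⟨fun x => ‖p x‖, 0, hp.continuous.norm, hc.norm, fun x => norm_nonneg _, ?_⟩
    intro x t
    have : Complex.I * ((q x : ℝ) : ℂ) * (t : ℂ) = Complex.I * ((q x * t : ℝ) : ℂ) := by
      push_cast; ring
    rw [norm_mul, this, Complex.norm_exp_I_mul_ofReal]
    simp
  | add f1 f2 _ _ h1 h2 =>
    obtain ⟨g1, k1, c1, s1, n1, b1⟩ := h1
    obtain ⟨g2, k2, c2, s2, n2, b2⟩ := h2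
    refine ⟨fun x => g1 x + g2 x, k1 + k2, c1.add c2, s1.add s2,
      fun x => add_nonneg (n1 x) (n2 x), ?_⟩
    intro x t
    have ht : 1 ≤ 1 + |t| := by linarith [abs_nonneg t]
    refine (norm_add_le _ _).trans ?_
    have e1 : (1 + |t|) ^ k1 ≤ (1 + |t|) ^ (k1 + k2) := pow_le_pow_right₀ ht (by omega)
    have e2 : (1 + |t|) ^ k2 ≤ (1 + |t|) ^ (k1 + k2) := pow_le_pow_right₀ ht (by omega)
    have a1 := mul_le_mul_of_nonneg_right e1 (n1 x)
    have a2 := mul_le_mul_of_nonneg_right e2 (n2 x)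
    linarith [b1 x t, b2 x t]
  | tmul f _ h =>
    obtain ⟨g, k, c, s, n, b⟩ := h
    refine ⟨g, k + 1, c, s, n, ?_⟩
    intro x t
    rw [norm_mul, Complex.norm_real, Real.norm_eq_abs, pow_succ]
    have h0 : 0 ≤ (1 + |t|) ^ k * g x := mul_nonneg (by positivity) (n x)
    have h1 := mul_le_mul_of_nonneg_left (b x t) (abs_nonneg t)
    nlinarith

lemma SDANice.sup {q : ℝ → ℝ} {f : ℝ → ℝ → ℂ} (hf : SDANice q f) :
    ∃ (K : ℝ) (k : ℕ), 0 ≤ K ∧ ∀ x t, ‖f x t‖ ≤ K * (1 + |t|) ^ k := by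
  obtain ⟨g, k, c, s, n, b⟩ := hf.bound
  obtain ⟨K, hK⟩ := s.exists_bound_of_continuous c
  refine ⟨K, k, (norm_nonneg _).trans (hK 0), fun x t => (b x t).trans ?_⟩
  rw [mul_comm]
  gcongr
  exact (le_abs_self _).trans (hK x)

lemma SDANice.l2 {q : ℝ → ℝ} (hq : ContDiff ℝ (⊤ : ℕ∞) q) {f : ℝ → ℝ → ℂ} (hf : SDANice q f) :
    ∃ (K : ℝ) (k : ℕ), 0 ≤ K ∧ ∀ a b t : ℝ, a ≤ b →
      (∫ x in a..b, ‖f x t‖ ^ 2) ≤ K * (1 + |t|) ^ k := by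
  obtain ⟨g, k, c, s, n, b⟩ := hf.bound
  have c2 : Continuous fun x => g x ^ 2 := c.pow 2
  have s2 : HasCompactSupport fun x => g x ^ 2 := by
    have : HasCompactSupport fun x => g x * g x := s.mul_left
    simpa [pow_two] using this
  have hi := c2.integrable_of_hasCompactSupport (μ := MeasureTheory.volume) s2
  refine ⟨∫ x, g x ^ 2, 2 * k, MeasureTheory.integral_nonneg fun x => by positivity, ?_⟩
  intro a b' t hab
  calc (∫ x in a..b', ‖f x t‖ ^ 2) ≤ ∫ x in a..b', (1 + |t|) ^ (2 * k) * g x ^ 2 := by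
        apply intervalIntegral.integral_mono_on hab
        · exact (((hf.sm hq).cx t).norm.pow 2).intervalIntegrable _ _
        · exact (continuous_const.mul c2).intervalIntegrable _ _
        · intro x _
          have := pow_le_pow_left₀ (norm_nonneg _) (b x t) 2
          refine this.trans (le_of_eq ?_)
          ring
    _ = (1 + |t|) ^ (2 * k) * ∫ x in a..b', g x ^ 2 := intervalIntegral.integral_const_mul _ _
    _ ≤ (1 + |t|) ^ (2 * k) * ∫ x, g x ^ 2 := by
        gcongr
        rw [intervalIntegral.integral_of_le hab]
        exact MeasureTheory.setIntegral_le_integral hi (by filter_upwards with x; positivity)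
    _ = _ := mul_comm _ _

lemma SDA_profile_bounds {φ : ℝ → ℂ} (hφ : ContDiff ℝ (⊤ : ℕ∞) φ) (hc : HasCompactSupport φ)
    {W : ℝ → ℝ → ℂ} (hW : W = fun (x t : ℝ) => φ x *
      Complex.exp (Complex.I * ((‖φ x‖ ^ 2 : ℝ) : ℂ) * (t : ℂ))) :
    ∃ (K : ℝ) (m : ℕ), 0 ≤ K ∧ (∀ x t, ‖W x t‖ ≤ K * (1 + |t|) ^ m) ∧
      (∀ x t, ‖SDADx W x t‖ ≤ K * (1 + |t|) ^ m) ∧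
      ∀ a b t : ℝ, a ≤ b → (∫ x in a..b, (‖SDADx (SDADx W) x t‖ ^ 2 +
        ‖SDADx (SDADx (SDADx W)) x t‖ ^ 2)) ≤ K * (1 + |t|) ^ m := by
  have hq : ContDiff ℝ (⊤ : ℕ∞) (fun x => ‖φ x‖ ^ 2) := hφ.norm_sq ℝ
  have n0 : SDANice (fun x => ‖φ x‖ ^ 2) W := by
    rw [hW]; exact SDANice.base φ hφ hc
  have n1 := n0.dx hq
  have n2 := n1.dx hq
  have n3 := n2.dx hq
  obtain ⟨K0, k0, p0, b0⟩ := n0.sup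
  obtain ⟨K1, k1, p1, b1⟩ := n1.sup
  obtain ⟨K2, k2, p2, b2⟩ := n2.l2 hq
  obtain ⟨K3, k3, p3, b3⟩ := n3.l2 hq
  have mono : ∀ (t A : ℝ) (k : ℕ), 0 ≤ A → k ≤ k0 + k1 + k2 + k3 →
      A * (1 + |t|) ^ k ≤ A * (1 + |t|) ^ (k0 + k1 + k2 + k3) := by
    intro t A k hA hk
    have ht : 1 ≤ 1 + |t| := by linarith [abs_nonneg t]
    exact mul_le_mul_of_nonneg_left (pow_le_pow_right₀ ht hk) hA
  refine ⟨K0 + K1 + K2 + K3, k0 + k1 + k2 + k3, by positivity, ?_, ?_, ?_⟩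
  · intro x t
    refine ((b0 x t).trans (mono t K0 k0 p0 (by omega))).trans ?_
    gcongr; linarith
  · intro x t
    refine ((b1 x t).trans (mono t K1 k1 p1 (by omega))).trans ?_
    gcongr; linarith
  · intro a b t hab
    have d2 : Continuous fun x => ‖SDADx (SDADx W) x t‖ ^ 2 := ((n2.sm hq).cx t).norm.pow 2
    have d3 : Continuous fun x => ‖SDADx (SDADx (SDADx W)) x t‖ ^ 2 := ((n3.sm hq).cx t).norm.pow 2
    rw [intervalIntegral.integral_add (d2.intervalIntegrable _ _) (d3.intervalIntegrable _ _)]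
    have h2 := (b2 a b t hab).trans (mono t K2 k2 p2 (by omega))
    have h3 := (b3 a b t hab).trans (mono t K3 k3 p3 (by omega))
    have : 0 ≤ (K0 + K1) * (1 + |t|) ^ (k0 + k1 + k2 + k3) := by positivity
    nlinarith

lemma SDADx_congr {f g : ℝ → ℝ → ℂ} {S : Set ℝ} (hS : IsOpen S) {t : ℝ}
    (h : ∀ x ∈ S, f x t = g x t) : ∀ x ∈ S, SDADx f x t = SDADx g x t := by
  intro x hx
  apply Filter.EventuallyEq.deriv_eq
  filter_upwards [hS.mem_nhds hx] with y hy using h y hy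

lemma SDA_periodization {φ : ℝ → ℂ} {L : ℝ} (hL : 0 < L)
    (hs : tsupport φ ⊆ Set.Ioo (-(L/2)) (L/2)) {x : ℝ} (hx : x ∈ Set.Ioo (-(L/2)) (L/2)) :
    periodization φ L x = φ x := by
  unfold periodization
  rw [tsum_eq_single 0]
  · simp
  · intro n hn
    apply image_eq_zero_of_notMem_tsupport
    intro hmem
    have h := hs hmem
    rcases lt_or_gt_of_ne hn with h0 | h0
    · have : (n : ℝ) ≤ -1 := by exact_mod_cast Int.le_sub_one_of_lt h0
      nlinarith [h.1, h.2, hx.1, hx.2]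
    · have : (1 : ℝ) ≤ n := by exact_mod_cast h0
      nlinarith [h.1, h.2, hx.1, hx.2]

lemma SDA_param (K γ : ℝ) (m : ℕ) (hK : 0 < K) (hγ : 0 < γ) :
    ∃ c : ℝ, 0 < c ∧ ∀ l : ℝ, 1 ≤ l → 0 ≤ c * l ^ c ∧
      3 * (K * (1 + c * l ^ c) ^ m) * (c * l ^ c) ≤ γ * l := by
  refine ⟨min (1 / ((m:ℝ) + 1)) (γ / (3 * K * 2 ^ m)), by positivity, ?_⟩
  set c := min (1 / ((m:ℝ) + 1)) (γ / (3 * K * 2 ^ m)) with hc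
  have hc0 : 0 < c := by positivity
  have hc1 : c * (m + 1) ≤ 1 := by
    have := min_le_left (1 / ((m:ℝ) + 1)) (γ / (3 * K * 2 ^ m))
    rw [← hc, le_div_iff₀ (by positivity)] at this
    exact this
  have hc2 : c * (3 * K * 2 ^ m) ≤ γ := by
    have := min_le_right (1 / ((m:ℝ) + 1)) (γ / (3 * K * 2 ^ m))
    rw [← hc, le_div_iff₀ (by positivity)] at this
    exact this
  have hc3 : c ≤ 1 := by nlinarith [(Nat.cast_nonneg m : (0:ℝ) ≤ m)]
  intro l hl
  have hl0 : 0 ≤ l := by linarith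
  have hy : 1 ≤ l ^ c := Real.one_le_rpow hl hc0.le
  have hy0 : 0 ≤ l ^ c := by linarith
  refine ⟨by positivity, ?_⟩
  have h1 : 1 + c * l ^ c ≤ 2 * l ^ c := by nlinarith
  have h2 : (1 + c * l ^ c) ^ m ≤ (2 * l ^ c) ^ m := pow_le_pow_left₀ (by positivity) h1 m
  have h3 : (l ^ c) ^ (m + 1) ≤ l := by
    rw [← Real.rpow_natCast, ← Real.rpow_mul hl0]
    calc l ^ (c * ((m + 1 : ℕ) : ℝ)) ≤ l ^ (1:ℝ) := by
          apply Real.rpow_le_rpow_of_exponent_le hl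
          push_cast; exact hc1
      _ = l := Real.rpow_one l
  calc 3 * (K * (1 + c * l ^ c) ^ m) * (c * l ^ c)
      ≤ 3 * (K * (2 * l ^ c) ^ m) * (c * l ^ c) := by gcongr
    _ = c * (3 * K * 2 ^ m) * (l ^ c) ^ (m + 1) := by rw [mul_pow, pow_succ]; ring
    _ ≤ γ * l := by gcongr

lemma SDA_rate (K P : ℝ) (hK : 0 ≤ K) (hP1 : 1 ≤ P) :
    1 + 12 * (K * P + 2) ^ 2 + K * P ≤ (1 + 12 * (K + 2) ^ 2 + K) * P ^ 2 := by
  have e1 : P ≤ P ^ 2 := by nlinarith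
  have e2 : (1:ℝ) ≤ P ^ 2 := by nlinarith
  have e3 : (K * P + 2) ^ 2 ≤ ((K + 2) * P) ^ 2 := by
    apply pow_le_pow_left₀ (by positivity)
    linarith
  have e4 : K * P ≤ K * P ^ 2 := mul_le_mul_of_nonneg_left e1 hK
  rw [mul_pow] at e3
  linarith

set_option maxHeartbeats 1000000 in
/-- Approximation of the small dispersion cubic NLS by the dispersionless ODE
on scaled tori, with constants uniform in the period. -/
theorem small_dispersion_approximation (φ : ℝ → ℂ)
    (hφ : ContDiff ℝ (⊤ : ℕ∞) φ) (hφsupp : HasCompactSupport φ)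
    (β : ℝ) (hβ : β ∈ Set.Ioo (0:ℝ) 2) :
    ∃ (c C δ₀ L₀ : ℝ), 0 < c ∧ 0 < C ∧ 0 < δ₀ ∧ 1 ≤ L₀ ∧
      ∀ L : ℝ, L₀ ≤ L → tsupport φ ⊆ Set.Ioo (-(L/2)) (L/2) →
      ∀ δ : ℝ, δ ∈ Set.Ioc (0:ℝ) δ₀ →
      ∀ v : ℝ → ℝ → ℂ,
        ContDiff ℝ (⊤ : ℕ∞) (fun p : ℝ × ℝ => v p.1 p.2) →
        (∀ x t : ℝ, v (x + L) t = v x t) →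
        (∀ x t : ℝ,
          Complex.I * deriv (fun τ => v x τ) t
            - (δ : ℂ)^2 * deriv (deriv fun y => v y t) x
            + (‖v x t‖ : ℂ)^2 * v x t = 0) →
        (∀ x : ℝ, v x 0 = periodization φ L x) →
        ∀ t : ℝ, |t| ≤ c * (Real.log (1/δ)) ^ c →
          HsNormL L 1 (fun x => v x t
              - periodization φ L x *
                Complex.exp (Complex.I * ((‖periodization φ L x‖^2 : ℝ) : ℂ) * (t : ℂ)))
            ≤ C * δ ^ β := by
  classical
  obtain ⟨W, hW⟩ : ∃ W : ℝ → ℝ → ℂ, W = fun (x t : ℝ) => φ x *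
    Complex.exp (Complex.I * ((‖φ x‖ ^ 2 : ℝ) : ℂ) * (t : ℂ)) := ⟨_, rfl⟩
  obtain ⟨K, m, hK, hb0, hb1, hb2⟩ := SDA_profile_bounds hφ hφsupp hW
  have hK' : 0 < 1 + 12 * (K + 2) ^ 2 + K := by positivity
  obtain ⟨c, hc, hpar⟩ := SDA_param (1 + 12 * (K + 2) ^ 2 + K) (4 - 2 * β) (2 * m) hK'
    (by linarith [hβ.2])
  refine ⟨c, 1, Real.exp (-1), 1, hc, one_pos, Real.exp_pos _, le_rfl, ?_⟩
  intro L hL1 hsupp δ hδ v hv hvper hveq hv0 t0 ht0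
  have hL0 : 0 < L := by linarith
  have hδ0 : 0 < δ := hδ.1
  -- the logarithm
  obtain ⟨l, hl⟩ : ∃ l, l = Real.log (1 / δ) := ⟨_, rfl⟩
  have hδl : δ = Real.exp (-l) := by
    rw [hl, one_div, Real.log_inv, neg_neg, Real.exp_log hδ0]
  have hl1 : 1 ≤ l := by
    have := hδ.2
    rw [hδl] at this
    linarith [Real.exp_le_exp.1 this]
  rw [← hl] at ht0
  obtain ⟨hT0, hTb⟩ := hpar l hl1
  obtain ⟨T, hT⟩ : ∃ T, T = c * l ^ c := ⟨_, rfl⟩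
  rw [← hT] at ht0 hT0 hTb
  -- the profile
  obtain ⟨pL, hpL⟩ : ∃ pL : ℝ → ℂ, pL = fun x => periodization φ L x := ⟨_, rfl⟩
  have hpLv : pL = fun x => v x 0 := by rw [hpL]; ext x; exact (hv0 x).symm
  have hpLs : ContDiff ℝ (⊤ : ℕ∞) pL := by
    rw [hpLv]; exact hv.comp (contDiff_id.prodMk contDiff_const)
  have hpLper : ∀ x, pL (x + L) = pL x := by intro x; rw [hpLv]; exact hvper x 0
  obtain ⟨w, hwdef⟩ : ∃ w : ℝ → ℝ → ℂ, w = fun (x t : ℝ) => pL x *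
    Complex.exp (Complex.I * ((‖pL x‖ ^ 2 : ℝ) : ℂ) * (t : ℂ)) := ⟨_, rfl⟩
  have hwS : SDASm w := by rw [hwdef]; exact SDA_profile_sm hpLs (hpLs.norm_sq ℝ)
  have hvS : SDASm v := hv
  obtain ⟨u, hudef⟩ : ∃ u : ℝ → ℝ → ℂ, u = fun x t => v x t - w x t := ⟨_, rfl⟩
  have huS : SDASm u := by rw [hudef]; exact hvS.sub hwS
  have huw : (fun x t => u x t + w x t) = v := by rw [hudef]; ext x t; simp
  have huper : ∀ x t, u (x + L) t = u x t := by
    intro x t; rw [hudef, hwdef]; simp only [hvper, hpLper]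
  -- the equation for the profile
  have hwnorm : ∀ x t, ‖w x t‖ = ‖pL x‖ := by
    intro x t
    have : Complex.I * ((‖pL x‖ ^ 2 : ℝ) : ℂ) * (t : ℂ) =
        Complex.I * ((‖pL x‖ ^ 2 * t : ℝ) : ℂ) := by push_cast; ring
    rw [hwdef]
    simp only []
    rw [norm_mul, this, Complex.norm_exp_I_mul_ofReal, mul_one]
  have hwt : ∀ x t, SDADt w x t = Complex.I * SDAcub w x t := by
    intro x t
    have h1 : HasDerivAt (fun s : ℝ => (s : ℂ)) 1 t := Complex.ofRealCLM.hasDerivAt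
    have h2 := ((h1.const_mul (Complex.I * ((‖pL x‖ ^ 2 : ℝ) : ℂ))).cexp).const_mul (pL x)
    have h3 := h2.deriv
    have h4 : SDADt w x t = deriv (fun y : ℝ => pL x *
        Complex.exp (Complex.I * ((‖pL x‖ ^ 2 : ℝ) : ℂ) * (y : ℂ))) t := by rw [hwdef]; rfl
    rw [h4, h3]
    unfold SDAcub
    rw [Complex.mul_conj', hwnorm, hwdef]
    push_cast
    ring
  have hvt : ∀ x t, SDADt v x t = -Complex.I * ((δ ^ 2 : ℝ) : ℂ) * SDADx (SDADx v) x t +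
      Complex.I * SDAcub v x t := by
    intro x t
    have h : Complex.I * SDADt v x t - (δ : ℂ) ^ 2 * SDADx (SDADx v) x t +
      (‖v x t‖ : ℂ) ^ 2 * v x t = 0 := hveq x t
    unfold SDAcub
    rw [Complex.mul_conj']
    push_cast
    linear_combination (-Complex.I) * h + SDADt v x t * Complex.I_sq
  have hut : ∀ x t, SDADt u x t = -Complex.I * ((δ ^ 2 : ℝ) : ℂ) * SDADx (SDADx u) x t +
      SDAG (δ ^ 2) u w x t := by
    intro x t
    have h1 : SDADt u x t = SDADt v x t - SDADt w x t := by
      rw [hudef]; exact ((hvS.ht x t).sub (hwS.ht x t)).deriv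
    have h2 : SDADx u = fun x t => SDADx v x t - SDADx w x t := by
      rw [hudef]; ext x t; exact ((hvS.hx x t).sub (hwS.hx x t)).deriv
    have h3 : SDADx (SDADx u) x t = SDADx (SDADx v) x t - SDADx (SDADx w) x t := by
      rw [h2]; exact ((hvS.dx.hx x t).sub (hwS.dx.hx x t)).deriv
    unfold SDAG
    rw [h1, h3, huw, hvt, hwt]
    ring
  have hGS : SDASm (SDAG (δ ^ 2) u w) := SDAG_sm huS hwS
  have huxt : ∀ x t, SDADt (SDADx u) x t =
      -Complex.I * ((δ ^ 2 : ℝ) : ℂ) * SDADx (SDADx (SDADx u)) x t +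
      SDADx (SDAG (δ ^ 2) u w) x t := by
    intro x t
    rw [huS.comm]
    have e : SDADt u = fun x t => -Complex.I * ((δ ^ 2 : ℝ) : ℂ) * SDADx (SDADx u) x t +
      SDAG (δ ^ 2) u w x t := by ext x t; exact hut x t
    rw [e]
    exact (((huS.dx.dx.hx x t).const_mul _).add (hGS.hx x t)).deriv
  -- bounds on the profile
  have hIoo : Set.Ioo (-(L/2)) (-(L/2) + L) = Set.Ioo (-(L/2)) (L/2) := by
    congr 1; ring
  have hloc0 : ∀ t, ∀ x ∈ Set.Ioo (-(L/2)) (-(L/2) + L), w x t = W x t := by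
    intro t x hx
    rw [hIoo] at hx
    have : pL x = φ x := by rw [hpL]; exact SDA_periodization hL0 hsupp hx
    rw [hwdef, hW]
    simp only [this]
  have hloc1 : ∀ t, ∀ x ∈ Set.Ioo (-(L/2)) (-(L/2) + L), SDADx w x t = SDADx W x t :=
    fun t => SDADx_congr isOpen_Ioo (hloc0 t)
  have hloc2 : ∀ t, ∀ x ∈ Set.Ioo (-(L/2)) (-(L/2) + L), SDADx (SDADx w) x t = SDADx (SDADx W) x t :=
    fun t => SDADx_congr isOpen_Ioo (hloc1 t)
  have hloc3 : ∀ t, ∀ x ∈ Set.Ioo (-(L/2)) (-(L/2) + L), SDADx (SDADx (SDADx w)) x t = SDADx (SDADx (SDADx W)) x t :=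
    fun t => SDADx_congr isOpen_Ioo (hloc2 t)
  have haL : -(L/2) ≤ -(L/2) + L := by linarith
  -- the energy
  obtain ⟨E, hEdef⟩ : ∃ E : ℝ → ℝ, E = fun t => (∫ x in (-(L/2))..(-(L/2) + L), ‖u x t‖ ^ 2) +
    (∫ x in (-(L/2))..(-(L/2) + L), ‖SDADx u x t‖ ^ 2) := ⟨_, rfl⟩
  have hEd : ∀ t, HasDerivAt E
      ((∫ x in (-(L/2))..(-(L/2) + L), 2 * ((starRingEnd ℂ (u x t)) * SDAG (δ ^ 2) u w x t).re) +
      (∫ x in (-(L/2))..(-(L/2) + L),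
        2 * ((starRingEnd ℂ (SDADx u x t)) * SDADx (SDAG (δ ^ 2) u w) x t).re)) t := by
    intro t
    rw [hEdef]
    exact (SDA_energy huS hGS huper hut t).add
      (SDA_energy huS.dx hGS.dx (SDADx_per huper) huxt t)
  have hu0 : ∀ x, u x 0 = 0 := by
    intro x; rw [hudef, hwdef, hpLv]; simp
  have hux0 : ∀ x, SDADx u x 0 = 0 := by
    intro x; unfold SDADx; simp [hu0]
  have hE0 : E 0 = 0 := by rw [hEdef]; simp [hu0, hux0]
  obtain ⟨R, hR⟩ : ∃ R, R = (1 + 12 * (K + 2) ^ 2 + K) * (1 + T) ^ (2 * m) := ⟨_, rfl⟩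
  rw [← hR] at hTb
  have hR0 : 0 < R := by rw [hR]; positivity
  have hδ4 : (δ ^ 2) ^ 2 = Real.exp (-(4 * l)) := by
    rw [hδl, ← Real.exp_nat_mul, ← Real.exp_nat_mul]; congr 1; push_cast; ring
  have hδβ : δ ^ β = Real.exp (-(β * l)) := by
    rw [hδl, ← Real.exp_mul]; congr 1; ring
  have hBle : (δ ^ 2) ^ 2 * Real.exp (3 * R * T) ≤ (δ ^ β) ^ 2 := by
    rw [hδ4, hδβ, ← Real.exp_add, ← Real.exp_nat_mul]
    apply Real.exp_le_exp.2
    push_cast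
    linarith
  have hβ1 : (δ ^ β) ^ 2 ≤ 1 := by
    rw [hδβ, ← Real.exp_nat_mul]
    apply Real.exp_le_one_iff.2
    have := mul_pos hβ.1 (by linarith : 0 < l)
    push_cast
    linarith
  have hbar := SDA_barrier hEd hE0 hR0 (by positivity : 0 < (δ ^ 2) ^ 2) (hBle.trans hβ1) ?_ t0 ht0
  · have hEt : E t0 ≤ (δ ^ β) ^ 2 := hbar.trans hBle
    have hfin := SDA_Hs_le hL0 (fun x => u x t0) (fun x => SDADx u x t0) (huS.dx.cx t0)
      (fun x => huS.hx x t0) (by have := huper 0 t0; simpa using this)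
    have hp1 : Function.Periodic (fun x => ‖u x t0‖ ^ 2) L := fun x => by simp only [huper]
    have hp2 : Function.Periodic (fun x => ‖SDADx u x t0‖ ^ 2) L :=
      fun x => by simp only [SDADx_per huper]
    have i1 := hp1.intervalIntegral_add_eq 0 (-(L/2))
    have i2 := hp2.intervalIntegral_add_eq 0 (-(L/2))
    rw [zero_add] at i1 i2
    rw [i1, i2] at hfin
    have hEt' : (∫ x in (-(L/2))..(-(L/2) + L), ‖u x t0‖ ^ 2) +
      (∫ x in (-(L/2))..(-(L/2) + L), ‖SDADx u x t0‖ ^ 2) ≤ (δ ^ β) ^ 2 := by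
      rw [hEdef] at hEt; exact hEt
    have hfin2 := hfin.trans (Real.sqrt_le_sqrt hEt')
    rw [Real.sqrt_sq (by positivity)] at hfin2
    rw [one_mul]
    rw [hudef, hwdef, hpL] at hfin2
    exact hfin2
  · intro t ht hE1
    have ht1 : 1 ≤ 1 + |t| := by linarith [abs_nonneg t]
    have hP : (1 + |t|) ^ m ≤ (1 + T) ^ m := by gcongr
    have hP1 : 1 ≤ (1 + T) ^ m := one_le_pow₀ (by linarith)
    obtain ⟨P, hPd⟩ : ∃ P, P = (1 + T) ^ m := ⟨_, rfl⟩
    rw [← hPd] at hP hP1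
    have hKP : K * (1 + |t|) ^ m ≤ K * P := by gcongr
    have hH : (∫ x in (-(L/2))..(-(L/2) + L), (‖SDADx (SDADx w) x t‖ ^ 2 +
        ‖SDADx (SDADx (SDADx w)) x t‖ ^ 2)) ≤ K * P := by
      rw [intervalIntegral.integral_congr_Ioo_of_le haL
        (fun x hx => by rw [hloc2 t x hx, hloc3 t x hx])]
      exact (hb2 _ _ t haL).trans hKP
    have hE1' : (∫ x in (-(L/2))..(-(L/2) + L), ‖u x t‖ ^ 2) +
        (∫ x in (-(L/2))..(-(L/2) + L), ‖SDADx u x t‖ ^ 2) ≤ 1 := by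
      rw [hEdef] at hE1; exact hE1
    have hmain := SDA_deriv_bound (κ := δ ^ 2) (M := K * P) huS hwS hL1 (by positivity) hE1'
      (fun x hx => by rw [hloc0 t x hx]; exact (hb0 x t).trans hKP)
      (fun x hx => by rw [hloc1 t x hx]; exact (hb1 x t).trans hKP) hH
    refine hmain.trans ?_
    have hEq : E t = (∫ x in (-(L/2))..(-(L/2) + L), ‖u x t‖ ^ 2) +
        (∫ x in (-(L/2))..(-(L/2) + L), ‖SDADx u x t‖ ^ 2) := by rw [hEdef]
    rw [← hEq]
    have hEnn : 0 ≤ E t := by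
      rw [hEq]
      exact add_nonneg (intervalIntegral.integral_nonneg haL (fun s _ => by positivity))
        (intervalIntegral.integral_nonneg haL (fun s _ => by positivity))
    apply mul_le_mul_of_nonneg_right _ (by positivity)
    rw [hR, mul_comm 2 m, pow_mul, ← hPd]
    exact SDA_rate K P hK hP1
end
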